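/- (Ford–Green–Konyagin–Tao; Maynard) For every constant M > 0 there exists X_0 such that for all X ≥ X_0 one has G(X) ≥ M · (log X · log_2 X · log_4 X) / (log_3 X)^2. -/

import Mathlib

open Real Filter

/-- `nthPrime n` is the `n`-th prime number `p_n` (so `p_1 = 2`, `p_2 = 3`, ...). -/
noncomputable def nthPrime (n : ℕ) : ℕ := Nat.nth Nat.Prime (n - 1)

/-- `iterlog k x` is the `k`-fold iterated natural logarithm `log_k x`,
with `iterlog 1 x = log x` and `iterlog (k+1) x = log (iterlog k x)`. -/
noncomputable def iterlog : ℕ → ℝ → ℝ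
  | 0, x => x
  | k + 1, x => Real.log (iterlog k x)

/-- `G X` is the maximal gap between consecutive primes `p_{n+1} ≤ X`. -/
noncomputable def G (X : ℝ) : ℝ :=
  sSup {d : ℝ | ∃ n : ℕ, 1 ≤ n ∧ (nthPrime (n + 1) : ℝ) ≤ X ∧
    d = (nthPrime (n + 1) : ℝ) - nthPrime n}

set_option linter.all false
open Real Filter Finset
local notation "mll" => mul_le_mul_of_nonneg_left
local notation "mlr" => mul_le_mul_of_nonneg_right
local notation "pmd" => Finset.prod_mul_distrib
local notation "ddi" => div_le_div_iff₀
abbrev HC {ι : Type} (q : ι → ℕ) : Prop := ∀ l l', l ≠ l' → (q l).Coprime (q l')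
lemma tensor_le {κ Ω : Type} [Fintype κ] (ε : ℝ) (ι : Type) [Fintype ι] [DecidableEq ι] :
    ∀ (s : ι → Finset Ω) (wt : ι → Ω → ℝ) (φ : ι → κ → Ω → ℝ) (c : ι → κ → ℝ)
    (_ : ∀ l ω, 0 ≤ wt l ω) (_ : ∀ l a, 0 ≤ c l a)
    (_ : ∀ l (β : κ → ℝ), ε * ∑ ω ∈ s l, wt l ω * (∑ a, β a * φ l a ω) ^ 2 ≤ ε * ∑ a, c l a * β a ^ 2)
    (y : (ι → κ) → ℝ),
    ε * ∑ r, ∑ r', y r * y r' * ∏ l, (∑ ω ∈ s l, wt l ω * φ l (r l) ω * φ l (r' l) ω)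
      ≤ ε * ∑ r, (∏ l, c l (r l)) * y r ^ 2 := by
  classical
  refine Fintype.induction_empty_option (P := fun ι _ => ∀ [DecidableEq ι] (s : ι → Finset Ω) (wt : ι → Ω → ℝ) (φ : ι → κ → Ω → ℝ) (c : ι → κ → ℝ)
    (_ : ∀ l ω, 0 ≤ wt l ω) (_ : ∀ l a, 0 ≤ c l a)
    (_ : ∀ l (β : κ → ℝ), ε * ∑ ω ∈ s l, wt l ω * (∑ a, β a * φ l a ω) ^ 2 ≤ ε * ∑ a, c l a * β a ^ 2)
    (y : (ι → κ) → ℝ),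
    ε * ∑ r, ∑ r', y r * y r' * ∏ l, (∑ ω ∈ s l, wt l ω * φ l (r l) ω * φ l (r' l) ω)
      ≤ ε * ∑ r, (∏ l, c l (r l)) * y r ^ 2) ?_ ?_ ?_ ι
  · intro α β _ e ih _ s wt φ c hπ hc h y
    let _ : Fintype α := Fintype.ofEquiv _ e.symm
    have := ih (s ∘ e) (wt ∘ e) (φ ∘ e) (c ∘ e) (fun l => hπ _) (fun l => hc _) (fun l => h _)
      (fun r => y (r ∘ e.symm))
    convert this using 2
    · rw [← (Equiv.arrowCongr e (Equiv.refl κ)).sum_comp]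
      refine sum_congr (by congr!) fun r _ => ?_
      rw [← (Equiv.arrowCongr e (Equiv.refl κ)).sum_comp]
      refine sum_congr (by congr!) fun r' _ => ?_
      congr 1
      rw [← e.prod_comp]
      refine prod_congr (by congr!) fun l _ => ?_
      simp
    · rw [← (Equiv.arrowCongr e (Equiv.refl κ)).sum_comp]
      refine sum_congr (by congr!) fun r _ => ?_
      congr 1
      rw [← e.prod_comp]
      refine prod_congr (by congr!) fun l _ => ?_
      simp
  · intro _ s wt φ c hπ hc h y
    simp [sq]
  · intro α _ ih _ s wt φ c hπ hc h y
    have key := fun z => ih (fun l => s (some l)) (fun l => wt (some l)) (fun l => φ (some l)) (fun l => c (some l))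
      (fun l => hπ _) (fun l => hc _) (fun l => h _) z
    let E := (Equiv.piOptionEquivProd (β := fun _ : Option α => κ)).symm
    have e1 : ∀ F : (Option α → κ) → ℝ, ∑ r, F r = ∑ a, ∑ r, F (E (a, r)) := fun F => by
      rw [← Fintype.sum_prod_type' (f := fun a r => F (E (a, r)))]; exact (E.sum_comp F).symm
    have aux : ∀ (P : ℝ) (Y Y' : κ → ℝ), ∑ a, ∑ a', Y a * Y' a' * ((∑ ω ∈ s none, wt none ω * φ none a ω * φ none a' ω) * P)
        = ∑ ω ∈ s none, wt none ω * ((∑ a, Y a * φ none a ω) * (∑ a, Y' a * φ none a ω) * P) := by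
      intro P Y Y'
      simp only [sum_mul, mul_sum]
      symm
      rw [sum_comm, sum_congr rfl fun x _ => sum_comm, sum_comm]
      exact sum_congr rfl fun a _ => sum_congr rfl fun a' _ => sum_congr rfl fun ω _ => by ring
    calc _ = ∑ ω ∈ s none, wt none ω * (ε * ∑ r : α → κ, ∑ r' : α → κ, (∑ a, y (E (a, r)) * φ none a ω) * (∑ a, y (E (a, r')) * φ none a ω)
          * ∏ l, (∑ ω ∈ s (some l), wt (some l) ω * φ (some l) (r l) ω * φ (some l) (r' l) ω)) := by
          simp only [e1, Fintype.prod_option]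
          rw [sum_comm]
          have r1 : ∀ Q : (α → κ) → (α → κ) → Ω → ℝ, ∑ ω ∈ s none, wt none ω * (ε * ∑ r, ∑ r', Q r r' ω) = ε * ∑ r, ∑ r', ∑ ω ∈ s none, wt none ω * Q r r' ω := by
            intro Q
            simp only [mul_sum]
            rw [sum_comm]
            refine sum_congr rfl fun r _ => ?_
            rw [sum_comm]
            exact sum_congr rfl fun r' _ => sum_congr rfl fun ω _ => by ring
          rw [r1]
          congr 1
          refine sum_congr rfl fun r _ => ?_
          have : ∀ a, ∑ x, ∑ x_1, y (E (a, r)) * y (E (x, x_1)) *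
              ((∑ ω ∈ s none, wt none ω * φ none (E (a, r) none) ω * φ none (E (x, x_1) none) ω) *
                ∏ x_2, ∑ ω ∈ s (some x_2), wt (some x_2) ω * φ (some x_2) (E (a, r) (some x_2)) ω *
                    φ (some x_2) (E (x, x_1) (some x_2)) ω) = ∑ x_1, ∑ x, y (E (a, r)) * y (E (x, x_1)) *
              ((∑ ω ∈ s none, wt none ω * φ none a ω * φ none x ω) *
                ∏ x_2, ∑ ω ∈ s (some x_2), wt (some x_2) ω * φ (some x_2) (r x_2) ω *
                    φ (some x_2) (x_1 x_2) ω) := fun a => by rw [sum_comm]; rfl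
          rw [sum_congr rfl fun a _ => this a, sum_comm]
          refine sum_congr rfl fun r' _ => ?_
          rw [aux]
      _ ≤ ∑ ω ∈ s none, wt none ω * (ε * ∑ r : α → κ, (∏ l, c (some l) (r l)) * (∑ a, y (E (a, r)) * φ none a ω) ^ 2) :=
          sum_le_sum fun ω _ => mll (key _) (hπ _ _)
      _ = ∑ r : α → κ, (∏ l, c (some l) (r l)) * (ε * ∑ ω ∈ s none, wt none ω * (∑ a, y (E (a, r)) * φ none a ω) ^ 2) := by
          simp only [mul_sum]; rw [sum_comm]; exact sum_congr rfl fun r _ => sum_congr rfl fun ω _ => by ring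
      _ ≤ ∑ r : α → κ, (∏ l, c (some l) (r l)) * (ε * ∑ a, c none a * y (E (a, r)) ^ 2) :=
          sum_le_sum fun r _ => mll (h _ _) (prod_nonneg fun _ _ => hc _ _)
      _ = _ := by
          simp only [e1, Fintype.prod_option, mul_sum]; rw [sum_comm]
          refine sum_congr rfl fun a _ => sum_congr rfl fun r _ => ?_
          simp only [E, Equiv.piOptionEquivProd, Equiv.coe_fn_symm_mk]; ring
lemma per_sum (f : ℕ → ℝ) (m : ℕ) (hm : 0 < m) (hper : Function.Periodic f m) (B : ℝ)
    (hB : ∀ n, |f n| ≤ B) (N : ℕ) :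
    |∑ n ∈ range N, f n - N / m * ∑ n ∈ range m, f n| ≤ 2 * m * B := by
  have hB0 : 0 ≤ B := (abs_nonneg _).trans (hB 0)
  have hs : ∀ K, |∑ n ∈ range K, f n| ≤ K * B := fun K => by
    refine (abs_sum_le_sum_abs _ _).trans ((sum_le_sum fun n _ => hB n).trans ?_); simp
  induction N using Nat.strong_induction_on with
  | _ N ih =>
  have hm' : (0:ℝ) < m := by exact_mod_cast hm
  rcases lt_or_ge N m with h | h
  · have h' : (N:ℝ) ≤ m := by exact_mod_cast h.le
    calc _ ≤ |∑ n ∈ range N, f n| + |(N / m * ∑ n ∈ range m, f n : ℝ)| := abs_sub _ _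
      _ ≤ N * B + N / m * (m * B) := by
        rw [abs_mul, abs_of_nonneg (by positivity : (0:ℝ) ≤ N / m)]
        exact add_le_add (hs _) (mll (hs _) (by positivity))
      _ = 2 * N * B := by field_simp; ring
      _ ≤ _ := by gcongr
  · obtain ⟨K, rfl⟩ := Nat.exists_eq_add_of_le h
    have := ih K (by omega)
    rw [sum_range_add]
    have e : ∑ x ∈ range K, f (m + x) = ∑ x ∈ range K, f x := sum_congr rfl fun x _ => by rw [add_comm, hper]
    rw [e]
    convert this using 2
    push_cast; field_simp; ring
lemma crt2 {M : Type} [CommRing M] (a b : ℕ) (ha : 0 < a) (hb : 0 < b) (hab : a.Coprime b) (f g : ℕ → M) (hf : Function.Periodic f a)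
    (hg : Function.Periodic g b) :
    ∑ n ∈ range (a * b), f n * g n = (∑ n ∈ range a, f n) * ∑ n ∈ range b, g n := by
  rw [sum_mul_sum, ← sum_product']
  have hmap : Set.MapsTo (fun n => (n % a, n % b)) (range (a * b) : Finset ℕ) (range a ×ˢ range b : Finset (ℕ × ℕ)) := by
    intro n _; simp [Nat.mod_lt _ ha, Nat.mod_lt _ hb]
  have hinj : Set.InjOn (fun n => (n % a, n % b)) (range (a * b) : Finset ℕ) := by
    intro x hx y hy h
    simp only [Prod.mk.injEq] at h
    simp only [coe_range, Set.mem_Iio] at hx hy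
    have : x ≡ y [MOD a * b] := (Nat.modEq_and_modEq_iff_modEq_mul hab).1 ⟨h.1, h.2⟩
    exact Nat.ModEq.eq_of_lt_of_lt this hx hy
  refine sum_bij (fun n _ => (n % a, n % b)) (fun n hn => hmap hn) (fun x hx y hy h => hinj hx hy h) ?_ ?_
  · intro p hp
    obtain ⟨n, hn, h⟩ := surjOn_of_injOn_of_card_le _ hmap hinj (by simp) hp
    exact ⟨n, hn, h⟩
  · intro n _
    simp [hf.map_mod_nat, hg.map_mod_nat]
lemma periodic_prod {M : Type} [CommRing M] {ι : Type} (T : Finset ι) (q : ι → ℕ) (f : ι → ℕ → M) (hf : ∀ l ∈ T, Function.Periodic (f l) (q l)) :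
    Function.Periodic (fun n => ∏ l ∈ T, f l n) (∏ l ∈ T, q l) := by
  intro n
  refine prod_congr rfl fun l hl => ?_
  obtain ⟨c, hc⟩ := dvd_prod_of_mem q hl
  rw [hc, mul_comm]
  exact (hf l hl).nat_mul c n
lemma crt_prod {M : Type} [CommRing M] {ι : Type} [DecidableEq ι] (T : Finset ι) (q : ι → ℕ) (hq : ∀ l, 0 < q l)
    (hco : HC q) (f : ι → ℕ → M)
    (hf : ∀ l, Function.Periodic (f l) (q l)) :
    ∑ n ∈ range (∏ l ∈ T, q l), ∏ l ∈ T, f l n = ∏ l ∈ T, ∑ n ∈ range (q l), f l n := by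
  induction T using Finset.induction_on with
  | empty => simp
  | insert a T ha ih =>
    simp only [prod_insert ha]
    rw [crt2 _ _ (hq a) (prod_pos fun l _ => hq l) _ (f a) (fun n => ∏ l ∈ T, f l n) (hf a)
      (periodic_prod T q f fun l _ => hf l), ih]
    exact Nat.Coprime.prod_right fun l hl => hco _ _ (by rintro rfl; exact ha hl)
noncomputable def tau (l : ℕ) : ℝ := 1 / ((l : ℝ) - 1)
noncomputable def ph {k : ℕ} (l : ℕ) (c : Fin k → ℕ) : Option (Fin k) → ℕ → ℝ
  | none, _ => 1
  | some j, m => tau l - if m % l = c j % l then 1 else 0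
lemma tau_pos {l : ℕ} (h : 2 ≤ l) : 0 < tau l := by
  have : (2:ℝ) ≤ l := by exact_mod_cast h
  unfold tau; apply one_div_pos.2; linarith
lemma tau_le_one {l : ℕ} (h : 2 ≤ l) : tau l ≤ 1 := by
  have : (2:ℝ) ≤ l := by exact_mod_cast h
  unfold tau; rw [div_le_one] <;> linarith
lemma ph_abs {k : ℕ} {l : ℕ} (h : 2 ≤ l) (c : Fin k → ℕ) (a : Option (Fin k)) (m : ℕ) : |ph l c a m| ≤ 1 := by
  have := tau_pos h
  have := tau_le_one h
  cases a with
  | none => simp [ph]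
  | some j => simp only [ph]; split_ifs <;> rw [abs_le] <;> constructor <;> linarith
lemma ph_periodic {k : ℕ} (l : ℕ) (c : Fin k → ℕ) (a : Option (Fin k)) : Function.Periodic (ph l c a) l := by
  intro n
  cases a with
  | none => rfl
  | some j => simp [ph]
noncomputable def NN {ι : Type} [Fintype ι] {k : ℕ} (q : ι → ℕ) (r : ι → Option (Fin k)) : ℕ := ∏ l, if r l = none then 1 else q l
noncomputable def gg {ι : Type} [Fintype ι] [DecidableEq ι] {k : ℕ} (q : ι → ℕ) (c : ι → Fin k → ℕ) (Y : (ι → Option (Fin k)) → ℝ) (m : ℕ) : ℝ :=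
  ∑ r, Y r * ∏ l, ph (q l) (c l) (r l) m
lemma gram_full {k : ℕ} {l : ℕ} (h : 2 ≤ l) (c : Fin k → ℕ) (hc : ∀ i j, c i % l = c j % l → i = j)
    (β : Option (Fin k) → ℝ) :
    ∑ n ∈ range l, (1 / (l:ℝ)) * (∑ a, β a * ph l c a n) ^ 2 ≤
      (1 + k / (l * ((l:ℝ) - 1))) * β none ^ 2 + ∑ j, tau l * β (some j) ^ 2 := by
  have hl : (2:ℝ) ≤ l := by exact_mod_cast h
  set I : Fin k → ℕ → ℝ := fun j n => if n % l = c j % l then 1 else 0 with hI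
  have I1 : ∀ j, ∑ n ∈ range l, I j n = 1 := by
    intro j
    rw [sum_eq_single (c j % l)]
    · simp [hI]
    · intro b hb hne
      simp only [hI]
      rw [if_neg]; rw [Nat.mod_eq_of_lt (mem_range.1 hb)]; exact hne
    · intro hn; exact absurd (mem_range.2 (Nat.mod_lt _ (by omega))) hn
  have I2 : ∀ n, (∑ j, β (some j) * I j n) ^ 2 = ∑ j, β (some j) ^ 2 * I j n := by
    intro n
    by_cases hn : ∃ j, n % l = c j % l
    · obtain ⟨j, hj⟩ := hn
      have : ∀ i, i ≠ j → I i n = 0 := fun i hi => by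
        simp only [hI]; rw [if_neg]; intro h'; exact hi (hc _ _ (h'.symm.trans hj))
      rw [sum_eq_single j (fun i _ hi => by simp [this i hi]) (by simp),
        sum_eq_single j (fun i _ hi => by simp [this i hi]) (by simp)]
      simp [hI, hj]
    · push Not at hn
      simp [hI, hn]
  set s := ∑ j, β (some j)
  set b2 := ∑ j, β (some j) ^ 2
  set a := β none
  have e1 : ∀ n, (∑ a, β a * ph l c a n) = (a + tau l * s) - ∑ j, β (some j) * I j n := by
    intro n
    rw [Fintype.sum_option]
    simp only [ph, mul_sub, sum_sub_distrib, s, mul_sum, hI]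
    simp only [mul_one, mul_comm (tau l)]; simp only [a]; ring
  have e2 : ∑ n ∈ range l, (1 / (l:ℝ)) * (∑ a, β a * ph l c a n) ^ 2 = (a + tau l * s) ^ 2 - 2 / l * (a + tau l * s) * s + b2 / l := by
    have : ∀ n ∈ range l, (1 / (l:ℝ)) * (∑ a, β a * ph l c a n) ^ 2 = (1 / (l:ℝ)) * (a + tau l * s) ^ 2 -
        2 / l * (a + tau l * s) * (∑ j, β (some j) * I j n) + 1 / l * ∑ j, β (some j) ^ 2 * I j n := by
      intro n _; rw [e1, ← I2]; ring
    rw [sum_congr rfl this, sum_add_distrib, sum_sub_distrib, ← mul_sum, ← mul_sum, ← mul_sum, sum_comm, sum_comm (f := fun n j => β (some j) ^ 2 * I j n)]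
    simp only [← mul_sum, I1]
    simp [s, b2]; field_simp
  rw [e2, ← mul_sum]
  have hs : 2 * a * s ≤ k * a ^ 2 + b2 := by
    have : ∑ j : Fin k, 2 * a * β (some j) ≤ ∑ j : Fin k, (a ^ 2 + β (some j) ^ 2) :=
      sum_le_sum fun j _ => by nlinarith [sq_nonneg (a - β (some j))]
    rw [sum_add_distrib, ← mul_sum] at this
    simpa using this
  have ht : tau l = 1 / l + 1 / (l * ((l:ℝ) - 1)) := by unfold tau; have : (l:ℝ) - 1 ≠ 0 := by linarith
                                                        field_simp; ring
  have hd : 0 ≤ 1 / (l * ((l:ℝ) - 1)) := by have : 0 ≤ (l:ℝ) - 1 := by linarith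
                                            positivity
  have h3 : tau l ≤ 2 / l := by
    unfold tau; rw [ddi] <;> linarith
  have h4 : 0 ≤ tau l := (tau_pos h).le
  have : (a + tau l * s) ^ 2 - 2 / l * (a + tau l * s) * s + b2 / l = a ^ 2 + 1 / (l * ((l:ℝ) - 1)) * (2 * a * s) - tau l * (2 / l - tau l) * s ^ 2 + b2 / l := by
    have : 2 * (tau l - 1/l) = 2 * (1 / (l * ((l:ℝ) - 1))) := by rw [ht]; ring
    linear_combination a * s * this
  rw [this]
  have e5 : 0 ≤ tau l * (2 / l - tau l) * s ^ 2 := by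
    have := sub_nonneg.2 h3; positivity
  have e6 := mll hs hd
  have e7 : tau l * b2 = b2 / l + 1 / (l * ((l:ℝ) - 1)) * b2 := by rw [ht]; ring
  have e8 : (1 + k / (l * ((l:ℝ) - 1))) * a ^ 2 = a ^ 2 + 1 / (l * ((l:ℝ) - 1)) * (k * a ^ 2) := by ring
  rw [e7, e8]; nlinarith
noncomputable def cc (k l : ℕ) : Option (Fin k) → ℝ
  | none => 1 + k / (l * ((l:ℝ) - 1))
  | some _ => tau l
lemma cc_nonneg {k l : ℕ} (h : 2 ≤ l) (a) : 0 ≤ cc k l a := by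
  have hl : (2:ℝ) ≤ l := by exact_mod_cast h
  cases a with
  | none => simp only [cc]; have : 0 ≤ (l:ℝ) - 1 := by linarith
            positivity
  | some j => exact (tau_pos h).le
section
variable {ι : Type} [Fintype ι] [DecidableEq ι] {k : ℕ} (q : ι → ℕ) (hq : ∀ l, 2 ≤ q l)
    (hco : HC q) (c : ι → Fin k → ℕ)
lemma pair_mean (hq : ∀ l, 2 ≤ q l) (hco : HC q)
    (W : ℕ) (hW : 0 < W) (hWq : ∀ l, W.Coprime (q l)) (r r' : ι → Option (Fin k)) (N : ℕ) :
    |∑ m ∈ range N, (if W.Coprime m then (1:ℝ) else 0) * ∏ l, (ph (q l) (c l) (r l) m * ph (q l) (c l) (r' l) m)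
      - N * ((W.totient : ℝ) / W) * ∏ l, ∑ n ∈ range (q l), (1 / (q l : ℝ)) * ph (q l) (c l) (r l) n * ph (q l) (c l) (r' l) n|
      ≤ 2 * (W * (NN q r * NN q r')) := by
  set T : Finset ι := univ.filter fun l => ¬ (r l = none ∧ r' l = none)
  set f : ι → ℕ → ℝ := fun l m => ph (q l) (c l) (r l) m * ph (q l) (c l) (r' l) m
  set h : ℕ → ℝ := fun m => if W.Coprime m then (1:ℝ) else 0
  have hq0 : ∀ l, 0 < q l := fun l => by have := hq l; omega
  have hfp : ∀ l, Function.Periodic (f l) (q l) := fun l => (ph_periodic _ _ _).mul (ph_periodic _ _ _)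
  have hhp : Function.Periodic h W := by intro n; simp [h]
  have hT : ∀ m, ∏ l, f l m = ∏ l ∈ T, f l m := fun m => by
    symm; refine prod_subset (subset_univ _) fun l _ hl => ?_
    simp only [T, mem_filter, mem_univ, true_and, not_not] at hl
    simp [f, hl.1, hl.2, ph]
  have hP0 : 0 < ∏ l ∈ T, q l := prod_pos fun l _ => hq0 l
  have hper : Function.Periodic (fun m => h m * ∏ l ∈ T, f l m) (W * ∏ l ∈ T, q l) := by
    have h1 := hhp.nat_mul (∏ l ∈ T, q l)
    have h2 := (periodic_prod T q f fun l _ => hfp l).nat_mul W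
    rw [mul_comm] at h1
    exact h1.mul h2
  have hB : ∀ n, |h n * ∏ l ∈ T, f l n| ≤ 1 := fun n => by
    rw [abs_mul, abs_prod]
    refine mul_le_one₀ ?_ (prod_nonneg fun _ _ => abs_nonneg _) (prod_le_one (fun _ _ => abs_nonneg _) fun l _ => ?_)
    · simp only [h]; split_ifs <;> simp
    · simp only [f]; rw [abs_mul]; exact mul_le_one₀ (ph_abs (hq l) _ _ _) (abs_nonneg _) (ph_abs (hq l) _ _ _)
  have key := per_sum _ _ (Nat.mul_pos hW hP0) hper 1 hB N
  rw [crt2 _ _ hW hP0 (Nat.Coprime.prod_right fun l _ => hWq l) h _ hhp (periodic_prod T q f fun l _ => hfp l),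
    crt_prod T q hq0 hco f hfp] at key
  have e1 : ∑ n ∈ range W, h n = W.totient := by
    rw [Nat.totient_eq_card_coprime]; simp [h]
  have e2 : ∏ l, ∑ n ∈ range (q l), (1 / (q l : ℝ)) * ph (q l) (c l) (r l) n * ph (q l) (c l) (r' l) n
      = (∏ l ∈ T, ∑ n ∈ range (q l), f l n) / ∏ l ∈ T, (q l : ℝ) := by
    rw [← prod_div_distrib]
    trans ∏ l, (∑ n ∈ range (q l), f l n) / (q l : ℝ)
    · refine prod_congr rfl fun l _ => ?_
      rw [sum_div]; exact sum_congr rfl fun n _ => by simp only [f]; ring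
    · symm; refine prod_subset (subset_univ _) fun l _ hl => ?_
      simp only [T, mem_filter, mem_univ, true_and, not_not] at hl
      have : (q l : ℝ) ≠ 0 := by exact_mod_cast (hq0 l).ne'
      simp [f, hl.1, hl.2, ph, this]
  have e3 : ∏ l ∈ T, q l ≤ NN q r * NN q r' := by
    unfold NN
    rw [← pmd]
    refine le_trans ?_ (prod_le_prod_of_subset_of_one_le' (subset_univ T) fun l _ _ => ?_)
    · refine prod_le_prod' fun l hl => ?_
      simp only [T, mem_filter, mem_univ, true_and, not_and_or] at hl
      have := hq0 l
      split_ifs with h1 h2 h2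
      · exact absurd hl (by simp [h1, h2])
      · simp
      · simp
      · nlinarith
    · have := hq0 l
      split_ifs <;> simp <;> nlinarith
  rw [e1] at key
  have e7 : ∑ m ∈ range N, (if W.Coprime m then (1:ℝ) else 0) * ∏ l, (ph (q l) (c l) (r l) m * ph (q l) (c l) (r' l) m)
      = ∑ m ∈ range N, h m * ∏ l ∈ T, f l m := sum_congr rfl fun m _ => by rw [← hT]
  rw [e2, e7]
  have : (N:ℝ) * ((W.totient : ℝ) / W) * ((∏ l ∈ T, ∑ n ∈ range (q l), f l n) / ∏ l ∈ T, (q l : ℝ)) =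
      N / ((W * ∏ l ∈ T, q l : ℕ) : ℝ) * (W.totient * ∏ l ∈ T, ∑ n ∈ range (q l), f l n) := by
    push_cast; field_simp
  rw [this]
  refine key.trans ?_
  rw [mul_one]
  have : ((W * ∏ l ∈ T, q l : ℕ) : ℝ) ≤ ((W * (NN q r * NN q r') : ℕ) : ℝ) := by
    exact_mod_cast Nat.mul_le_mul_left W e3
  push_cast at this ⊢
  linarith
lemma sieve_upper (hq : ∀ l, 2 ≤ q l) (hco : HC q)
    (hc : ∀ l i j, c l i % q l = c l j % q l → i = j)
    (W : ℕ) (hW : 0 < W) (hWq : ∀ l, W.Coprime (q l)) (Y : (ι → Option (Fin k)) → ℝ) (hY : ∀ r, 0 ≤ Y r) (N : ℕ) :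
    ∑ m ∈ range N, (if W.Coprime m then (1:ℝ) else 0) * gg q c Y m ^ 2 ≤
     N * ((W.totient : ℝ) / W) * ∑ r, (∏ l, cc k (q l) (r l)) * Y r ^ 2 + 2 * W * (∑ r, Y r * NN q r) ^ 2 := by
  have e1 : ∀ m, (if W.Coprime m then (1:ℝ) else 0) * gg q c Y m ^ 2 = ∑ r, ∑ r', Y r * Y r' *
      ((if W.Coprime m then (1:ℝ) else 0) * ∏ l, (ph (q l) (c l) (r l) m * ph (q l) (c l) (r' l) m)) := fun m => by
    rw [gg, sq, sum_mul_sum, mul_sum]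
    refine sum_congr rfl fun r _ => ?_
    rw [mul_sum]
    exact sum_congr rfl fun r' _ => by rw [pmd]; ring
  have e2 : ∑ m ∈ range N, (if W.Coprime m then (1:ℝ) else 0) * gg q c Y m ^ 2 = ∑ r, ∑ r', Y r * Y r' *
      ∑ m ∈ range N, ((if W.Coprime m then (1:ℝ) else 0) * ∏ l, (ph (q l) (c l) (r l) m * ph (q l) (c l) (r' l) m)) := by
    rw [sum_congr rfl fun m _ => e1 m, sum_comm]
    refine sum_congr rfl fun r _ => ?_
    rw [sum_comm]
    exact sum_congr rfl fun r' _ => by rw [mul_sum]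
  have e3 := tensor_le (κ := Option (Fin k)) (Ω := ℕ) 1 ι (fun l => range (q l)) (fun l _ => 1 / (q l : ℝ))
    (fun l a n => ph (q l) (c l) a n) (fun l => cc k (q l)) (fun l _ => by positivity)
    (fun l a => cc_nonneg (hq l) a) (fun l β => by
      rw [one_mul, one_mul, Fintype.sum_option]
      exact gram_full (hq l) (c l) (hc l) β) Y
  rw [one_mul, one_mul] at e3
  have e4 := mll e3 (by positivity : 0 ≤ (N:ℝ) * ((W.totient : ℝ) / W))
  rw [e2]
  have e5 : 2 * (W:ℝ) * (∑ r, Y r * NN q r) ^ 2 = ∑ r, ∑ r', Y r * Y r' * (2 * (W * (NN q r * NN q r'))) := by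
    rw [sq, sum_mul_sum, mul_sum]
    refine sum_congr rfl fun r _ => ?_
    rw [mul_sum]
    exact sum_congr rfl fun r' _ => by ring
  have e6 : ∑ r, ∑ r', Y r * Y r' *
      ∑ m ∈ range N, ((if W.Coprime m then (1:ℝ) else 0) * ∏ l, (ph (q l) (c l) (r l) m * ph (q l) (c l) (r' l) m)) ≤
      ∑ r, ∑ r', (Y r * Y r' * (N * ((W.totient : ℝ) / W) * ∏ l, ∑ n ∈ range (q l), (1 / (q l : ℝ)) * ph (q l) (c l) (r l) n * ph (q l) (c l) (r' l) n)
        + Y r * Y r' * (2 * (W * (NN q r * NN q r')))) := by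
    refine sum_le_sum fun r _ => sum_le_sum fun r' _ => ?_
    rw [← mul_add]
    refine mll ?_ (mul_nonneg (hY _) (hY _))
    have := (abs_le.1 (pair_mean q c hq hco W hW hWq r r' N)).2
    linarith
  refine e6.trans ?_
  simp only [sum_add_distrib]
  rw [← e5]
  refine add_le_add (le_trans (le_of_eq ?_) e4) le_rfl
  rw [mul_sum]
  refine sum_congr rfl fun r _ => ?_
  rw [mul_sum]
  exact sum_congr rfl fun r' _ => by ring
end
section
variable {ι : Type} [Fintype ι] [DecidableEq ι] {k : ℕ}
def AA (r : ι → Option (Fin k)) (j : Fin k) : Finset ι := univ.filter fun l => r l = some j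
lemma mem_AA (r : ι → Option (Fin k)) (j : Fin k) (l : ι) : l ∈ AA r j ↔ r l = some j := by simp [AA]
lemma AA_inj : Function.Injective (AA : (ι → Option (Fin k)) → Fin k → Finset ι) := by
  intro r s h
  funext l
  rcases hr : r l with _ | j
  · rcases hs : s l with _ | j
    · rfl
    · have : l ∈ AA r j := by rw [h, mem_AA, hs]
      rw [mem_AA, hr] at this; cases this
  · have : l ∈ AA s j := by rw [← h, mem_AA, hr]
    rw [mem_AA] at this; exact this.symm
lemma cfg_prod {M : Type} [CommMonoid M] (h : ι → M) (r : ι → Option (Fin k)) :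
    ∏ l, (if r l = none then 1 else h l) = ∏ j, ∏ l ∈ AA r j, h l := by
  simp only [AA, prod_filter]
  rw [Finset.prod_comm]
  refine prod_congr rfl fun l _ => ?_
  rcases hr : r l with _ | j
  · simp
  · simp
lemma AA_exists (t : Fin k → Finset ι) (ht : ∀ i j, i ≠ j → Disjoint (t i) (t j)) :
    ∃ r : ι → Option (Fin k), AA r = t := by
  classical
  refine ⟨fun l => if h : ∃ j, l ∈ t j then some h.choose else none, ?_⟩
  funext j; ext l
  rw [mem_AA]
  split_ifs with h
  · rw [Option.some_inj]
    constructor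
    · rintro rfl; exact h.choose_spec
    · intro hj
      by_contra hne
      exact (disjoint_left.1 (ht _ _ hne) h.choose_spec) hj
  · simp only [reduceCtorEq, false_iff]; intro hj; exact h ⟨j, hj⟩
lemma tup_sum (F : Fin k → Finset ι → ℝ) : ∏ j, ∑ A, F j A = ∑ t : Fin k → Finset ι, ∏ j, F j (t j) := by
  rw [prod_univ_sum]; simp
lemma cfg_sum_le (F : Fin k → Finset ι → ℝ) (hF : ∀ j A, 0 ≤ F j A) :
    ∑ r : ι → Option (Fin k), ∏ j, F j (AA r j) ≤ ∏ j, ∑ A, F j A := by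
  rw [tup_sum, ← sum_image (f := fun t : Fin k → Finset ι => ∏ j, F j (t j)) (g := AA) (fun x _ y _ h => AA_inj h)]
  exact sum_le_sum_of_subset_of_nonneg (subset_univ _) fun t _ _ => prod_nonneg fun j _ => hF _ _
lemma cfg_sum_ge (F : Fin k → Finset ι → ℝ) (hF : ∀ j A, 0 ≤ F j A) (H : (Fin k → Finset ι) → ℝ)
    (hH : ∀ t, 0 < H t → ∀ i j, i ≠ j → Disjoint (t i) (t j)) :
    ∑ t : Fin k → Finset ι, (∏ j, F j (t j)) * H t ≤ ∑ r : ι → Option (Fin k), (∏ j, F j (AA r j)) * H (AA r) := by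
  rw [← sum_image (f := fun t : Fin k → Finset ι => (∏ j, F j (t j)) * H t) (g := AA) (fun x _ y _ h => AA_inj h)]
  rw [← sum_sdiff (subset_univ (image AA univ))]
  have : ∑ x ∈ univ \ image (AA : (ι → Option (Fin k)) → _) univ, (∏ j, F j (x j)) * H x ≤ 0 := by
    refine sum_nonpos fun t ht => mul_nonpos_of_nonneg_of_nonpos (prod_nonneg fun j _ => hF _ _) ?_
    by_contra hp
    obtain ⟨r, hr⟩ := AA_exists t (hH t (not_le.1 hp))
    exact (mem_sdiff.1 ht).2 (mem_image.2 ⟨r, mem_univ _, hr⟩)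
  linarith
lemma cfg_count (q : ι → ℕ) (hq : ∀ l, 2 ≤ q l) (R : ℝ) (hR : 0 ≤ R) (Y : (ι → Option (Fin k)) → ℝ) (B : ℝ)
    (hY : ∀ r, 0 ≤ Y r) (hYB : ∀ r, Y r ≤ B) (hYs : ∀ r, Y r ≠ 0 → (NN q r : ℝ) ≤ R) :
    ∑ r, Y r * NN q r ≤ B * R ^ 3 * exp (∑ l, k / (q l : ℝ) ^ 2) := by
  have hB : 0 ≤ B := (hY (fun _ => none)).trans (hYB _)
  have hN : ∀ r : ι → Option (Fin k), (0:ℝ) < NN q r := fun r => by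
    unfold NN; push_cast
    refine prod_pos fun l _ => ?_
    have := hq l
    split_ifs
    · norm_num
    · exact_mod_cast (by omega : 0 < q l)
  have e1 : ∀ r, Y r * NN q r ≤ B * R ^ 3 * ((NN q r : ℝ) ^ 2)⁻¹ := by
    intro r
    by_cases h : Y r = 0
    · rw [h, zero_mul]; positivity
    · rw [← div_eq_mul_inv, le_div_iff₀ (by have := hN r; positivity)]
      calc Y r * NN q r * (NN q r : ℝ) ^ 2 = Y r * (NN q r : ℝ) ^ 3 := by ring
        _ ≤ _ := mul_le_mul (hYB r) (pow_le_pow_left₀ (hN r).le (hYs r h) 3) (by have := hN r; positivity) hB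
  refine (sum_le_sum fun r _ => e1 r).trans ?_
  rw [← mul_sum]
  refine mll ?_ (by positivity)
  have e2 : ∑ r : ι → Option (Fin k), ((NN q r : ℝ) ^ 2)⁻¹ = ∏ l, ∑ a : Option (Fin k), (if a = none then (1:ℝ) else ((q l:ℝ) ^ 2)⁻¹) := by
    rw [prod_univ_sum]
    simp only [Fintype.piFinset_univ]
    refine sum_congr rfl fun r _ => ?_
    unfold NN; push_cast
    rw [← prod_pow, ← prod_inv_distrib]
    exact prod_congr rfl fun l _ => by split_ifs <;> simp
  rw [e2, Real.exp_sum]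
  refine prod_le_prod (fun l _ => ?_) fun l _ => ?_
  · exact sum_nonneg fun a _ => by split_ifs <;> positivity
  · rw [Fintype.sum_option]
    simp only [reduceIte, reduceCtorEq, sum_const, card_univ, Fintype.card_fin, nsmul_eq_mul]
    have := Real.add_one_le_exp (k / (q l : ℝ) ^ 2)
    rw [div_eq_mul_inv] at this ⊢; linarith
noncomputable def mm (q : ι → ℕ) (A : Finset ι) : ℝ := ∏ l ∈ A, tau (q l)
lemma mm_nonneg (q : ι → ℕ) (hq : ∀ l, 2 ≤ q l) (A) : 0 ≤ mm q A := prod_nonneg fun l _ => (tau_pos (hq l)).le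
lemma sum_mem_le (q : ι → ℕ) (hq : ∀ l, 2 ≤ q l) (f : Finset ι → ℝ) (hf0 : ∀ A, 0 ≤ f A) (hf : ∀ A B, A ⊆ B → f B ≤ f A) (l : ι) :
    ∑ A, (if l ∈ A then f A * mm q A else 0) ≤ tau (q l) * ∑ A, f A * mm q A := by
  rw [← sum_filter]
  have h1 : ∀ A ∈ univ.filter (fun A : Finset ι => l ∈ A), f A * mm q A ≤ tau (q l) * (f (A.erase l) * mm q (A.erase l)) := by
    intro A hA
    have hl : l ∈ A := (mem_filter.1 hA).2
    have : mm q A = tau (q l) * mm q (A.erase l) := by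
      unfold mm; exact (mul_prod_erase A (fun l => tau (q l)) hl).symm
    rw [this]
    have := hf _ _ (erase_subset l A)
    have h2 := (tau_pos (hq l)).le
    have h3 := mm_nonneg q hq (A.erase l)
    calc f A * (tau (q l) * mm q (A.erase l)) ≤ f (A.erase l) * (tau (q l) * mm q (A.erase l)) := by gcongr
      _ = _ := by ring
  refine (sum_le_sum h1).trans ?_
  rw [← mul_sum]
  refine mll ?_ (tau_pos (hq l)).le
  rw [← sum_image (f := fun B => f B * mm q B) (g := fun A : Finset ι => A.erase l)]
  · exact sum_le_sum_of_subset_of_nonneg (subset_univ _) fun B _ _ => mul_nonneg (hf0 _) (mm_nonneg q hq _)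
  · intro A hA B hB h
    simp only [coe_filter, mem_univ, true_and, Set.mem_setOf_eq] at hA hB
    rw [← insert_erase hA, ← insert_erase hB]; exact congrArg _ h
lemma cc_prod_le (q : ι → ℕ) (hq : ∀ l, 2 ≤ q l) (r : ι → Option (Fin k)) :
    ∏ l, cc k (q l) (r l) ≤ exp (∑ l, k / (q l * ((q l:ℝ) - 1))) * ∏ j, mm q (AA r j) := by
  unfold mm
  rw [← cfg_prod, Real.exp_sum, ← pmd]
  refine prod_le_prod (fun l _ => cc_nonneg (hq l) _) fun l _ => ?_
  have hl : (2:ℝ) ≤ q l := by exact_mod_cast hq l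
  have h0 : 0 ≤ k / (q l * ((q l:ℝ) - 1)) := by
    have : 0 ≤ (q l:ℝ) - 1 := by linarith
    positivity
  rcases hr : r l with _ | j
  · simp only [cc]; have := Real.add_one_le_exp (k / (q l * ((q l:ℝ) - 1))); simp; linarith
  · simp only [cc, reduceCtorEq, if_false]
    exact le_mul_of_one_le_left (tau_pos (hq l)).le (Real.one_le_exp h0)
end
noncomputable def phU {k : ℕ} (i : Fin k) (l : ℕ) (c : Fin k → ℕ) (a : Option (Fin k)) (n : ℕ) : ℝ :=
  if a = some i then 0 else ph l c a n
lemma gram_units {k : ℕ} {l : ℕ} (h : 2 ≤ l) (i : Fin k) (c : Fin k → ℕ) (hc : ∀ j j', j ≠ i → j' ≠ i → c j % l = c j' % l → j = j')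
    (hc0 : ∀ j, j ≠ i → c j % l ≠ 0) (β : Option (Fin k) → ℝ) :
    ∑ n ∈ (range l).filter (fun n => ¬ l ∣ n), tau l * (∑ a, β a * phU i l c a n) ^ 2 =
      β none ^ 2 + tau l * (∑ j, (if j = i then 0 else β (some j)) ^ 2) - tau l ^ 2 * (∑ j, if j = i then 0 else β (some j)) ^ 2 := by
  have hl : (2:ℝ) ≤ l := by exact_mod_cast h
  set b : Fin k → ℝ := fun j => if j = i then 0 else β (some j) with hb
  set I : Fin k → ℕ → ℝ := fun j n => if n % l = c j % l then 1 else 0 with hI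
  set U := (range l).filter (fun n => ¬ l ∣ n) with hU
  have hUc : (U.card : ℝ) * tau l = 1 := by
    have : U = Ico 1 l := by
      ext n; simp only [hU, mem_filter, mem_range, mem_Ico]
      constructor
      · rintro ⟨h1, h2⟩; refine ⟨?_, h1⟩
        rcases Nat.eq_zero_or_pos n with rfl | h3
        · simp at h2
        · exact h3
      · rintro ⟨h1, h2⟩; exact ⟨h2, fun h3 => by have := Nat.le_of_dvd h1 h3; omega⟩
    rw [this, Nat.card_Ico]; unfold tau
    push_cast [show 1 ≤ l by omega]
    have : (l:ℝ) - 1 ≠ 0 := by linarith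
    field_simp
  have I1 : ∀ j, b j * ∑ n ∈ U, I j n = b j := by
    intro j
    by_cases hj : j = i
    · simp [hb, hj]
    rw [sum_eq_single (c j % l)]
    · simp [hI]
    · intro x hx hne
      simp only [hI]
      rw [if_neg]; rw [Nat.mod_eq_of_lt (mem_range.1 (mem_filter.1 hx).1)]; exact hne
    · intro hn; refine absurd ?_ hn
      rw [hU, mem_filter, mem_range]
      refine ⟨Nat.mod_lt _ (by omega), fun hd => hc0 j hj ?_⟩
      exact Nat.eq_zero_of_dvd_of_lt hd (Nat.mod_lt _ (by omega))
  have I2 : ∀ n, (∑ j, b j * I j n) ^ 2 = ∑ j, b j ^ 2 * I j n := by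
    intro n
    by_cases hn : ∃ j, j ≠ i ∧ n % l = c j % l
    · obtain ⟨j, hji, hj⟩ := hn
      have : ∀ m, m ≠ j → b m * I m n = 0 ∧ b m ^ 2 * I m n = 0 := fun m hm => by
        by_cases hmi : m = i
        · simp [hb, hmi]
        · simp only [hI]; rw [if_neg]
          · simp
          · intro h'; exact hm (hc _ _ hmi hji (h'.symm.trans hj))
      rw [sum_eq_single j (fun m _ hm => (this m hm).1) (by simp),
        sum_eq_single j (fun m _ hm => (this m hm).2) (by simp)]
      simp [hI, hj]
    · push Not at hn
      have : ∀ j, b j * I j n = 0 ∧ b j ^ 2 * I j n = 0 := fun j => by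
        by_cases hj : j = i
        · simp [hb, hj]
        · simp [hI, hn j hj]
      simp [this]
  set s := ∑ j, b j
  set a := β none with ha
  have e1 : ∀ n, (∑ a, β a * phU i l c a n) = (a + tau l * s) - ∑ j, b j * I j n := by
    intro n
    rw [Fintype.sum_option]
    have : ∀ j, β (some j) * phU i l c (some j) n = tau l * b j - b j * I j n := fun j => by
      by_cases hj : j = i
      · simp [phU, hj, hb]
      · simp only [phU, hb, hI, ph, Option.some_inj, hj, if_false]; ring
    rw [sum_congr rfl fun j _ => this j, sum_sub_distrib, ← mul_sum]
    simp only [phU, ph, reduceCtorEq, if_false, a, s]; ring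
  have : ∀ n ∈ U, tau l * (∑ a, β a * phU i l c a n) ^ 2 = tau l * (a + tau l * s) ^ 2 -
      2 * tau l * (a + tau l * s) * (∑ j, b j * I j n) + tau l * ∑ j, b j ^ 2 * I j n := by
    intro n _; rw [e1, ← I2]; ring
  rw [sum_congr rfl this, sum_add_distrib, sum_sub_distrib, ← mul_sum, ← mul_sum, ← mul_sum, sum_comm, sum_comm (f := fun n j => b j ^ 2 * I j n)]
  have e3 : ∑ j, ∑ n ∈ U, b j * I j n = s := sum_congr rfl fun j _ => by rw [← mul_sum, I1]
  have e4 : ∑ j, ∑ n ∈ U, b j ^ 2 * I j n = ∑ j, b j ^ 2 := sum_congr rfl fun j _ => by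
    rw [← mul_sum, sq, mul_assoc, I1]
  rw [e3, e4, sum_const, nsmul_eq_mul]
  linear_combination (a + tau l * s) ^ 2 * hUc
section
variable {ι : Type} [Fintype ι] [DecidableEq ι] {k : ℕ}
noncomputable def gU (q : ι → ℕ) (i : Fin k) (c : ι → Fin k → ℕ) (Z : (ι → Option (Fin k)) → ℝ) (n : ℕ) : ℝ :=
  ∑ s, Z s * ∏ l, phU i (q l) (c l) (s l) n
noncomputable def EU (q : ι → ℕ) (f : ℕ → ℝ) : ℝ :=
  (∏ l, tau (q l)) * ∑ n ∈ (range (∏ l, q l)).filter (fun n => ∀ l, ¬ q l ∣ n), f n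
lemma EU_gram (q : ι → ℕ) (hq : ∀ l, 2 ≤ q l) (hco : HC q) (i : Fin k)
    (c : ι → Fin k → ℕ) (Z : (ι → Option (Fin k)) → ℝ) :
    EU q (fun n => gU q i c Z n ^ 2) = ∑ s, ∑ s', Z s * Z s' * ∏ l, ∑ n ∈ (range (q l)).filter (fun n => ¬ q l ∣ n),
      tau (q l) * phU i (q l) (c l) (s l) n * phU i (q l) (c l) (s' l) n := by
  have hq0 : ∀ l, 0 < q l := fun l => by have := hq l; omega
  have e1 : ∀ n, gU q i c Z n ^ 2 = ∑ s, ∑ s', Z s * Z s' * ∏ l, (phU i (q l) (c l) (s l) n * phU i (q l) (c l) (s' l) n) := fun n => by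
    rw [gU, sq, sum_mul_sum]
    exact sum_congr rfl fun s _ => sum_congr rfl fun s' _ => by rw [pmd]; ring
  simp only [EU, e1]
  rw [sum_comm, mul_sum]
  refine sum_congr rfl fun s _ => ?_
  rw [sum_comm, mul_sum]
  refine sum_congr rfl fun s' _ => ?_
  rw [← mul_sum, sum_filter]
  have := crt_prod univ q hq0 hco (fun l n => if q l ∣ n then 0 else phU i (q l) (c l) (s l) n * phU i (q l) (c l) (s' l) n) (by
    intro l n
    have h1 : ∀ a, phU i (q l) (c l) a (n + q l) = phU i (q l) (c l) a n := fun a => by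
      unfold phU; rw [ph_periodic]
    simp only [h1, Nat.dvd_add_self_right])
  have e2 : ∀ n, (if ∀ l, ¬ q l ∣ n then ∏ l, (phU i (q l) (c l) (s l) n * phU i (q l) (c l) (s' l) n) else 0) =
      ∏ l, (if q l ∣ n then 0 else phU i (q l) (c l) (s l) n * phU i (q l) (c l) (s' l) n) := fun n => by
    split_ifs with h
    · exact prod_congr rfl fun l _ => by rw [if_neg (h l)]
    · push Not at h; obtain ⟨l, hl⟩ := h
      exact (prod_eq_zero (mem_univ l) (by simp [hl])).symm
  rw [sum_congr rfl fun n _ => e2 n, this]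
  have e3 : ∀ l, ∑ n ∈ (range (q l)).filter (fun n => ¬ q l ∣ n),
      tau (q l) * phU i (q l) (c l) (s l) n * phU i (q l) (c l) (s' l) n = tau (q l) * ∑ n ∈ range (q l), (if q l ∣ n then 0 else phU i (q l) (c l) (s l) n * phU i (q l) (c l) (s' l) n) := fun l => by
    rw [sum_filter, mul_sum]; exact sum_congr rfl fun n _ => by split_ifs <;> simp_all; ring
  simp only [e3, pmd]; ring
noncomputable def cL (i : Fin k) (l : ℕ) : Option (Fin k) → ℝ
  | none => 1
  | some j => if j = i then 0 else tau l * (1 - k * tau l)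
lemma EU_le (q : ι → ℕ) (hq : ∀ l, 2 ≤ q l) (hco : HC q) (i : Fin k)
    (c : ι → Fin k → ℕ) (hc : ∀ l j j', j ≠ i → j' ≠ i → c l j % q l = c l j' % q l → j = j')
    (hc0 : ∀ l j, j ≠ i → c l j % q l ≠ 0) (Z : (ι → Option (Fin k)) → ℝ) :
    EU q (fun n => gU q i c Z n ^ 2) ≤ ∑ s, (∏ j, mm q (AA s j)) * Z s ^ 2 := by
  rw [EU_gram q hq hco]
  have := tensor_le (κ := Option (Fin k)) (Ω := ℕ) 1 ι (fun l => (range (q l)).filter (fun n => ¬ q l ∣ n)) (fun l _ => tau (q l))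
    (fun l a n => phU i (q l) (c l) a n) (fun l a => if a = none then 1 else tau (q l)) (fun l _ => (tau_pos (hq l)).le)
    (fun l a => by have := (tau_pos (hq l)).le; split_ifs <;> [norm_num; exact this]) (fun l β => by
      rw [one_mul, one_mul, Fintype.sum_option, gram_units (hq l) i (c l) (hc l) (hc0 l)]
      simp only [reduceIte, reduceCtorEq, one_mul, ← mul_sum]
      have h1 : ∑ j, (if j = i then 0 else β (some j)) ^ 2 ≤ ∑ j, β (some j) ^ 2 :=
        sum_le_sum fun j _ => by split_ifs <;> nlinarith [sq_nonneg (β (some j))]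
      have h2 := mll h1 (tau_pos (hq l)).le
      nlinarith [sq_nonneg (tau (q l) * ∑ j, if j = i then 0 else β (some j))]) Z
  rw [one_mul, one_mul] at this
  refine this.trans (le_of_eq (sum_congr rfl fun s _ => ?_))
  unfold mm; rw [← cfg_prod]
lemma EU_ge (q : ι → ℕ) (hq : ∀ l, 2 ≤ q l) (hco : HC q) (i : Fin k)
    (c : ι → Fin k → ℕ) (hc : ∀ l j j', j ≠ i → j' ≠ i → c l j % q l = c l j' % q l → j = j')
    (hc0 : ∀ l j, j ≠ i → c l j % q l ≠ 0) (hk : ∀ l, k * tau (q l) ≤ 1) (Z : (ι → Option (Fin k)) → ℝ) :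
    ∑ s, (∏ l, cL i (q l) (s l)) * Z s ^ 2 ≤ EU q (fun n => gU q i c Z n ^ 2) := by
  rw [EU_gram q hq hco]
  have := tensor_le (κ := Option (Fin k)) (Ω := ℕ) (-1) ι (fun l => (range (q l)).filter (fun n => ¬ q l ∣ n)) (fun l _ => tau (q l))
    (fun l a n => phU i (q l) (c l) a n) (fun l => cL i (q l)) (fun l _ => (tau_pos (hq l)).le)
    (fun l a => by
      have h1 := (tau_pos (hq l)).le
      have h2 := hk l
      rcases a with _ | j
      · simp [cL]
      · simp only [cL]; split_ifs
        · exact le_rfl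
        · exact mul_nonneg h1 (by linarith)) (fun l β => by
      rw [Fintype.sum_option, gram_units (hq l) i (c l) (hc l) (hc0 l)]
      simp only [cL]
      set b : Fin k → ℝ := fun j => if j = i then 0 else β (some j) with hb
      have h1 : ∑ j, (if j = i then 0 else tau (q l) * (1 - k * tau (q l))) * β (some j) ^ 2 = tau (q l) * (1 - k * tau (q l)) * ∑ j, b j ^ 2 := by
        rw [mul_sum]; exact sum_congr rfl fun j _ => by simp only [hb]; split_ifs <;> simp
      have h2 : (∑ j, b j) ^ 2 ≤ k * ∑ j, b j ^ 2 := by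
        have := sq_sum_le_card_mul_sum_sq (s := (univ : Finset (Fin k))) (f := b)
        simpa using this
      rw [h1]
      have h3 := mll h2 (sq_nonneg (tau (q l)))
      nlinarith) Z
  linarith
end
section
variable {ι : Type} [Fintype ι] [DecidableEq ι] {k : ℕ}
noncomputable def phT {k : ℕ} (i : Fin k) (l : ℕ) (c : Fin k → ℕ) (a : Option (Fin k)) (n : ℕ) : ℝ :=
  if a = some i then tau l else ph l c a n
noncomputable def Mx (i : Fin k) (l : ℕ) (a b : Option (Fin k)) : ℝ :=
  if a = some i then (if b = none then tau l else 0) else (if a = b then 1 else 0)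
noncomputable def ZZ (q : ι → ℕ) (i : Fin k) (Y : (ι → Option (Fin k)) → ℝ) (s : ι → Option (Fin k)) : ℝ :=
  ∑ r, Y r * ∏ l, Mx i (q l) (r l) (s l)
lemma gT_eq (q : ι → ℕ) (i : Fin k) (c : ι → Fin k → ℕ) (Y : (ι → Option (Fin k)) → ℝ) (n : ℕ) :
    ∑ r, Y r * ∏ l, phT i (q l) (c l) (r l) n = gU q i c (ZZ q i Y) n := by
  have h : ∀ l a, phT i (q l) (c l) a n = ∑ b, Mx i (q l) a b * phU i (q l) (c l) b n := by
    intro l a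
    by_cases ha : a = some i
    · rw [sum_eq_single none]
      · simp [phT, ha, Mx, phU, ph]
      · intro b _ hb; simp [Mx, ha, hb]
      · simp
    · rw [sum_eq_single a]
      · simp [phT, ha, Mx, phU]
      · intro b _ hb; simp [Mx, ha, Ne.symm hb]
      · simp
  simp only [h, gU, ZZ, prod_univ_sum, Fintype.piFinset_univ, sum_mul, mul_sum]
  rw [sum_comm]
  refine sum_congr rfl fun s _ => sum_congr rfl fun r _ => ?_
  rw [pmd, mul_assoc]
def ins (i : Fin k) (s : ι → Option (Fin k)) (A : Finset ι) : ι → Option (Fin k) := fun l => if l ∈ A then some i else s l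
lemma AA_ins_self (i : Fin k) (s : ι → Option (Fin k)) (hs : AA s i = ∅) (A : Finset ι) : AA (ins i s A) i = A := by
  ext l
  have : s l ≠ some i := fun h => by have := (mem_AA s i l).2 h; rw [hs] at this; simp at this
  rw [mem_AA]; unfold ins; split_ifs with h <;> simp [h, this]
lemma AA_ins_ne (i : Fin k) (s : ι → Option (Fin k)) (A : Finset ι) (hA : ∀ l ∈ A, s l = none) (j : Fin k) (hj : j ≠ i) :
    AA (ins i s A) j = AA s j := by
  ext l
  rw [mem_AA, mem_AA]; unfold ins; split_ifs with h
  · simp [hA l h, hj.symm]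
  · rfl
lemma ZZ_eq_zero (q : ι → ℕ) (i : Fin k) (Y : (ι → Option (Fin k)) → ℝ) (s : ι → Option (Fin k)) (hs : AA s i ≠ ∅) :
    ZZ q i Y s = 0 := by
  obtain ⟨l, hl⟩ := nonempty_iff_ne_empty.2 hs
  rw [mem_AA] at hl
  refine sum_eq_zero fun r _ => ?_
  rw [prod_eq_zero (mem_univ l), mul_zero]
  simp only [Mx, hl]; split_ifs <;> simp_all
lemma ZZ_eq (q : ι → ℕ) (i : Fin k) (Y : (ι → Option (Fin k)) → ℝ) (s : ι → Option (Fin k)) (hs : AA s i = ∅) :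
    ZZ q i Y s = ∑ A ∈ (univ.filter fun l => s l = none).powerset, Y (ins i s A) * mm q A := by
  have hsi : ∀ l, s l ≠ some i := fun l h => by have := (mem_AA s i l).2 h; rw [hs] at this; simp at this
  set P := (univ.filter fun l => s l = none).powerset with hP
  have hPm : ∀ A ∈ P, ∀ l ∈ A, s l = none := fun A hA l hl => by
    have := mem_powerset.1 hA hl; simpa using this
  have h1 : ∀ A ∈ P, Y (ins i s A) * mm q A = Y (ins i s A) * ∏ l, Mx i (q l) (ins i s A l) (s l) := by
    intro A hA
    congr 1
    unfold mm
    rw [← prod_subset (subset_univ A) (f := fun l => Mx i (q l) (ins i s A l) (s l))]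
    · exact prod_congr rfl fun l hl => by simp [Mx, ins, hl, hPm A hA l hl]
    · intro l _ hl; simp [Mx, ins, hl, hsi]
  rw [sum_congr rfl h1, ← sum_image (f := fun r => Y r * ∏ l, Mx i (q l) (r l) (s l)) (g := ins i s), ZZ]
  · symm
    refine sum_subset (subset_univ _) fun r _ hr => ?_
    by_contra hne
    apply hr
    have hM : ∀ l, Mx i (q l) (r l) (s l) ≠ 0 := fun l => (prod_ne_zero_iff.1 (right_ne_zero_of_mul hne)) l (mem_univ l)
    refine mem_image.2 ⟨AA r i, ?_, ?_⟩
    · refine mem_powerset.2 fun l hl => ?_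
      rw [mem_AA] at hl
      have := hM l
      simp only [Mx, hl, if_true] at this
      by_contra h2
      exact this (if_neg fun h3 => h2 (by simp [h3]))
    · funext l
      have := hM l
      unfold ins
      simp only [mem_AA]
      split_ifs with h
      · exact h.symm
      · simp only [Mx, h, if_false] at this
        by_contra h2
        exact this (if_neg (Ne.symm h2))
  · intro A hA B hB h
    rw [← AA_ins_self i s hs A, h, AA_ins_self i s hs]
noncomputable def NA (q : ι → ℕ) (A : Finset ι) : ℕ := ∏ l ∈ A, q l
lemma NN_eq (q : ι → ℕ) (r : ι → Option (Fin k)) : NN q r = ∏ j, NA q (AA r j) := by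
  unfold NN NA; rw [← cfg_prod]
noncomputable def YY (q : ι → ℕ) (R : ℝ) (g : Finset ι → ℝ) (r : ι → Option (Fin k)) : ℝ :=
  if (NN q r : ℝ) ≤ R then ∏ j, g (AA r j) else 0
lemma prod_ins (i : Fin k) (s : ι → Option (Fin k)) (hs : AA s i = ∅) (A : Finset ι) (hA : ∀ l ∈ A, s l = none) {M : Type} [CommMonoid M]
    (g : Finset ι → M) : ∏ j, g (AA (ins i s A) j) = g A * ∏ j ∈ univ.erase i, g (AA s j) := by
  rw [← mul_prod_erase univ _ (mem_univ i), AA_ins_self i s hs]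
  congr 1
  exact prod_congr rfl fun j hj => by rw [AA_ins_ne i s A hA j (mem_erase.1 hj).1]
noncomputable def G1 (q : ι → ℕ) (g : Finset ι → ℝ) : ℝ := ∑ A, g A * mm q A
lemma ZZ_nonneg (q : ι → ℕ) (hq : ∀ l, 2 ≤ q l) (i : Fin k) (R : ℝ) (g : Finset ι → ℝ) (hg0 : ∀ A, 0 ≤ g A) (s : ι → Option (Fin k)) :
    0 ≤ ZZ q i (YY q R g) s := by
  by_cases hs : AA s i = ∅
  · rw [ZZ_eq q i _ s hs]
    refine sum_nonneg fun A _ => mul_nonneg ?_ (mm_nonneg q hq A)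
    unfold YY; split_ifs
    · exact prod_nonneg fun j _ => hg0 _
    · exact le_rfl
  · rw [ZZ_eq_zero q i _ s hs]
lemma ZZ_le (q : ι → ℕ) (hq : ∀ l, 2 ≤ q l) (i : Fin k) (R : ℝ) (g : Finset ι → ℝ) (hg0 : ∀ A, 0 ≤ g A) (s : ι → Option (Fin k)) :
    ZZ q i (YY q R g) s ≤ if AA s i = ∅ then G1 q g * ∏ j ∈ univ.erase i, g (AA s j) else 0 := by
  split_ifs with hs
  · rw [ZZ_eq q i _ s hs, G1, sum_mul]
    refine (sum_le_sum fun A hA => ?_).trans (sum_le_sum_of_subset_of_nonneg (subset_univ _) fun A _ _ =>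
      mul_nonneg (mul_nonneg (hg0 _) (mm_nonneg q hq A)) (prod_nonneg fun j _ => hg0 _))
    have hA' : ∀ l ∈ A, s l = none := fun l hl => by simpa using mem_powerset.1 hA hl
    have : YY q R g (ins i s A) ≤ g A * ∏ j ∈ univ.erase i, g (AA s j) := by
      unfold YY; split_ifs
      · exact (prod_ins i s hs A hA' g).le
      · exact mul_nonneg (hg0 _) (prod_nonneg fun j _ => hg0 _)
    calc _ ≤ g A * (∏ j ∈ univ.erase i, g (AA s j)) * mm q A := mlr this (mm_nonneg q hq A)
      _ = _ := by ring
  · rw [ZZ_eq_zero q i _ s hs]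
lemma ZZ_ge (q : ι → ℕ) (hq : ∀ l, 2 ≤ q l) (i : Fin k) (R : ℝ) (hR : 0 ≤ R) (g : Finset ι → ℝ) (hg0 : ∀ A, 0 ≤ g A)
    (hga : ∀ A B, A ⊆ B → g B ≤ g A) (hgR : ∀ A, g A ≠ 0 → (NA q A : ℝ) ≤ R) (s : ι → Option (Fin k)) (hs : AA s i = ∅)
    (hN : (NN q s : ℝ) ≤ R) :
    G1 q g * (∏ j ∈ univ.erase i, g (AA s j)) * (1 - ∑ j, ∑ l ∈ AA s j, tau (q l)) ≤ ZZ q i (YY q (R ^ 2) g) s := by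
  rw [ZZ_eq q i _ s hs]
  set S0 := (univ.filter fun l => s l = none)
  have h1 : ∀ A ∈ S0.powerset, YY q (R ^ 2) g (ins i s A) = g A * ∏ j ∈ univ.erase i, g (AA s j) := by
    intro A hA
    have hA' : ∀ l ∈ A, s l = none := fun l hl => by simpa [S0] using mem_powerset.1 hA hl
    unfold YY
    split_ifs with h
    · exact prod_ins i s hs A hA' g
    · have : g A = 0 := by
        by_contra hne
        apply h
        have h2 := hgR A hne
        have h3 : NN q (ins i s A) = NA q A * NN q s := by
          rw [NN_eq, NN_eq, prod_ins i s hs A hA' (NA q), ← mul_prod_erase univ (fun j => NA q (AA s j)) (mem_univ i), hs]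
          simp [NA]
        rw [h3]; push_cast; rw [sq]; gcongr
      rw [this, zero_mul]
  have h4 : ∑ A ∈ S0.powerset, YY q (R ^ 2) g (ins i s A) * mm q A = (∏ j ∈ univ.erase i, g (AA s j)) * ∑ A ∈ S0.powerset, g A * mm q A := by
    rw [mul_sum]; exact sum_congr rfl fun A hA => by rw [h1 A hA]; ring
  rw [h4]
  have h5 : G1 q g * (1 - ∑ j, ∑ l ∈ AA s j, tau (q l)) ≤ ∑ A ∈ S0.powerset, g A * mm q A := by
    have e1 : ∑ j, ∑ l ∈ AA s j, tau (q l) = ∑ l ∈ S0ᶜ, tau (q l) := by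
      simp only [AA, sum_filter]
      rw [Finset.sum_comm, ← sum_filter_add_sum_filter_not univ (fun l => s l = none)]
      have : ∑ x ∈ univ.filter (fun l => s l = none), ∑ j, (if s x = some j then tau (q x) else 0) = 0 :=
        sum_eq_zero fun x hx => by simp [(mem_filter.1 hx).2]
      rw [this, zero_add]
      have : S0ᶜ = univ.filter (fun l => ¬ s l = none) := by ext l; simp [S0]
      rw [this]
      refine sum_congr rfl fun l hl => ?_
      obtain ⟨j, hj⟩ := Option.ne_none_iff_exists'.1 (mem_filter.1 hl).2
      simp [hj]
    rw [e1, mul_sub, mul_one, sub_le_iff_le_add]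
    have e2 : ∀ A : Finset ι, g A * mm q A ≤ (if A ∈ S0.powerset then g A * mm q A else 0) + ∑ l ∈ S0ᶜ, (if l ∈ A then g A * mm q A else 0) := by
      intro A
      have hn := mul_nonneg (hg0 A) (mm_nonneg q hq A)
      have hn2 : 0 ≤ ∑ l ∈ S0ᶜ, (if l ∈ A then g A * mm q A else 0) := sum_nonneg fun l _ => by split_ifs <;> [exact hn; exact le_rfl]
      by_cases hA : A ∈ S0.powerset
      · rw [if_pos hA]; linarith
      · rw [if_neg hA, zero_add]
        rw [mem_powerset, not_subset] at hA
        obtain ⟨l, hl, hl2⟩ := hA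
        have := single_le_sum (f := fun l => if l ∈ A then g A * mm q A else 0) (fun l _ => by split_ifs <;> [exact hn; exact le_rfl]) (mem_compl.2 hl2)
        simpa [hl] using this
    calc G1 q g ≤ ∑ A : Finset ι, ((if A ∈ S0.powerset then g A * mm q A else 0) + ∑ l ∈ S0ᶜ, (if l ∈ A then g A * mm q A else 0)) :=
          sum_le_sum fun A _ => e2 A
      _ ≤ _ := by
        rw [sum_add_distrib, Finset.sum_comm]
        refine add_le_add (le_of_eq ?_) ?_
        · rw [← sum_filter]; congr 1; ext A; simp
        · rw [mul_sum]; refine sum_le_sum fun l _ => ?_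
          rw [mul_comm]
          exact sum_mem_le q hq g hg0 hga l
  calc _ = (∏ j ∈ univ.erase i, g (AA s j)) * (G1 q g * (1 - ∑ j, ∑ l ∈ AA s j, tau (q l))) := by ring
    _ ≤ _ := mll h5 (prod_nonneg fun j _ => hg0 _)
end
section
variable {ι : Type} [Fintype ι] [DecidableEq ι] {k : ℕ}
noncomputable def FF (q : ι → ℕ) (g : Finset ι → ℝ) (i j : Fin k) (A : Finset ι) : ℝ :=
  if j = i then (if A = ∅ then 1 else 0) else g A ^ 2 * mm q A
noncomputable def G2 (q : ι → ℕ) (g : Finset ι → ℝ) : ℝ := ∑ A, g A ^ 2 * mm q A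
lemma FF_nonneg (q : ι → ℕ) (hq : ∀ l, 2 ≤ q l) (g : Finset ι → ℝ) (i j : Fin k) (A) : 0 ≤ FF q g i j A := by
  unfold FF
  have := mm_nonneg q hq A
  split_ifs <;> positivity
lemma FF_sum (q : ι → ℕ) (g : Finset ι → ℝ) (i j : Fin k) : ∑ A, FF q g i j A = if j = i then 1 else G2 q g := by
  unfold FF G2; split_ifs <;> simp
lemma FF_prod_sum (q : ι → ℕ) (g : Finset ι → ℝ) (i : Fin k) : ∏ j, ∑ A, FF q g i j A = G2 q g ^ (k - 1) := by
  simp only [FF_sum]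
  rw [← mul_prod_erase univ _ (mem_univ i), if_pos rfl, one_mul, prod_congr rfl fun j hj => if_neg (mem_erase.1 hj).1]
  simp [prod_const, card_erase_of_mem]
lemma FF_prod (q : ι → ℕ) (g : Finset ι → ℝ) (i : Fin k) (s : ι → Option (Fin k)) (hs : AA s i = ∅) :
    ∏ j, FF q g i j (AA s j) = (∏ j, mm q (AA s j)) * (∏ j ∈ univ.erase i, g (AA s j)) ^ 2 := by
  rw [← mul_prod_erase univ _ (mem_univ i), ← mul_prod_erase univ (fun j => mm q (AA s j)) (mem_univ i), hs]
  simp only [FF, if_true, mm, prod_empty, one_mul]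
  rw [← prod_pow, ← pmd]
  exact prod_congr rfl fun j hj => by rw [if_neg (mem_erase.1 hj).1, mul_comm]
lemma FF_prod_zero (q : ι → ℕ) (g : Finset ι → ℝ) (i : Fin k) (s : ι → Option (Fin k)) (hs : AA s i ≠ ∅) :
    ∏ j, FF q g i j (AA s j) = 0 := prod_eq_zero (mem_univ i) (by simp [FF, hs])
lemma Zsq_le (q : ι → ℕ) (hq : ∀ l, 2 ≤ q l) (i : Fin k) (R : ℝ) (g : Finset ι → ℝ) (hg0 : ∀ A, 0 ≤ g A) (s : ι → Option (Fin k)) :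
    (∏ j, mm q (AA s j)) * ZZ q i (YY q R g) s ^ 2 ≤ G1 q g ^ 2 * ∏ j, FF q g i j (AA s j) := by
  by_cases hs : AA s i = ∅
  · have h1 := ZZ_le q hq i R g hg0 s
    rw [if_pos hs] at h1
    have h2 := pow_le_pow_left₀ (ZZ_nonneg q hq i R g hg0 s) h1 2
    rw [FF_prod q g i s hs]
    calc _ ≤ (∏ j, mm q (AA s j)) * (G1 q g * ∏ j ∈ univ.erase i, g (AA s j)) ^ 2 :=
          mll h2 (prod_nonneg fun j _ => mm_nonneg q hq _)
      _ = _ := by ring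
  · rw [ZZ_eq_zero q i _ s hs, FF_prod_zero q g i s hs]; simp
lemma T_upper (q : ι → ℕ) (hq : ∀ l, 2 ≤ q l) (hco : HC q) (i : Fin k)
    (c : ι → Fin k → ℕ) (hc : ∀ l j j', j ≠ i → j' ≠ i → c l j % q l = c l j' % q l → j = j')
    (hc0 : ∀ l j, j ≠ i → c l j % q l ≠ 0) (R : ℝ) (g : Finset ι → ℝ) (hg0 : ∀ A, 0 ≤ g A)
    (Z : (ι → Option (Fin k)) → ℝ) (hZ : ∀ s, Z s = 0 ∨ Z s = ZZ q i (YY q R g) s) :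
    EU q (fun n => gU q i c Z n ^ 2) ≤ G1 q g ^ 2 * G2 q g ^ (k - 1) := by
  refine (EU_le q hq hco i c hc hc0 _).trans ?_
  have : ∀ s, (∏ j, mm q (AA s j)) * Z s ^ 2 ≤ G1 q g ^ 2 * ∏ j, FF q g i j (AA s j) := fun s => by
    rcases hZ s with h | h
    · rw [h]; simp; exact mul_nonneg (sq_nonneg _) (prod_nonneg fun j _ => FF_nonneg q hq g i j _)
    · rw [h]; exact Zsq_le q hq i R g hg0 s
  refine (sum_le_sum fun s _ => this s).trans ?_
  rw [← mul_sum, ← FF_prod_sum q g i]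
  exact mll (cfg_sum_le _ fun j A => FF_nonneg q hq g i j A) (sq_nonneg _)
lemma marg (F h : Fin k → Finset ι → ℝ) (e : Fin k → ℝ) (hF : ∀ j A, 0 ≤ F j A) (hh : ∀ j A, 0 ≤ h j A) (h1 : ∀ j, ∑ A, F j A * h j A ≤ e j * ∑ A, F j A) :
    ∑ t : Fin k → Finset ι, (∏ j, F j (t j)) * ∏ j, h j (t j) ≤ (∏ j, e j) * ∏ j, ∑ A, F j A := by
  simp only [← pmd]
  rw [← tup_sum (fun j A => F j A * h j A)]
  exact prod_le_prod (fun j _ => sum_nonneg fun A _ => mul_nonneg (hF _ _) (hh _ _)) fun j _ => h1 j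
lemma marg1 (F : Fin k → Finset ι → ℝ) (hF : ∀ j A, 0 ≤ F j A) (h : Finset ι → ℝ) (hh : ∀ A, 0 ≤ h A) (e : ℝ) (j0 : Fin k)
    (h1 : ∑ A, F j0 A * h A ≤ e * ∑ A, F j0 A) :
    ∑ t : Fin k → Finset ι, (∏ j, F j (t j)) * h (t j0) ≤ e * ∏ j, ∑ A, F j A := by
  have := marg F (fun j A => if j = j0 then h A else 1) (fun j => if j = j0 then e else 1) hF
    (fun j A => by split_ifs <;> [exact hh _; norm_num]) (fun j => by
      by_cases hj : j = j0
      · simp [hj, h1]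
      · simp [hj])
  simpa using this
lemma marg2 (F : Fin k → Finset ι → ℝ) (hF : ∀ j A, 0 ≤ F j A) (h : Finset ι → ℝ) (hh : ∀ A, 0 ≤ h A) (e : ℝ) (j0 j1 : Fin k) (hne : j0 ≠ j1)
    (h1 : ∀ j, ∑ A, F j A * h A ≤ e * ∑ A, F j A) :
    ∑ t : Fin k → Finset ι, (∏ j, F j (t j)) * (h (t j0) * h (t j1)) ≤ e ^ 2 * ∏ j, ∑ A, F j A := by
  have := marg F (fun j A => (if j = j0 then h A else 1) * (if j = j1 then h A else 1)) (fun j => (if j = j0 then e else 1) * (if j = j1 then e else 1)) hF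
    (fun j A => mul_nonneg (by split_ifs <;> [exact hh _; norm_num]) (by split_ifs <;> [exact hh _; norm_num])) (fun j => by
      by_cases hj : j = j0
      · subst hj; simpa [hne] using h1 j
      · by_cases hj1 : j = j1
        · subst hj1; simpa [hj] using h1 j
        · simp [hj, hj1])
  simp only [pmd] at this
  simpa [sq, -mul_ite, -ite_mul] using this
lemma FF_mem (q : ι → ℕ) (hq : ∀ l, 2 ≤ q l) (g : Finset ι → ℝ) (hg0 : ∀ A, 0 ≤ g A) (hga : ∀ A B, A ⊆ B → g B ≤ g A) (i j : Fin k) (l : ι) :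
    ∑ A, FF q g i j A * (if l ∈ A then 1 else 0) ≤ tau (q l) * ∑ A, FF q g i j A := by
  by_cases hj : j = i
  · have : ∀ A : Finset ι, FF q g i j A * (if l ∈ A then 1 else 0) = 0 := fun A => by
      simp only [FF, hj, if_true]; split_ifs with h1 h2 <;> simp_all
    rw [sum_congr rfl fun A _ => this A, sum_const_zero]
    exact mul_nonneg (tau_pos (hq l)).le (sum_nonneg fun A _ => FF_nonneg q hq g i j A)
  · have := sum_mem_le q hq (fun A => g A ^ 2) (fun A => sq_nonneg _) (fun A B h => pow_le_pow_left₀ (hg0 _) (hga A B h) 2) l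
    simpa [FF, hj] using this
lemma T_beta (q : ι → ℕ) (hq : ∀ l, 2 ≤ q l) (hco : HC q) (i : Fin k)
    (c : ι → Fin k → ℕ) (hc : ∀ l j j', j ≠ i → j' ≠ i → c l j % q l = c l j' % q l → j = j')
    (hc0 : ∀ l j, j ≠ i → c l j % q l ≠ 0) (R : ℝ) (g : Finset ι → ℝ) (hg0 : ∀ A, 0 ≤ g A) (hga : ∀ A B, A ⊆ B → g B ≤ g A) (l0 : ι) :
    EU q (fun n => gU q i c (fun s => if s l0 = none then 0 else ZZ q i (YY q R g) s) n ^ 2) ≤ k * tau (q l0) * (G1 q g ^ 2 * G2 q g ^ (k - 1)) := by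
  refine (EU_le q hq hco i c hc hc0 _).trans ?_
  have h1 : ∀ s : ι → Option (Fin k), (∏ j, mm q (AA s j)) * (if s l0 = none then 0 else ZZ q i (YY q R g) s) ^ 2 ≤
      G1 q g ^ 2 * ∑ j0, (∏ j, FF q g i j (AA s j)) * (if l0 ∈ AA s j0 then 1 else 0) := fun s => by
    split_ifs with h
    · simp only [mem_AA, h]; simp
    · obtain ⟨j, hj⟩ := Option.ne_none_iff_exists'.1 h
      refine (Zsq_le q hq i R g hg0 s).trans (mll ?_ (sq_nonneg _))
      simp [mem_AA, hj]
  refine (sum_le_sum fun s _ => h1 s).trans ?_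
  rw [← mul_sum, Finset.sum_comm]
  have h2 : ∀ j0 : Fin k, ∑ s : ι → Option (Fin k), (∏ j, FF q g i j (AA s j)) * (if l0 ∈ AA s j0 then 1 else 0) ≤ tau (q l0) * G2 q g ^ (k - 1) := fun j0 => by
    rw [← FF_prod_sum q g i]
    refine le_trans ?_ (marg1 (FF q g i) (fun j A => FF_nonneg q hq g i j A) (fun A => if l0 ∈ A then 1 else 0) (fun A => by split_ifs <;> norm_num) (tau (q l0)) j0
      (FF_mem q hq g hg0 hga i j0 l0))
    rw [← sum_image (f := fun t : Fin k → Finset ι => (∏ j, FF q g i j (t j)) * (if l0 ∈ t j0 then 1 else 0)) (g := AA) (fun x _ y _ h => AA_inj h)]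
    exact sum_le_sum_of_subset_of_nonneg (subset_univ _) fun t _ _ => mul_nonneg (prod_nonneg fun j _ => FF_nonneg q hq g i j _) (by split_ifs <;> norm_num)
  calc _ ≤ G1 q g ^ 2 * ∑ j0 : Fin k, tau (q l0) * G2 q g ^ (k - 1) := mll (sum_le_sum fun j _ => h2 j) (sq_nonneg _)
    _ = _ := by simp; ring
end
section
variable {ι : Type} [Fintype ι] [DecidableEq ι] {k : ℕ}
lemma prod_one_sub_ge {α : Type} [DecidableEq α] (S : Finset α) (f : α → ℝ) (h0 : ∀ a ∈ S, 0 ≤ f a) (h1 : ∀ a ∈ S, f a ≤ 1) :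
    1 - ∑ a ∈ S, f a ≤ ∏ a ∈ S, (1 - f a) := by
  induction S using Finset.induction_on with
  | empty => simp
  | insert a S ha ih =>
    rw [sum_insert ha, prod_insert ha]
    have ih := ih (fun b hb => h0 b (mem_insert_of_mem hb)) (fun b hb => h1 b (mem_insert_of_mem hb))
    have a0 := h0 a (mem_insert_self _ _)
    have a1 := h1 a (mem_insert_self _ _)
    have s0 : 0 ≤ ∑ b ∈ S, f b := sum_nonneg fun b hb => h0 b (mem_insert_of_mem hb)
    nlinarith [mll ih (sub_nonneg.2 a1)]
noncomputable def i01 (l : ι) (A : Finset ι) : ℝ := if l ∈ A then 1 else 0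
lemma i01_nonneg (l : ι) (A : Finset ι) : 0 ≤ i01 l A := by unfold i01; split_ifs <;> norm_num
noncomputable def HH (q : ι → ℕ) (R : ℝ) (t : Fin k → Finset ι) : ℝ :=
  1 - (∑ j, ∑ j', if j ≠ j' then ∑ l, i01 l (t j) * i01 l (t j') else 0) - (∑ j, log (NA q (t j)) / log R)
    - (k + 2) * ∑ j, ∑ l, tau (q l) * i01 l (t j)
lemma NA_pos (q : ι → ℕ) (hq : ∀ l, 2 ≤ q l) (A : Finset ι) : 1 ≤ NA q A :=
  Nat.one_le_iff_ne_zero.2 (prod_ne_zero_iff.2 fun l _ => by have := hq l; omega)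
lemma HH_sum (q : ι → ℕ) (hq : ∀ l, 2 ≤ q l) (i : Fin k) (R δ : ℝ) (hR : 1 < R) (hδ : 0 ≤ δ) (g : Finset ι → ℝ) (hg0 : ∀ A, 0 ≤ g A)
    (hga : ∀ A B, A ⊆ B → g B ≤ g A) (hlog : ∑ A, log (NA q A) * (g A ^ 2 * mm q A) ≤ δ * log R * G2 q g) :
    G2 q g ^ (k - 1) * (1 - (2 * k ^ 2 + 2 * k) * ∑ l, tau (q l) ^ 2 - k * δ) ≤ ∑ t : Fin k → Finset ι, (∏ j, FF q g i j (t j)) * HH q R t := by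
  have hlR : 0 < log R := Real.log_pos hR
  set P := G2 q g ^ (k - 1) with hP
  have hPe : ∏ j, ∑ A, FF q g i j A = P := FF_prod_sum q g i
  have hF := fun j A => FF_nonneg q hq g i j A
  have hP0 : 0 ≤ P := hPe ▸ prod_nonneg fun j _ => sum_nonneg fun A _ => hF j A
  have hT : ∑ t : Fin k → Finset ι, ∏ j, FF q g i j (t j) = P := by rw [← hPe, tup_sum]
  have a1 : ∀ j j' : Fin k, j ≠ j' → ∀ l, ∑ t : Fin k → Finset ι, (∏ j, FF q g i j (t j)) * (i01 l (t j) * i01 l (t j')) ≤ tau (q l) ^ 2 * P := fun j j' hj l => by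
    rw [← hPe]; exact marg2 _ hF (i01 l) (i01_nonneg l) _ j j' hj fun j => FF_mem q hq g hg0 hga i j l
  have a2 : ∀ j : Fin k, ∀ l, ∑ t : Fin k → Finset ι, (∏ j, FF q g i j (t j)) * i01 l (t j) ≤ tau (q l) * P := fun j l => by
    rw [← hPe]; exact marg1 _ hF (i01 l) (i01_nonneg l) _ j (FF_mem q hq g hg0 hga i j l)
  have a3 : ∀ j : Fin k, ∑ t : Fin k → Finset ι, (∏ j, FF q g i j (t j)) * log (NA q (t j)) ≤ δ * log R * P := fun j => by
    rw [← hPe]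
    refine marg1 _ hF (fun A => log (NA q A)) (fun A => Real.log_natCast_nonneg _) _ j ?_
    by_cases hj : j = i
    · have : ∀ A : Finset ι, FF q g i j A * log (NA q A) = 0 := fun A => by
        simp only [FF, hj, if_true]; split_ifs with h1 <;> simp [h1, NA]
      rw [sum_congr rfl fun A _ => this A, sum_const_zero]
      exact mul_nonneg (by positivity) (sum_nonneg fun A _ => hF j A)
    · rw [FF_sum, if_neg hj]
      refine le_trans (le_of_eq ?_) hlog
      exact sum_congr rfl fun A _ => by rw [FF, if_neg hj, mul_comm]
  unfold HH
  simp only [mul_sub, sum_sub_distrib, mul_one, hT]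
  have b1 : ∑ t : Fin k → Finset ι, (∏ j, FF q g i j (t j)) * (∑ j, ∑ j', if j ≠ j' then ∑ l, i01 l (t j) * i01 l (t j') else 0) ≤ k ^ 2 * (∑ l, tau (q l) ^ 2) * P := by
    simp only [mul_sum]
    rw [Finset.sum_comm]
    calc _ ≤ ∑ j : Fin k, ∑ j' : Fin k, (∑ l, tau (q l) ^ 2) * P := by
          refine sum_le_sum fun j _ => ?_
          rw [Finset.sum_comm]
          refine sum_le_sum fun j' _ => ?_
          by_cases h : j = j'
          · simp [h]; positivity
          · simp only [ne_eq, h, not_false_eq_true, if_true, mul_sum]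
            rw [Finset.sum_comm, sum_mul]
            exact sum_le_sum fun l _ => a1 j j' h l
      _ = _ := by simp only [← mul_sum]; simp; ring
  have b2 : ∑ t : Fin k → Finset ι, (∏ j, FF q g i j (t j)) * (∑ j, log (NA q (t j)) / log R) ≤ k * δ * P := by
    simp only [mul_sum]
    rw [Finset.sum_comm]
    calc _ ≤ ∑ j : Fin k, δ * P := by
          refine sum_le_sum fun j _ => ?_
          simp only [← mul_div_assoc]
          rw [← sum_div, div_le_iff₀ hlR]
          linarith [a3 j]
      _ = _ := by simp; ring
  have b3 : ∑ t : Fin k → Finset ι, (∏ j, FF q g i j (t j)) * ((k + 2) * ∑ j, ∑ l, tau (q l) * i01 l (t j)) ≤ (k + 2) * (k * (∑ l, tau (q l) ^ 2) * P) := by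
    simp only [mul_left_comm _ ((k:ℝ)+2)]
    rw [← mul_sum]
    refine mll ?_ (by positivity)
    simp only [mul_sum]
    rw [Finset.sum_comm]
    calc _ ≤ ∑ j : Fin k, (∑ l, tau (q l) ^ 2) * P := by
          refine sum_le_sum fun j _ => ?_
          rw [Finset.sum_comm, sum_mul]
          refine sum_le_sum fun l _ => ?_
          simp only [mul_left_comm _ (tau (q l))]
          rw [← mul_sum, sq, mul_assoc]
          exact mll (a2 j l) (tau_pos (hq l)).le
      _ = _ := by simp only [← mul_sum]; simp; ring
  nlinarith
lemma cL_prod (q : ι → ℕ) (hq : ∀ l, 2 ≤ q l) (hk : ∀ l, k * tau (q l) ≤ 1) (i : Fin k) (s : ι → Option (Fin k)) (hs : AA s i = ∅) :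
    (∏ j, mm q (AA s j)) * (1 - k * ∑ j, ∑ l ∈ AA s j, tau (q l)) ≤ ∏ l, cL i (q l) (s l) := by
  have h1 : ∏ l, cL i (q l) (s l) = ∏ l, ((if s l = none then 1 else tau (q l)) * (1 - if s l = none then 0 else k * tau (q l))) :=
    prod_congr rfl fun l _ => by
      rcases h : s l with _ | j
      · simp [cL]
      · have : j ≠ i := fun hj => by
          have := (mem_AA s i l).2 (hj ▸ h); rw [hs] at this; simp at this
        simp [cL, this]
  have h2 : ∑ l, (if s l = none then (0:ℝ) else k * tau (q l)) = k * ∑ j, ∑ l ∈ AA s j, tau (q l) := by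
    have := cfg_prod (M := Multiplicative ℝ) (fun l => Multiplicative.ofAdd (tau (q l))) s
    have h3 : ∑ l, (if s l = none then (0:ℝ) else tau (q l)) = ∑ j, ∑ l ∈ AA s j, tau (q l) := this
    rw [← h3, mul_sum]
    exact sum_congr rfl fun l _ => by split_ifs <;> simp
  rw [h1, pmd, cfg_prod, ← h2]
  refine mll (prod_one_sub_ge _ _ ?_ ?_) (prod_nonneg fun j _ => mm_nonneg q hq _)
  · intro l _; have := (tau_pos (hq l)).le; split_ifs <;> positivity
  · intro l _; have := hk l; split_ifs <;> [norm_num; exact this]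
lemma sum_i01 (f : ι → ℝ) (A : Finset ι) : ∑ l, f l * i01 l A = ∑ l ∈ A, f l := by
  simp [i01]
lemma T_lower (q : ι → ℕ) (hq : ∀ l, 2 ≤ q l) (hco : HC q) (i : Fin k)
    (c : ι → Fin k → ℕ) (hc : ∀ l j j', j ≠ i → j' ≠ i → c l j % q l = c l j' % q l → j = j')
    (hc0 : ∀ l j, j ≠ i → c l j % q l ≠ 0) (hk : ∀ l, k * tau (q l) ≤ 1)
    (R δ : ℝ) (hR : 1 < R) (hδ : 0 ≤ δ) (g : Finset ι → ℝ) (hg0 : ∀ A, 0 ≤ g A)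
    (hga : ∀ A B, A ⊆ B → g B ≤ g A) (hgR : ∀ A, g A ≠ 0 → (NA q A : ℝ) ≤ R)
    (hlog : ∑ A, log (NA q A) * (g A ^ 2 * mm q A) ≤ δ * log R * G2 q g) :
    G1 q g ^ 2 * (G2 q g ^ (k - 1) * (1 - (2 * k ^ 2 + 2 * k) * ∑ l, tau (q l) ^ 2 - k * δ)) ≤
      EU q (fun n => gU q i c (ZZ q i (YY q (R ^ 2) g)) n ^ 2) := by
  have hlR : 0 < log R := Real.log_pos hR
  refine le_trans ?_ (EU_ge q hq hco i c hc hc0 hk _)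
  have nn1 : ∀ t : Fin k → Finset ι, 0 ≤ ∑ j, ∑ j', if j ≠ j' then ∑ l, i01 l (t j) * i01 l (t j') else 0 := fun t =>
    sum_nonneg fun j _ => sum_nonneg fun j' _ => by
      split_ifs <;> [exact sum_nonneg fun l _ => mul_nonneg (i01_nonneg _ _) (i01_nonneg _ _); exact le_rfl]
  have nn2 : ∀ t : Fin k → Finset ι, 0 ≤ ∑ j, log (NA q (t j)) / log R := fun t =>
    sum_nonneg fun j _ => div_nonneg (Real.log_natCast_nonneg _) hlR.le
  have nn3 : ∀ t : Fin k → Finset ι, 0 ≤ ∑ j, ∑ l, tau (q l) * i01 l (t j) := fun t =>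
    sum_nonneg fun j _ => sum_nonneg fun l _ => mul_nonneg (tau_pos (hq l)).le (i01_nonneg _ _)
  have h1 := HH_sum q hq i R δ hR hδ g hg0 hga hlog
  have h2 := cfg_sum_ge (FF q g i) (fun j A => FF_nonneg q hq g i j A) (HH q R) (fun t ht a b hab => by
    by_contra hd
    obtain ⟨l, hla, hlb⟩ := not_disjoint_iff.1 hd
    have : (1:ℝ) ≤ ∑ j, ∑ j', if j ≠ j' then ∑ l, i01 l (t j) * i01 l (t j') else 0 := by
      have e0 : ∀ j j' : Fin k, 0 ≤ if j ≠ j' then ∑ l, i01 l (t j) * i01 l (t j') else 0 := fun j j' => by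
        split_ifs <;> [exact sum_nonneg fun l _ => mul_nonneg (i01_nonneg _ _) (i01_nonneg _ _); exact le_rfl]
      refine le_trans ?_ (single_le_sum (fun j _ => sum_nonneg fun j' _ => e0 j j') (mem_univ a))
      refine le_trans ?_ (single_le_sum (fun j' _ => e0 a j') (mem_univ b))
      rw [if_pos hab]
      refine le_trans ?_ (single_le_sum (fun l _ => mul_nonneg (i01_nonneg l _) (i01_nonneg l _)) (mem_univ l))
      simp [i01, hla, hlb]
    unfold HH at ht
    have := nn2 t
    have := mul_nonneg (by positivity : (0:ℝ) ≤ k + 2) (nn3 t)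
    linarith)
  refine (mll (h1.trans h2) (sq_nonneg _)).trans ?_
  rw [mul_sum]
  refine sum_le_sum fun s _ => ?_
  have hcL : 0 ≤ ∏ l, cL i (q l) (s l) := prod_nonneg fun l _ => by
    rcases s l with _ | j
    · simp [cL]
    · simp only [cL]; split_ifs <;> [exact le_rfl; exact mul_nonneg (tau_pos (hq l)).le (by linarith [hk l])]
  have hFp : 0 ≤ ∏ j, FF q g i j (AA s j) := prod_nonneg fun j _ => FF_nonneg q hq g i j _
  by_cases hs : AA s i = ∅
  swap
  · rw [FF_prod_zero q g i s hs]; simp; positivity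
  by_cases hH : HH q R (AA s) ≤ 0
  · have : G1 q g ^ 2 * ((∏ j, FF q g i j (AA s j)) * HH q R (AA s)) ≤ 0 :=
      mul_nonpos_of_nonneg_of_nonpos (sq_nonneg _) (mul_nonpos_of_nonneg_of_nonpos hFp hH)
    exact this.trans (by positivity)
  push Not at hH
  set σ := ∑ j, ∑ l ∈ AA s j, tau (q l) with hσ
  have hσe : ∑ j, ∑ l, tau (q l) * i01 l (AA s j) = σ := sum_congr rfl fun j _ => sum_i01 _ _
  have hσ0 : 0 ≤ σ := hσe ▸ nn3 _
  have m1 := nn1 (AA s)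
  have m2 := nn2 (AA s)
  have hHle : HH q R (AA s) ≤ 1 - (k + 2) * σ := by unfold HH; rw [hσe]; linarith
  have hN : (NN q s : ℝ) ≤ R := by
    have : ∑ j, log (NA q (AA s j)) / log R < 1 := by
      unfold HH at hH; rw [hσe] at hH
      have : 0 ≤ (k + 2) * σ := by positivity
      linarith
    rw [← sum_div, div_lt_one hlR, ← Real.log_prod (fun j _ => by have := NA_pos q hq (AA s j); positivity)] at this
    have h := (Real.log_lt_log_iff (by
      refine prod_pos fun j _ => ?_
      have := NA_pos q hq (AA s j); positivity) (by linarith)).1 this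
    rw [NN_eq]; push_cast; exact h.le
  have hZ := ZZ_ge q hq i R (by linarith) g hg0 hga hgR s hs hN
  rw [← hσ] at hZ
  have hk0 : (0:ℝ) ≤ k := Nat.cast_nonneg _
  have hσ1 : (k + 2) * σ ≤ 1 := by linarith
  have hG1 : 0 ≤ G1 q g := sum_nonneg fun A _ => mul_nonneg (hg0 _) (mm_nonneg q hq A)
  have hgp : 0 ≤ ∏ j ∈ univ.erase i, g (AA s j) := prod_nonneg fun j _ => hg0 _
  have hks : 0 ≤ k * σ := by positivity
  have hZ2 := pow_le_pow_left₀ (mul_nonneg (mul_nonneg hG1 hgp) (by nlinarith)) hZ 2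
  have hc2 := cL_prod q hq hk i s hs
  rw [← hσ] at hc2
  have hmm : 0 ≤ ∏ j, mm q (AA s j) := prod_nonneg fun j _ => mm_nonneg q hq _
  rw [FF_prod q g i s hs]
  refine le_trans ?_ (mul_le_mul hc2 hZ2 (sq_nonneg _) hcL)
  have hpoly : HH q R (AA s) ≤ (1 - k * σ) * (1 - σ) ^ 2 := by
    have : 0 ≤ (1 - k * σ) * σ ^ 2 := mul_nonneg (by nlinarith) (sq_nonneg _)
    nlinarith [mul_nonneg hks hσ0]
  calc _ = (G1 q g ^ 2 * (∏ j, mm q (AA s j)) * (∏ j ∈ univ.erase i, g (AA s j)) ^ 2) * HH q R (AA s) := by ring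
    _ ≤ (G1 q g ^ 2 * (∏ j, mm q (AA s j)) * (∏ j ∈ univ.erase i, g (AA s j)) ^ 2) * ((1 - k * σ) * (1 - σ) ^ 2) :=
      mll hpoly (by positivity)
    _ = _ := by ring
end
section
lemma pow_dvd_fact (p k : ℕ) (hp : 0 < p) : p ^ k ∣ (p * k).factorial := by
  induction k with
  | zero => simp
  | succ k ih =>
    rw [pow_succ, mul_add, mul_one]
    exact (mul_dvd_mul ih (Nat.dvd_factorial hp le_rfl)).trans (Nat.factorial_mul_factorial_dvd_factorial_add _ _)
lemma sum_log_div_le (n : ℕ) (hn : 1 ≤ n) : ∑ p ∈ n.primesLE, log p / p ≤ log n + log 4 := by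
  have hn0 : (0:ℝ) < n := by exact_mod_cast hn
  have h1 : ∏ p ∈ n.primesLE, p ^ (n / p) ∣ n.factorial := by
    refine Finset.prod_dvd_of_isRelPrime (fun p hp q hq hpq => ?_) fun p hp => ?_
    · exact (Nat.coprime_iff_isRelPrime.1 (Nat.Coprime.pow _ _ ((Nat.coprime_primes (Nat.mem_primesLE.1 hp).2 (Nat.mem_primesLE.1 hq).2).2 hpq)))
    · exact (pow_dvd_fact p (n / p) (Nat.mem_primesLE.1 hp).2.pos).trans (Nat.factorial_dvd_factorial (Nat.mul_div_le n p))
  have h2 := Nat.le_of_dvd (Nat.factorial_pos n) h1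
  have h3 : ∏ p ∈ n.primesLE, p ^ (n / p) ≤ n ^ n := h2.trans (Nat.factorial_le_pow n)
  have h4 : ∑ p ∈ n.primesLE, ((n / p : ℕ) : ℝ) * log p ≤ n * log n := by
    have := Real.log_le_log (by
      have : 0 < ∏ p ∈ n.primesLE, p ^ (n / p) := prod_pos fun p hp => pow_pos (Nat.mem_primesLE.1 hp).2.pos _
      exact_mod_cast this) (by exact_mod_cast h3 : ((∏ p ∈ n.primesLE, p ^ (n / p) : ℕ) : ℝ) ≤ (n:ℝ) ^ n)
    rw [Real.log_pow] at this
    push_cast at this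
    rw [Real.log_prod (fun p hp => by have := (Nat.mem_primesLE.1 hp).2.pos; positivity)] at this
    simpa [Real.log_pow] using this
  have h5 := Chebyshev.theta_le_log4_mul_x hn0.le
  rw [Chebyshev.theta_eq_sum_primesLE_log] at h5
  have h6 : ∀ p ∈ n.primesLE, n * (log p / p) - log p ≤ ((n / p : ℕ) : ℝ) * log p := fun p hp => by
    have hp0 : (0:ℝ) < p := by exact_mod_cast (Nat.mem_primesLE.1 hp).2.pos
    have : (n:ℝ) / p - 1 ≤ ((n / p : ℕ) : ℝ) := by
      have := (Nat.lt_div_mul_add (a := n) (Nat.mem_primesLE.1 hp).2.pos)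
      rw [sub_le_iff_le_add, div_le_iff₀ hp0]
      have h' : (n:ℝ) < (n / p : ℕ) * p + p := by exact_mod_cast this
      linarith
    have hl : 0 ≤ log p := Real.log_natCast_nonneg _
    calc _ = ((n:ℝ) / p - 1) * log p := by ring
      _ ≤ _ := mlr this hl
  have h7 := sum_le_sum h6
  rw [sum_sub_distrib, ← mul_sum] at h7
  have : n * ∑ p ∈ n.primesLE, log p / p ≤ n * (log n + log 4) := by linarith
  exact le_of_mul_le_mul_left this hn0
lemma rpow_tele (n : ℕ) (hn : 1 ≤ n) (ε : ℝ) (hε : 0 < ε) :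
    ε * ((n + 1 : ℕ) : ℝ) ^ (-(1 + ε)) ≤ (n : ℝ) ^ (-ε) - ((n + 1 : ℕ) : ℝ) ^ (-ε) := by
  have hn0 : (0:ℝ) < n := by exact_mod_cast hn
  have hn1 : (0:ℝ) < ((n + 1 : ℕ) : ℝ) := by positivity
  have h1 : log n ≤ log (n + 1 : ℕ) - 1 / (n + 1 : ℕ) := by
    have := Real.log_le_sub_one_of_pos (div_pos hn0 hn1)
    rw [Real.log_div hn0.ne' hn1.ne'] at this
    have e : (n:ℝ) / (n + 1 : ℕ) - 1 = - (1 / (n + 1 : ℕ)) := by push_cast; field_simp; ring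
    linarith
  have h2 : ((n + 1 : ℕ) : ℝ) ^ (-ε) * (1 + ε / (n + 1 : ℕ)) ≤ (n : ℝ) ^ (-ε) := by
    rw [Real.rpow_def_of_pos hn0, Real.rpow_def_of_pos hn1]
    calc _ ≤ exp (log (n + 1 : ℕ) * -ε) * exp (ε / (n + 1 : ℕ)) :=
          mll (by linarith [Real.add_one_le_exp (ε / (n + 1 : ℕ))]) (Real.exp_pos _).le
      _ = exp (log (n + 1 : ℕ) * -ε + (ε / (n + 1 : ℕ))) := (Real.exp_add _ _).symm
      _ ≤ _ := Real.exp_le_exp.2 (by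
        have : ε / (n + 1 : ℕ) = ε * (1 / (n + 1 : ℕ)) := by ring
        nlinarith)
  have h3 : ((n + 1 : ℕ) : ℝ) ^ (-(1 + ε)) = ((n + 1 : ℕ) : ℝ) ^ (-ε) / (n + 1 : ℕ) := by
    rw [← Real.rpow_sub_one hn1.ne']; congr 1; ring
  rw [h3]
  calc _ = ((n + 1 : ℕ) : ℝ) ^ (-ε) * (1 + ε / (n + 1 : ℕ)) - ((n + 1 : ℕ) : ℝ) ^ (-ε) := by ring
    _ ≤ _ := by linarith
lemma zeta_le (ε : ℝ) (hε : 0 < ε) : ∑' n : ℕ, (n : ℝ) ^ (-(1 + ε)) ≤ 1 + 1 / ε := by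
  refine Real.tsum_le_of_sum_range_le (fun n => by positivity) fun N => ?_
  have key : ∀ N : ℕ, ∑ n ∈ range (N + 2), (n : ℝ) ^ (-(1 + ε)) ≤ 1 + (1 - ((N + 1 : ℕ) : ℝ) ^ (-ε)) / ε := fun N => by
    induction N with
    | zero => simp [sum_range_succ]; rw [Real.zero_rpow (by linarith)]
    | succ N ih =>
      rw [sum_range_succ]
      have := rpow_tele (N + 1) (by omega) ε hε
      have h2 : ((N + 1 + 1 : ℕ) : ℝ) ^ (-(1 + ε)) ≤ (((N + 1 : ℕ) : ℝ) ^ (-ε) - ((N + 1 + 1 : ℕ) : ℝ) ^ (-ε)) / ε := by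
        rw [le_div_iff₀ hε]; linarith
      calc _ ≤ 1 + (1 - ((N + 1 : ℕ) : ℝ) ^ (-ε)) / ε + (((N + 1 : ℕ) : ℝ) ^ (-ε) - ((N + 1 + 1 : ℕ) : ℝ) ^ (-ε)) / ε := add_le_add ih h2
        _ = _ := by ring
  calc _ ≤ ∑ n ∈ range (N + 2), (n : ℝ) ^ (-(1 + ε)) :=
        sum_le_sum_of_subset_of_nonneg (range_mono (by omega)) fun n _ _ => by positivity
    _ ≤ _ := (key N).trans (by
      have : 0 ≤ ((N + 1 : ℕ) : ℝ) ^ (-ε) := by positivity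
      have := div_le_div_of_nonneg_right (by linarith : 1 - ((N + 1 : ℕ) : ℝ) ^ (-ε) ≤ 1) hε.le
      linarith)
noncomputable def powHom (s : ℝ) : ℕ →* ℝ where
  toFun n := (n : ℝ) ^ (-s)
  map_one' := by simp
  map_mul' m n := by push_cast; exact Real.mul_rpow (by positivity) (by positivity)
noncomputable def PP (n : ℕ) : ℝ := ∏ p ∈ n.primesLE, (1 - 1 / (p : ℝ))⁻¹
lemma mertens_upper (n : ℕ) (hn : 2 ≤ n) : PP n ≤ 3 * exp 6 * log n := by
  have hn0 : (0:ℝ) < n := by positivity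
  have hl2 : log 2 ≤ log n := Real.log_le_log (by norm_num) (by exact_mod_cast hn)
  have hlog2 := Real.log_two_gt_d9
  have hln : 0 < log n := by linarith
  set ε := 1 / log n with hε
  have hε0 : 0 < ε := by positivity
  have h1 : ∏ p ∈ n.primesLE, (1 - powHom (1 + ε) p)⁻¹ ≤ 1 + 1 / ε := by
    have hs : Summable (powHom (1 + ε)) := Real.summable_nat_rpow.2 (by linarith)
    have := EulerProduct.prod_primesBelow_geometric_eq_tsum_smoothNumbers hs (n + 1)
    rw [show n.primesLE = (n + 1).primesBelow from rfl, this]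
    refine (hs.tsum_subtype_le _ _ fun n => ?_).trans (zeta_le ε hε0)
    simp only [powHom, MonoidHom.coe_mk, OneHom.coe_mk]; positivity
  have h2 : ∀ p ∈ n.primesLE, (1 - 1 / (p : ℝ))⁻¹ ≤ (1 - powHom (1 + ε) p)⁻¹ * exp (2 * ε * (log p / p)) := fun p hp => by
    have hpp := (Nat.mem_primesLE.1 hp).2
    have hp2 : (2:ℝ) ≤ p := by exact_mod_cast hpp.two_le
    have hp0 : (0:ℝ) < p := by linarith
    have e1 : powHom (1 + ε) p = (1 / p) * (p:ℝ) ^ (-ε) := by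
      simp only [powHom, MonoidHom.coe_mk, OneHom.coe_mk]
      rw [neg_add, Real.rpow_add hp0, Real.rpow_neg_one]; simp
    have e2 : 1 - ε * log p ≤ (p:ℝ) ^ (-ε) := by
      rw [Real.rpow_def_of_pos hp0]; linarith [Real.add_one_le_exp (log p * -ε)]
    have e3 : (p:ℝ) ^ (-ε) ≤ 1 := Real.rpow_le_one_of_one_le_of_nonpos (by linarith) (by linarith)
    have e4 : 1 / (p:ℝ) ≤ 1 / 2 := one_div_le_one_div_of_le (by norm_num) hp2
    have e5 : 0 < 1 / (p:ℝ) := by positivity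
    have e6 : 0 < 1 - powHom (1 + ε) p := by rw [e1]; nlinarith
    have e7 : 0 ≤ log p := Real.log_natCast_nonneg _
    rw [inv_eq_one_div, inv_mul_eq_div, ddi (by linarith) e6, one_mul]
    have e8 : log p / p = (1 / p) * log p := by ring
    have := Real.add_one_le_exp (2 * ε * (log p / p))
    rw [e8] at this ⊢
    calc _ ≤ (1 - 1 / (p:ℝ)) + (1 / p) * (ε * log p) := by rw [e1]; nlinarith
      _ ≤ (2 * ε * (1 / p * log p) + 1) * (1 - 1 / p) := by
        have : 0 ≤ ε * (1 / p * log p) := by positivity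
        nlinarith
      _ ≤ _ := mlr this (by linarith)
  have h3 := prod_le_prod (fun p hp => ?_) h2
  swap
  · have hp2 : (2:ℝ) ≤ p := by exact_mod_cast (Nat.mem_primesLE.1 hp).2.two_le
    have e4 : 1 / (p:ℝ) ≤ 1 / 2 := one_div_le_one_div_of_le (by norm_num) hp2
    exact inv_nonneg.2 (by linarith)
  rw [pmd, ← Real.exp_sum, ← mul_sum] at h3
  refine h3.trans ?_
  have h4 := sum_log_div_le n (by omega)
  have hl4 : log 4 = 2 * log 2 := by
    rw [show (4:ℝ) = 2 ^ 2 by norm_num, Real.log_pow]; norm_num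
  have h5 : 2 * ε * ∑ p ∈ n.primesLE, log p / p ≤ 6 := by
    have : ∑ p ∈ n.primesLE, log p / p ≤ 3 * log n := by linarith
    calc _ ≤ 2 * ε * (3 * log n) := mll this (by positivity)
      _ = 6 := by rw [hε]; field_simp; norm_num
  have h6 : 1 + 1 / ε ≤ 3 * log n := by rw [hε, one_div_one_div]; linarith
  calc _ ≤ (3 * log n) * exp 6 := mul_le_mul (h1.trans h6) (Real.exp_le_exp.2 h5) (Real.exp_pos _).le (by positivity)
    _ = _ := by ring
lemma mertens_lower (n : ℕ) : log (n + 1) ≤ PP n := by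
  have h := EulerProduct.summable_and_hasSum_smoothNumbers_prod_primesBelow_geometric (f := powHom 1) (fun {p} hp => by
    simp only [powHom, MonoidHom.coe_mk, OneHom.coe_mk, Real.rpow_neg_one]
    rw [Real.norm_of_nonneg (by positivity)]
    exact inv_lt_one_of_one_lt₀ (by exact_mod_cast hp.one_lt)) (n + 1)
  have e : PP n = ∏ p ∈ (n + 1).primesBelow, (1 - powHom 1 p)⁻¹ := by
    refine prod_congr rfl fun p _ => ?_
    simp [powHom, Real.rpow_neg_one]
  have hn : ∀ m : (n+1).smoothNumbers, 0 ≤ powHom 1 m := fun m => by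
    simp only [powHom, MonoidHom.coe_mk, OneHom.coe_mk]; positivity
  rw [e, ← h.2.tsum_eq]
  let emb : Fin n → (n+1).smoothNumbers := fun m => ⟨m + 1, (Nat.mem_smoothNumbers).2 ⟨by omega, fun p hp => by
    have := Nat.le_of_mem_primeFactorsList hp; omega⟩⟩
  have hinj : Function.Injective emb := fun a b hab => by
    have := congrArg Subtype.val hab; simp only [emb] at this; ext; omega
  have h2 : ∑ m : Fin n, powHom 1 (emb m) ≤ ∑' m : (n+1).smoothNumbers, powHom 1 m := by
    have := h.2.summable.sum_le_tsum (univ.image emb) (fun m _ => hn m)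
    rwa [sum_image (fun a _ b _ hab => hinj hab)] at this
  refine le_trans ?_ h2
  have h3 := log_add_one_le_harmonic n
  push_cast at h3
  refine h3.trans (le_of_eq ?_)
  rw [harmonic, Rat.cast_sum, Fin.sum_univ_eq_sum_range (fun m => powHom 1 (m + 1)) n]
  refine sum_congr rfl fun i _ => ?_
  simp [powHom, Real.rpow_neg_one]
end
section
abbrev Lc (w R : ℕ) : Finset ℕ := R.primesLE.filter (w < ·)
abbrev qL (w R : ℕ) (l : Lc w R) : ℕ := l
lemma Lc_prime {w R : ℕ} (l : Lc w R) : (qL w R l).Prime := (Nat.mem_primesLE.1 (mem_filter.1 l.2).1).2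
lemma Lc_le {w R : ℕ} (l : Lc w R) : qL w R l ≤ R := (Nat.mem_primesLE.1 (mem_filter.1 l.2).1).1
lemma Lc_gt {w R : ℕ} (l : Lc w R) : w < qL w R l := (mem_filter.1 l.2).2
lemma Lc_two {w R : ℕ} (l : Lc w R) : 2 ≤ qL w R l := (Lc_prime l).two_le
lemma Lc_co {w R : ℕ} (l l' : Lc w R) (h : l ≠ l') : (qL w R l).Coprime (qL w R l') :=
  (Nat.coprime_primes (Lc_prime l) (Lc_prime l')).2 fun e => h (Subtype.ext e)
noncomputable def VV (w R : ℕ) (u : ℝ) : ℝ := ∑ A : Finset (Lc w R), if log (NA (qL w R) A) ≤ u then mm (qL w R) A else 0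
lemma prime_inv_le {p : ℕ} (hp : p.Prime) : 1 / (p:ℝ) ≤ 1 / 2 :=
  one_div_le_one_div_of_le (by norm_num) (by exact_mod_cast hp.two_le)
lemma one_le_prodR {α : Type} (S : Finset α) (f : α → ℝ) (h : ∀ a ∈ S, 1 ≤ f a) : 1 ≤ ∏ a ∈ S, f a := by
  have := prod_le_prod (s := S) (f := fun _ => (1:ℝ)) (g := f) (fun _ _ => zero_le_one) h
  simpa using this
lemma prod_sub_le {α : Type} [DecidableEq α] (S T : Finset α) (hST : S ⊆ T) (f : α → ℝ) (h : ∀ a ∈ T, 1 ≤ f a) : ∏ a ∈ S, f a ≤ ∏ a ∈ T, f a := by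
  rw [← prod_sdiff hST]
  exact le_mul_of_one_le_left (prod_nonneg fun a ha => zero_le_one.trans (h a (hST ha))) (one_le_prodR _ _ fun a ha => h a (mem_sdiff.1 ha).1)
lemma PP_ge_one (n : ℕ) : 1 ≤ PP n := by
  refine one_le_prodR _ _ fun p hp => ?_
  have := prime_inv_le (Nat.mem_primesLE.1 hp).2
  have : 0 ≤ 1 / (p:ℝ) := by positivity
  exact (one_le_inv₀ (by linarith)).2 (by linarith)
lemma NA_ge {w R : ℕ} (A : Finset (Lc w R)) (l) (hl : l ∈ A) : qL w R l ≤ NA (qL w R) A :=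
  Nat.le_of_dvd (NA_pos _ Lc_two A) (dvd_prod_of_mem _ hl)
lemma VV_le (w R : ℕ) (u : ℝ) (hw : 2 ≤ w) (hu : log w ≤ u) : VV w R u ≤ 3 * exp 6 * u / PP w := by
  set n := ⌊exp u⌋₊ with hn
  have hwn : w ≤ n := Nat.le_floor (by
    rw [← Real.exp_log (by positivity : (0:ℝ) < w)]; exact Real.exp_le_exp.2 hu)
  have hnu : log n ≤ u := by
    rw [Real.log_le_iff_le_exp (by have := hw.trans hwn; positivity)]
    exact Nat.floor_le (Real.exp_pos _).le
  have h1 : VV w R u ≤ ∏ l ∈ univ.filter (fun l : Lc w R => (l:ℕ) ≤ n), (1 + tau (qL w R l)) := by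
    rw [prod_one_add]
    unfold VV
    rw [← sum_filter]
    refine sum_le_sum_of_subset_of_nonneg (fun A hA => ?_) fun A _ _ => mm_nonneg _ Lc_two A
    rw [mem_powerset]
    intro l hl
    refine mem_filter.2 ⟨mem_univ _, ?_⟩
    have h2 := (mem_filter.1 hA).2
    rw [Real.log_le_iff_le_exp (by have := NA_pos _ Lc_two A; positivity)] at h2
    exact (NA_ge A l hl).trans (Nat.le_floor h2)
  have h2 : ∏ l ∈ univ.filter (fun l : Lc w R => (l:ℕ) ≤ n), (1 + tau (qL w R l)) ≤ ∏ p ∈ n.primesLE.filter (w < ·), (1 - 1 / (p:ℝ))⁻¹ := by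
    rw [prod_congr rfl (g := fun l : Lc w R => (1 - 1 / ((l:ℕ):ℝ))⁻¹) (fun l _ => by
      have := Lc_two l
      have h : (2:ℝ) ≤ (l:ℕ) := by exact_mod_cast this
      unfold tau
      have : ((l:ℕ):ℝ) - 1 ≠ 0 := by linarith
      have : ((l:ℕ):ℝ) ≠ 0 := by linarith
      field_simp; ring)]
    rw [← prod_image (f := fun p : ℕ => (1 - 1 / (p:ℝ))⁻¹) (g := fun l : Lc w R => (l:ℕ)) (fun x _ y _ h => Subtype.ext h)]
    refine prod_sub_le _ _ ?_ _ ?_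
    · intro p hp
      obtain ⟨l, hl, rfl⟩ := mem_image.1 hp
      exact mem_filter.2 ⟨Nat.mem_primesLE.2 ⟨(mem_filter.1 hl).2, Lc_prime l⟩, Lc_gt l⟩
    · intro p hp
      have := prime_inv_le (Nat.mem_primesLE.1 (mem_filter.1 hp).1).2
      have : 0 ≤ 1 / (p:ℝ) := by positivity
      exact (one_le_inv₀ (by linarith)).2 (by linarith)
  have h3 : (∏ p ∈ n.primesLE.filter (w < ·), (1 - 1 / (p:ℝ))⁻¹) * PP w = PP n := by
    unfold PP
    rw [← prod_filter_mul_prod_filter_not n.primesLE (w < ·)]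
    congr 1
    refine prod_congr (ext fun p => ?_) fun _ _ => rfl
    simp only [mem_filter, Nat.mem_primesLE, not_lt]; constructor <;> intro h
    · exact ⟨⟨h.1.trans hwn, h.2⟩, h.1⟩
    · exact ⟨h.2, h.1.2⟩
  have hP := PP_ge_one w
  rw [le_div_iff₀ (by linarith)]
  calc _ ≤ _ := mlr (h1.trans h2) (by linarith)
    _ ≤ 3 * exp 6 * log n := h3 ▸ mertens_upper n (hw.trans hwn)
    _ ≤ _ := mll hnu (by positivity)
lemma VV_ge (w R : ℕ) (u : ℝ) (hR : 1 ≤ R) (hu : u ≤ log R) : u / (2 * PP w) ≤ VV w R u := by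
  set n := ⌊exp u⌋₊ with hn
  have hnR : n ≤ R := by
    have : exp u ≤ R := by rw [← Real.exp_log (by positivity : (0:ℝ) < R)]; exact Real.exp_le_exp.2 hu
    exact Nat.cast_le.1 ((Nat.floor_le (Real.exp_pos _).le).trans this)
  choose c b hcb hsq using Nat.sq_mul_squarefree
  let Bs : ℕ → Finset ℕ := fun m => (c m).primeFactors.filter (· ≤ w)
  let As : ℕ → Finset (Lc w R) := fun m => univ.filter fun l : Lc w R => (l:ℕ) ∣ c m
  have hm : ∀ m ∈ Icc 1 n, m = b m ^ 2 * ((∏ p ∈ Bs m, p) * NA (qL w R) (As m)) := fun m hm => by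
    have hm1 := mem_Icc.1 hm
    have hc0 : c m ≠ 0 := (hsq m).ne_zero
    have hcm : c m ≤ m := Nat.le_of_dvd hm1.1 ⟨b m ^ 2, by rw [mul_comm]; exact (hcb m).symm⟩
    have e1 : NA (qL w R) (As m) = ∏ p ∈ (c m).primeFactors.filter (fun p => ¬ p ≤ w), p := by
      unfold NA
      rw [← prod_image (f := fun p : ℕ => p) (g := fun l : Lc w R => (l:ℕ)) (fun x _ y _ h => Subtype.ext h)]
      refine prod_congr (ext fun p => ?_) fun _ _ => rfl
      simp only [mem_image, mem_filter, Nat.mem_primeFactors, As, mem_univ, true_and, not_le]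
      constructor
      · rintro ⟨l, hl, rfl⟩; exact ⟨⟨Lc_prime l, hl, hc0⟩, Lc_gt l⟩
      · rintro ⟨⟨h1, h2, _⟩, h3⟩
        exact ⟨⟨p, mem_filter.2 ⟨Nat.mem_primesLE.2 ⟨(Nat.le_of_dvd (Nat.pos_of_ne_zero hc0) h2).trans (hcm.trans (hm1.2.trans hnR)), h1⟩, h3⟩⟩, h2, rfl⟩
    rw [e1, prod_filter_mul_prod_filter_not, Nat.prod_primeFactors_of_squarefree (hsq m), hcb]
  let F : ℕ × Finset ℕ × Finset (Lc w R) → ℝ := fun x => ((x.1:ℝ) ^ 2)⁻¹ * ((∏ p ∈ x.2.1, 1 / (p:ℝ)) * mm (qL w R) x.2.2)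
  have hF0 : ∀ x, 0 ≤ F x := fun x => mul_nonneg (by positivity) (mul_nonneg (prod_nonneg fun p _ => by positivity) (mm_nonneg _ Lc_two _))
  let Φ : ℕ → ℕ × Finset ℕ × Finset (Lc w R) := fun m => (b m, Bs m, As m)
  have hmF : ∀ m ∈ Icc 1 n, 1 / (m:ℝ) ≤ F (Φ m) := fun m hm' => by
    have h := hm m hm'
    have e : 1 / (m:ℝ) = ((b m:ℝ) ^ 2)⁻¹ * ((∏ p ∈ Bs m, 1 / (p:ℝ)) * ∏ l ∈ As m, 1 / ((qL w R l : ℕ) : ℝ)) := by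
      conv_lhs => rw [h]
      unfold NA; push_cast
      simp only [one_div, prod_inv_distrib, mul_inv]
    rw [e]
    refine mll (mll ?_ (prod_nonneg fun p _ => by positivity)) (by positivity)
    refine prod_le_prod (fun l _ => by positivity) fun l _ => ?_
    have h : (2:ℝ) ≤ qL w R l := by exact_mod_cast Lc_two l
    unfold tau
    exact one_div_le_one_div_of_le (by linarith) (by linarith)
  have hinj : Set.InjOn Φ (Icc 1 n : Finset ℕ) := fun m hm1 m' hm2 h => by
    simp only [Φ, Prod.mk.injEq] at h
    rw [hm m hm1, hm m' hm2, h.1, h.2.1, h.2.2]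
  have hbig : ∑ m ∈ Icc 1 n, F (Φ m) ≤ ∑ x ∈ (Icc 1 n) ×ˢ ((w.primesLE).powerset ×ˢ univ.filter (fun A => log (NA (qL w R) A) ≤ u)), F x := by
    rw [← sum_image (f := F) hinj]
    refine sum_le_sum_of_subset_of_nonneg (fun x hx => ?_) fun x _ _ => hF0 x
    obtain ⟨m, hm1, rfl⟩ := mem_image.1 hx
    have h := hm m hm1
    have hm2 := mem_Icc.1 hm1
    simp only [Φ, mem_product, mem_Icc, mem_powerset, mem_filter, mem_univ, true_and]
    have hb0 : b m ≠ 0 := fun h0 => by rw [h0] at h; simp at h; omega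
    refine ⟨⟨by omega, ?_⟩, fun p hp => ?_, ?_⟩
    · have : b m ∣ m := ⟨b m * c m, by rw [← mul_assoc, ← sq]; exact (hcb m).symm⟩
      exact (Nat.le_of_dvd hm2.1 this).trans hm2.2
    · simp only [Bs, mem_filter, Nat.mem_primeFactors] at hp
      exact Nat.mem_primesLE.2 ⟨hp.2, hp.1.1⟩
    · have hd : NA (qL w R) (As m) ∣ m := ⟨b m ^ 2 * ∏ p ∈ Bs m, p, h.trans (by ring)⟩
      have h1 := (Nat.le_of_dvd hm2.1 hd).trans hm2.2
      rw [Real.log_le_iff_le_exp (by have := NA_pos _ Lc_two (As m); positivity)]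
      exact (Nat.cast_le.2 h1).trans (Nat.floor_le (Real.exp_pos _).le)
  have hsplit : ∑ x ∈ (Icc 1 n) ×ˢ ((w.primesLE).powerset ×ˢ univ.filter (fun A => log (NA (qL w R) A) ≤ u)), F x =
      (∑ b ∈ Icc 1 n, ((b:ℝ) ^ 2)⁻¹) * ((∏ p ∈ w.primesLE, (1 + 1 / (p:ℝ))) * VV w R u) := by
    rw [prod_one_add, VV, ← sum_filter, sum_product, sum_mul]
    refine sum_congr rfl fun b _ => ?_
    rw [sum_product, sum_mul, mul_sum]
    refine sum_congr rfl fun B _ => ?_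
    rw [mul_sum, mul_sum]
  have hV0 : 0 ≤ VV w R u := sum_nonneg fun A _ => by split_ifs <;> [exact mm_nonneg _ Lc_two A; exact le_rfl]
  have h2 : ∑ b ∈ Icc 1 n, ((b:ℝ) ^ 2)⁻¹ ≤ 2 := by
    have := sum_Ioo_inv_sq_le (α := ℝ) 0 (n + 1)
    have e : Icc 1 n = Ioo 0 (n + 1) := by ext; simp; omega
    rw [e]; simpa using this
  have h3 : ∏ p ∈ w.primesLE, (1 + 1 / (p:ℝ)) ≤ PP w := by
    refine prod_le_prod (fun p _ => by positivity) fun p hp => ?_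
    have := prime_inv_le (Nat.mem_primesLE.1 hp).2
    rw [le_inv_comm₀ (by positivity) (by linarith), inv_eq_one_div, le_div_iff₀ (by positivity)]
    nlinarith [sq_nonneg (1 / (p:ℝ))]
  have hP := PP_ge_one w
  have h4 : u ≤ ∑ m ∈ Icc 1 n, 1 / (m:ℝ) := by
    have h := log_add_one_le_harmonic n
    rw [harmonic_eq_sum_Icc] at h
    push_cast at h
    simp only [one_div]
    refine le_trans ?_ h
    rw [Real.le_log_iff_exp_le (by positivity)]
    exact (Nat.lt_floor_add_one _).le
  rw [div_le_iff₀ (by linarith)]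
  calc u ≤ _ := h4
    _ ≤ _ := sum_le_sum hmF
    _ ≤ _ := hbig
    _ = _ := hsplit
    _ ≤ 2 * (PP w * VV w R u) := mul_le_mul h2 (mlr h3 hV0) (mul_nonneg (prod_nonneg fun p _ => by positivity) hV0) (by norm_num)
    _ = _ := by ring
end
section
noncomputable def thr {w R : ℕ} (lam : ℝ) (m : ℕ) (A : Finset (Lc w R)) : ℝ := if log (NA (qL w R) A) ≤ lam * 2 ^ m then 1 else 0
noncomputable def gW {w R : ℕ} (lam : ℝ) (M : ℕ) (A : Finset (Lc w R)) : ℝ := ∑ m ∈ range (M + 1), (1 / 2) ^ m * thr lam m A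
noncomputable abbrev CM : ℝ := 3 * exp 6
lemma thr_nonneg {w R : ℕ} (lam : ℝ) (m : ℕ) (A : Finset (Lc w R)) : 0 ≤ thr lam m A := by unfold thr; split_ifs <;> norm_num
lemma thr_le {w R : ℕ} (lam : ℝ) (m : ℕ) (A : Finset (Lc w R)) : thr lam m A ≤ 1 := by unfold thr; split_ifs <;> norm_num
lemma gW_nonneg {w R : ℕ} (lam : ℝ) (M : ℕ) (A : Finset (Lc w R)) : 0 ≤ gW lam M A :=
  sum_nonneg fun m _ => mul_nonneg (by positivity) (thr_nonneg _ _ _)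
lemma geo_le (N : ℕ) (x : ℕ → ℝ) (hx : ∀ m, x m ≤ 1) : ∑ m ∈ range N, (1 / 2 : ℝ) ^ m * x m ≤ 2 := by
  calc _ ≤ ∑ m ∈ range N, (1 / 2 : ℝ) ^ m := sum_le_sum fun m _ => mul_le_of_le_one_right (by positivity) (hx m)
    _ ≤ 2 := by
      rw [geom_sum_eq (by norm_num)]
      have : (0:ℝ) < (1/2)^N := by positivity
      rw [div_le_iff_of_neg (by norm_num)]; linarith
lemma gW_le {w R : ℕ} (lam : ℝ) (M : ℕ) (A : Finset (Lc w R)) : gW lam M A ≤ 2 := geo_le _ _ fun m => thr_le _ _ _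
lemma gW_anti {w R : ℕ} (lam : ℝ) (M : ℕ) (A B : Finset (Lc w R)) (h : A ⊆ B) : gW lam M B ≤ gW lam M A := by
  refine sum_le_sum fun m _ => mll ?_ (by positivity)
  have : log (NA (qL w R) A) ≤ log (NA (qL w R) B) := Real.log_le_log (by have := NA_pos _ Lc_two A; positivity)
    (by exact_mod_cast Nat.le_of_dvd (NA_pos _ Lc_two B) (prod_dvd_prod_of_subset _ _ _ h))
  unfold thr; split_ifs <;> first | linarith | norm_num
lemma gW_supp {w R : ℕ} (lam r : ℝ) (hr : 0 < r) (hlam : 0 ≤ lam) (M : ℕ) (h : lam * 2 ^ M ≤ log r) (A : Finset (Lc w R)) (hA : gW lam M A ≠ 0) :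
    (NA (qL w R) A : ℝ) ≤ r := by
  by_contra hn
  push Not at hn
  refine hA (sum_eq_zero fun m hm => ?_)
  have := Real.log_lt_log hr hn
  have h2 : lam * 2 ^ m ≤ lam * 2 ^ M := mll (pow_le_pow_right₀ (by norm_num) (by have := mem_range.1 hm; omega)) hlam
  rw [thr, if_neg (by linarith), mul_zero]
lemma sq_geo (N : ℕ) (x : ℕ → ℝ) (hx : ∀ m, x m = 0 ∨ x m = 1) :
    (∑ m ∈ range N, (1 / 2 : ℝ) ^ m * x m) ^ 2 ≤ 4 * ∑ m ∈ range N, (1 / 4 : ℝ) ^ m * x m := by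
  induction N generalizing x with
  | zero => simp
  | succ N ih =>
    have h0 : ∀ m, 0 ≤ x m := fun m => by rcases hx m with h | h <;> rw [h]; norm_num
    have h1 : ∀ m, x m ≤ 1 := fun m => by rcases hx m with h | h <;> rw [h]; norm_num
    rcases hx 0 with h | h
    · rw [sum_range_succ', sum_range_succ' (fun m => (1 / 4 : ℝ) ^ m * x m), h]
      have ih := ih (fun m => x (m + 1)) fun m => hx _
      have e1 : ∑ m ∈ range N, (1 / 2 : ℝ) ^ (m + 1) * x (m + 1) = 1 / 2 * ∑ m ∈ range N, (1 / 2 : ℝ) ^ m * x (m + 1) := by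
        rw [mul_sum]; exact sum_congr rfl fun m _ => by ring
      have e2 : ∑ m ∈ range N, (1 / 4 : ℝ) ^ (m + 1) * x (m + 1) = 1 / 4 * ∑ m ∈ range N, (1 / 4 : ℝ) ^ m * x (m + 1) := by
        rw [mul_sum]; exact sum_congr rfl fun m _ => by ring
      rw [e1, e2]; simp only [mul_zero, add_zero]; nlinarith
    · have a := geo_le (N + 1) x h1
      have b : 0 ≤ ∑ m ∈ range (N + 1), (1 / 2 : ℝ) ^ m * x m := sum_nonneg fun m _ => mul_nonneg (by positivity) (h0 m)
      have c : 1 ≤ ∑ m ∈ range (N + 1), (1 / 4 : ℝ) ^ m * x m := by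
        rw [sum_range_succ', h]
        have : 0 ≤ ∑ m ∈ range N, (1 / 4 : ℝ) ^ (m + 1) * x (m + 1) := sum_nonneg fun m _ => mul_nonneg (by positivity) (h0 _)
        simp only [pow_zero, mul_one]; linarith
      nlinarith
lemma gW_sq {w R : ℕ} (lam : ℝ) (M : ℕ) (A : Finset (Lc w R)) : gW lam M A ^ 2 ≤ 4 * ∑ m ∈ range (M + 1), (1 / 4 : ℝ) ^ m * thr lam m A :=
  sq_geo _ _ fun m => by unfold thr; split_ifs <;> simp
lemma VV_thr {w R : ℕ} (lam : ℝ) (m : ℕ) : VV w R (lam * 2 ^ m) = ∑ A : Finset (Lc w R), thr lam m A * mm (qL w R) A := by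
  unfold VV thr; exact sum_congr rfl fun A _ => by split_ifs <;> simp
lemma G1_ge (w R : ℕ) (lam : ℝ) (M : ℕ) (hR : 1 ≤ R) (hlam : 0 ≤ lam) (h : lam * 2 ^ M ≤ log R) :
    lam * (M + 1) / (2 * PP w) ≤ G1 (qL w R) (gW lam M) := by
  have e : G1 (qL w R) (gW lam M) = ∑ m ∈ range (M + 1), (1 / 2 : ℝ) ^ m * VV w R (lam * 2 ^ m) := by
    unfold G1 gW
    simp only [VV_thr, sum_mul, mul_sum]
    rw [Finset.sum_comm]
    exact sum_congr rfl fun m _ => sum_congr rfl fun A _ => by ring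
  rw [e]
  calc _ = ∑ m ∈ range (M + 1), (1 / 2 : ℝ) ^ m * (lam * 2 ^ m / (2 * PP w)) := by
        rw [sum_congr rfl (g := fun _ => lam / (2 * PP w)) (fun m _ => by
          rw [show (1 / 2 : ℝ) ^ m * (lam * 2 ^ m / (2 * PP w)) = ((1 / 2 : ℝ) ^ m * 2 ^ m) * (lam / (2 * PP w)) by ring, ← mul_pow]; norm_num)]
        simp; ring
    _ ≤ _ := sum_le_sum fun m hm => mll (VV_ge w R _ hR (le_trans
      (mll (pow_le_pow_right₀ (by norm_num) (by have := mem_range.1 hm; omega)) hlam) h)) (by positivity)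
lemma G2_ge (w R : ℕ) (lam : ℝ) (M : ℕ) (hR : 1 ≤ R) (hlam : 0 ≤ lam) (h : lam * 2 ^ M ≤ log R) :
    lam / (2 * PP w) ≤ G2 (qL w R) (gW lam M) := by
  have h0 : lam ≤ lam * 2 ^ M := le_mul_of_one_le_right hlam (one_le_pow₀ (by norm_num))
  refine (VV_ge w R lam hR (h0.trans h)).trans (sum_le_sum fun A _ => ?_)
  have hm := mm_nonneg _ Lc_two A
  split_ifs with hA
  · refine le_mul_of_one_le_left hm (one_le_pow₀ ?_)
    unfold gW
    rw [sum_range_succ']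
    have : 0 ≤ ∑ m ∈ range M, (1 / 2 : ℝ) ^ (m + 1) * thr lam (m + 1) A := sum_nonneg fun m _ => mul_nonneg (by positivity) (thr_nonneg _ _ _)
    have h1 : thr lam 0 A = 1 := by simp [thr, hA]
    rw [h1]; simp only [pow_zero, mul_one]; linarith
  · positivity
lemma G2_le (w R : ℕ) (lam : ℝ) (M : ℕ) (hw : 2 ≤ w) (h : log w ≤ lam) :
    G2 (qL w R) (gW lam M) ≤ 8 * CM * lam / PP w := by
  have hw0 : 0 ≤ log w := Real.log_natCast_nonneg _
  have hP := PP_ge_one w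
  calc G2 (qL w R) (gW lam M) ≤ ∑ A, (4 * ∑ m ∈ range (M + 1), (1 / 4 : ℝ) ^ m * thr lam m A) * mm (qL w R) A :=
        sum_le_sum fun A _ => mlr (gW_sq _ _ _) (mm_nonneg _ Lc_two A)
    _ = 4 * ∑ m ∈ range (M + 1), (1 / 4 : ℝ) ^ m * VV w R (lam * 2 ^ m) := by
        simp only [VV_thr, sum_mul, mul_sum]
        rw [Finset.sum_comm]
        exact sum_congr rfl fun m _ => sum_congr rfl fun A _ => by ring
    _ ≤ 4 * ∑ m ∈ range (M + 1), (1 / 4 : ℝ) ^ m * (CM * (lam * 2 ^ m) / PP w) := by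
        refine mll (sum_le_sum fun m _ => mll (VV_le w R _ hw ?_) (by positivity)) (by norm_num)
        exact h.trans (le_mul_of_one_le_right (by linarith) (one_le_pow₀ (by norm_num)))
    _ = 4 * (CM * lam / PP w) * ∑ m ∈ range (M + 1), (1 / 2 : ℝ) ^ m * 1 := by
        rw [mul_assoc, mul_sum (a := CM * lam / PP w)]
        congr 1
        refine sum_congr rfl fun m _ => ?_
        rw [show (1 / 4 : ℝ) ^ m * (CM * (lam * 2 ^ m) / PP w) = (CM * lam / PP w) * ((1 / 4 : ℝ) ^ m * 2 ^ m) by ring, ← mul_pow]; norm_num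
    _ ≤ 4 * (CM * lam / PP w) * 2 := mll (geo_le _ (fun _ => 1) fun _ => le_rfl)
        (mul_nonneg (by norm_num) (div_nonneg (mul_nonneg (by positivity) (by linarith)) (by linarith)))
    _ = _ := by ring
lemma logmom (w R : ℕ) (lam : ℝ) (M : ℕ) (hw : 2 ≤ w) (h : log w ≤ lam) :
    ∑ A, log (NA (qL w R) A) * (gW lam M A ^ 2 * mm (qL w R) A) ≤ 4 * CM * lam ^ 2 * (M + 1) / PP w := by
  have hw0 : 0 ≤ log w := Real.log_natCast_nonneg _
  have hP := PP_ge_one w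
  calc _ ≤ ∑ A, (4 * ∑ m ∈ range (M + 1), (1 / 4 : ℝ) ^ m * (lam * 2 ^ m * thr lam m A)) * mm (qL w R) A :=
        sum_le_sum fun A _ => by
          rw [← mul_assoc]
          refine mlr ?_ (mm_nonneg _ Lc_two A)
          refine (mll (gW_sq _ _ _) (Real.log_natCast_nonneg _)).trans ?_
          rw [mul_left_comm, mul_sum]
          refine mll (sum_le_sum fun m _ => ?_) (by norm_num)
          rw [mul_left_comm]
          refine mll ?_ (by positivity)
          unfold thr; split_ifs with hA <;> simp [hA]
    _ = 4 * ∑ m ∈ range (M + 1), (1 / 4 : ℝ) ^ m * (lam * 2 ^ m * VV w R (lam * 2 ^ m)) := by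
        simp only [VV_thr, sum_mul, mul_sum]
        rw [Finset.sum_comm]
        exact sum_congr rfl fun m _ => sum_congr rfl fun A _ => by ring
    _ ≤ 4 * ∑ m ∈ range (M + 1), (1 / 4 : ℝ) ^ m * (lam * 2 ^ m * (CM * (lam * 2 ^ m) / PP w)) := by
        refine mll (sum_le_sum fun m _ => mll (mll (VV_le w R _ hw ?_) ?_) (by positivity)) (by norm_num)
        · exact h.trans (le_mul_of_one_le_right (by linarith) (one_le_pow₀ (by norm_num)))
        · exact mul_nonneg (by linarith) (by positivity)
    _ = _ := by
        rw [sum_congr rfl (g := fun _ => CM * lam ^ 2 / PP w) (fun m _ => by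
          rw [show (1 / 4 : ℝ) ^ m * (lam * 2 ^ m * (CM * (lam * 2 ^ m) / PP w)) = ((1 / 4 : ℝ) ^ m * 2 ^ m * 2 ^ m) * (CM * lam ^ 2 / PP w) by ring, ← mul_pow, ← mul_pow]; norm_num)]
        simp; ring
end
section F1
lemma per_zero (f : ℕ → ℂ) (m : ℕ) (hm : 0 < m) (hper : Function.Periodic f m)
    (hB : ∀ n, ‖f n‖ ≤ 1) (h0 : ∑ n ∈ range m, f n = 0) (N : ℕ) :
    ‖∑ n ∈ range N, f n‖ ≤ m := by
  induction N using Nat.strong_induction_on with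
  | _ N ih =>
  rcases lt_or_ge N m with h | h
  · refine (norm_sum_le _ _).trans ((sum_le_sum fun n _ => hB n).trans ?_)
    simp; exact h.le
  · obtain ⟨K, rfl⟩ := Nat.exists_eq_add_of_le h
    rw [sum_range_add, h0, zero_add]
    convert ih K (by omega) using 3
    rw [add_comm, hper]
lemma sum_zmod (n : ℕ) [NeZero n] (F : ZMod n → ℂ) : ∑ a ∈ range n, F (a : ZMod n) = ∑ a, F a := by
  refine sum_bij' (fun a _ => (a : ZMod n)) (fun a _ => a.val) (by simp) (fun a _ => by simp [ZMod.val_lt]) ?_ (by simp) (by simp)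
  intro a ha
  exact ZMod.val_cast_of_lt (by simpa using ha)
open Classical in
noncomputable def ch0 {n : ℕ} (χ : DirichletCharacter ℂ n) (a : ℕ) : ℂ := if χ = 1 then 1 else χ (a : ZMod n)
lemma ch0_norm {n : ℕ} (χ : DirichletCharacter ℂ n) (a : ℕ) : ‖ch0 χ a‖ ≤ 1 := by
  unfold ch0; split_ifs
  · simp
  · exact χ.norm_le_one _
lemma ch0_per {n : ℕ} (χ : DirichletCharacter ℂ n) : Function.Periodic (ch0 χ) n := by
  intro a; simp [ch0]
lemma cop_iff {l : ℕ} (hl : l.Prime) (n : ℕ) : IsUnit (n : ZMod l) ↔ ¬ l ∣ n := by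
  rw [ZMod.isUnit_iff_coprime, Nat.coprime_comm, hl.coprime_iff_not_dvd]
lemma ch0_unit {l : ℕ} (hl : l.Prime) (χ : DirichletCharacter ℂ l) (a : ℕ) (h : ¬ l ∣ a) : ch0 χ a = χ (a : ZMod l) := by
  unfold ch0; split_ifs with h1
  · rw [h1, MulChar.one_apply ((cop_iff hl a).2 h)]
  · rfl
noncomputable def tA (l : ℕ) (a : Option (Fin 1)) : ℝ := if a = none then 1 else tau l
lemma ph_unit {l : ℕ} (a : Option (Fin 1)) (n : ℕ) (h : ¬ l ∣ n) : ph l (fun _ => 0) a n = tA l a := by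
  cases a with
  | none => simp [ph, tA]
  | some j => simp [ph, tA, ← Nat.dvd_iff_mod_eq_zero, h]
lemma loc_zero {l : ℕ} (hl : l.Prime) (χ χ' : DirichletCharacter ℂ l) (h : χ ≠ χ') (a a' : Option (Fin 1)) :
    ∑ n ∈ range l, ((ph l (fun _ => 0) a n * ph l (fun _ => 0) a' n : ℝ) : ℂ) * (ch0 χ n * star (ch0 χ' n)) = 0 := by
  haveI : NeZero l := ⟨hl.ne_zero⟩
  have e : ∀ n : ℕ, ((ph l (fun _ => 0) a n * ph l (fun _ => 0) a' n : ℝ) : ℂ) * (ch0 χ n * star (ch0 χ' n)) =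
      ((tA l a * tA l a' : ℝ) : ℂ) * (χ * χ'⁻¹) (n : ZMod l) := by
    intro n
    by_cases hn : l ∣ n
    · have hu : ¬ IsUnit (n : ZMod l) := by rw [cop_iff hl]; simpa using hn
      rw [MulChar.map_nonunit _ hu]
      have : ch0 χ n * star (ch0 χ' n) = 0 := by
        by_cases h1 : χ = 1
        · have h2 : χ' ≠ 1 := by rintro rfl; exact h h1
          simp [ch0, h2, MulChar.map_nonunit _ hu]
        · simp [ch0, h1, MulChar.map_nonunit _ hu]
      rw [this]; simp
    · rw [ph_unit _ _ hn, ph_unit _ _ hn, ch0_unit hl _ _ hn, ch0_unit hl _ _ hn, MulChar.star_apply', MulChar.mul_apply]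
  rw [sum_congr rfl fun n _ => e n, ← mul_sum, sum_zmod l (fun a => (χ * χ'⁻¹) a), MulChar.sum_eq_zero_of_ne_one, mul_zero]
  intro h1
  exact h (mul_inv_eq_one.1 h1)
variable {ι : Type} [Fintype ι] [DecidableEq ι]
abbrev Tp (q : ι → ℕ) := (l : ι) → DirichletCharacter ℂ (q l)
noncomputable def chi {q : ι → ℕ} (χ : Tp q) (n : ℕ) : ℂ := ∏ l, ch0 (χ l) n
open Classical in
noncomputable def cndt {q : ι → ℕ} (χ : Tp q) : ℕ := ∏ l, if χ l = 1 then 1 else q l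
lemma chi_norm {q : ι → ℕ} (χ : Tp q) (n : ℕ) : ‖chi χ n‖ ≤ 1 := by
  rw [chi, norm_prod]; exact prod_le_one (fun _ _ => norm_nonneg _) fun _ _ => ch0_norm _ _
open Classical in
lemma pair_zero {q : ι → ℕ} (hp : ∀ l, (q l).Prime) (hco : HC q) (χ χ' : Tp q) (h : χ ≠ χ')
    (r r' : ι → Option (Fin 1)) (N : ℕ) :
    ‖∑ n ∈ range N, ∏ l, (((ph (q l) (fun _ => 0) (r l) n * ph (q l) (fun _ => 0) (r' l) n : ℝ) : ℂ) * (ch0 (χ l) n * star (ch0 (χ' l) n)))‖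
      ≤ NN q r * NN q r' * (cndt χ * cndt χ') := by
  set f : ι → ℕ → ℂ := fun l n => ((ph (q l) (fun _ => 0) (r l) n * ph (q l) (fun _ => 0) (r' l) n : ℝ) : ℂ) * (ch0 (χ l) n * star (ch0 (χ' l) n)) with hf
  set T : Finset ι := univ.filter fun l => ¬ (r l = none ∧ r' l = none ∧ χ l = 1 ∧ χ' l = 1) with hT
  have hfp : ∀ l, Function.Periodic (f l) (q l) := by
    intro l n
    simp only [hf, ph_periodic (q l) (fun _ => 0) (r l) n, ph_periodic (q l) (fun _ => 0) (r' l) n, ch0_per (χ l) n, ch0_per (χ' l) n]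
  have hf1 : ∀ l n, ‖f l n‖ ≤ 1 := by
    intro l n
    simp only [hf, norm_mul, norm_star, Complex.norm_real, Real.norm_eq_abs, abs_mul]
    exact mul_le_one₀ (mul_le_one₀ (ph_abs (hp l).two_le _ _ _) (abs_nonneg _) (ph_abs (hp l).two_le _ _ _)) (by positivity)
      (mul_le_one₀ (ch0_norm _ _) (norm_nonneg _) (ch0_norm _ _))
  have hprod : ∀ n, ∏ l, f l n = ∏ l ∈ T, f l n := by
    intro n
    refine (prod_subset (subset_univ T) fun l _ hl => ?_).symm
    simp only [hT, mem_filter, mem_univ, true_and, not_not] at hl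
    obtain ⟨h1, h2, h3, h4⟩ := hl
    simp [hf, h1, h2, h3, h4, ph, ch0]
  rw [sum_congr rfl fun n _ => hprod n]
  obtain ⟨l0, hl0⟩ := Function.ne_iff.1 h
  have hl0T : l0 ∈ T := by
    simp only [hT, mem_filter, mem_univ, true_and]
    rintro ⟨_, _, h3, h4⟩; exact hl0 (h3.trans h4.symm)
  refine (per_zero _ (∏ l ∈ T, q l) (prod_pos fun l _ => (hp l).pos) (periodic_prod T q f fun l _ => hfp l) ?_ ?_ N).trans ?_
  · intro n; rw [norm_prod]; exact prod_le_one (fun _ _ => norm_nonneg _) fun _ _ => hf1 _ _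
  · rw [crt_prod T q (fun l => (hp l).pos) hco f hfp]
    exact prod_eq_zero hl0T (loc_zero (hp l0) _ _ hl0 _ _)
  · have : ∏ l ∈ T, q l ≤ NN q r * NN q r' * (cndt χ * cndt χ') := by
      unfold NN cndt
      rw [← pmd, ← pmd, ← pmd, hT, prod_filter]
      refine prod_le_prod' fun l _ => ?_
      have hq := (hp l).one_le
      split_ifs <;> first | nlinarith [Nat.mul_le_mul hq hq, Nat.mul_le_mul (Nat.mul_le_mul hq hq) (Nat.mul_le_mul hq hq), Nat.mul_le_mul (Nat.mul_le_mul hq hq) hq] | (simp_all)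
    exact_mod_cast this
end F1
section F2
variable {ι : Type} [Fintype ι] [DecidableEq ι]
noncomputable def g1 (q : ι → ℕ) (Y : (ι → Option (Fin 1)) → ℝ) (n : ℕ) : ℝ := gg q (fun _ _ => 0) Y n
noncomputable def V0 (q : ι → ℕ) (Y : (ι → Option (Fin 1)) → ℝ) : ℝ := ∑ r, Y r * ∏ l, tA (q l) (r l)
lemma g1_unit (q : ι → ℕ) (Y : (ι → Option (Fin 1)) → ℝ) (n : ℕ) (h : ∀ l, ¬ q l ∣ n) : g1 q Y n = V0 q Y := by
  unfold g1 V0 gg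
  refine sum_congr rfl fun r _ => ?_
  congr 1
  exact prod_congr rfl fun l _ => ph_unit _ _ (h l)
lemma ls_off {q : ι → ℕ} (hp : ∀ l, (q l).Prime) (hco : HC q) (χ χ' : Tp q) (h : χ ≠ χ')
    (Y : (ι → Option (Fin 1)) → ℝ) (hY : ∀ r, 0 ≤ Y r) (N : ℕ) :
    ‖∑ n ∈ range N, ((g1 q Y n ^ 2 : ℝ) : ℂ) * (chi χ n * star (chi χ' n))‖ ≤ (∑ r, Y r * NN q r) ^ 2 * (cndt χ * cndt χ') := by
  have e : ∀ n, ((g1 q Y n ^ 2 : ℝ) : ℂ) * (chi χ n * star (chi χ' n)) = ∑ r, ∑ r', ((Y r * Y r' : ℝ) : ℂ) *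
      ∏ l, (((ph (q l) (fun _ => 0) (r l) n * ph (q l) (fun _ => 0) (r' l) n : ℝ) : ℂ) * (ch0 (χ l) n * star (ch0 (χ' l) n))) := by
    intro n
    have : ∀ r r' : ι → Option (Fin 1), ((Y r * Y r' : ℝ) : ℂ) *
      ∏ l, (((ph (q l) (fun _ => 0) (r l) n * ph (q l) (fun _ => 0) (r' l) n : ℝ) : ℂ) * (ch0 (χ l) n * star (ch0 (χ' l) n)))
      = (((Y r * ∏ l, ph (q l) (fun _ => 0) (r l) n) * (Y r' * ∏ l, ph (q l) (fun _ => 0) (r' l) n) : ℝ) : ℂ) * (chi χ n * star (chi χ' n)) := by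
      intro r r'
      rw [pmd, ← Complex.ofReal_prod, pmd, pmd, chi, chi, star_prod]
      push_cast; ring
    simp only [this]
    simp only [← sum_mul, ← Complex.ofReal_sum, ← sum_mul_sum]
    simp only [g1, gg, pow_two]
  rw [sum_congr rfl fun n _ => e n, Finset.sum_comm, pow_two, sum_mul_sum, sum_mul]
  refine (norm_sum_le _ _).trans (sum_le_sum fun r _ => ?_)
  rw [Finset.sum_comm, sum_mul]
  refine (norm_sum_le _ _).trans (sum_le_sum fun r' _ => ?_)
  rw [← mul_sum, norm_mul, Complex.norm_real, Real.norm_of_nonneg (mul_nonneg (hY r) (hY r'))]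
  calc _ ≤ Y r * Y r' * (NN q r * NN q r' * (cndt χ * cndt χ') : ℝ) :=
        mll (pair_zero hp hco χ χ' h r r' N) (mul_nonneg (hY r) (hY r'))
    _ = _ := by ring
lemma ls {q : ι → ℕ} (hp : ∀ l, (q l).Prime) (hco : HC q)
    (Y : (ι → Option (Fin 1)) → ℝ) (hY : ∀ r, 0 ≤ Y r) (N : ℕ) (X : Finset (Tp q)) (Q : ℝ) (hX : ∀ χ ∈ X, (cndt χ : ℝ) ≤ Q)
    (S : Finset ℕ) (hS : ∀ n ∈ S, n < N ∧ ∀ l, ¬ q l ∣ n) (b : Tp q → ℂ) :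
    V0 q Y ^ 2 * ∑ n ∈ S, ‖∑ χ ∈ X, b χ * chi χ n‖ ^ 2 ≤
      (∑ n ∈ range N, g1 q Y n ^ 2 + #X * ((∑ r, Y r * NN q r) ^ 2 * Q ^ 2)) * ∑ χ ∈ X, ‖b χ‖ ^ 2 := by
  classical
  set D := ∑ n ∈ range N, g1 q Y n ^ 2 with hD
  set E := (∑ r, Y r * NN q r) ^ 2 * Q ^ 2 with hE
  have hE0 : 0 ≤ E := by positivity
  have h1 : V0 q Y ^ 2 * ∑ n ∈ S, ‖∑ χ ∈ X, b χ * chi χ n‖ ^ 2 ≤ ∑ n ∈ range N, g1 q Y n ^ 2 * ‖∑ χ ∈ X, b χ * chi χ n‖ ^ 2 := by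
    rw [mul_sum]
    calc _ = ∑ n ∈ S, g1 q Y n ^ 2 * ‖∑ χ ∈ X, b χ * chi χ n‖ ^ 2 :=
          sum_congr rfl fun n hn => by rw [g1_unit q Y n (hS n hn).2]
      _ ≤ _ := sum_le_sum_of_subset_of_nonneg (fun n hn => mem_range.2 (hS n hn).1) fun _ _ _ => by positivity
  refine h1.trans ?_
  have h2 : ((∑ n ∈ range N, g1 q Y n ^ 2 * ‖∑ χ ∈ X, b χ * chi χ n‖ ^ 2 : ℝ) : ℂ) =
      ∑ χ ∈ X, ∑ χ' ∈ X, (b χ * star (b χ')) * ∑ n ∈ range N, ((g1 q Y n ^ 2 : ℝ) : ℂ) * (chi χ n * star (chi χ' n)) := by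
    rw [Complex.ofReal_sum]
    simp only [mul_sum]
    rw [sum_congr rfl fun χ _ => Finset.sum_comm, Finset.sum_comm]
    refine sum_congr rfl fun n _ => ?_
    rw [Complex.ofReal_mul, Complex.ofReal_pow ‖_‖, ← Complex.mul_conj', ← Complex.star_def, star_sum, sum_mul_sum, mul_sum]
    refine sum_congr rfl fun χ _ => ?_
    rw [mul_sum]
    refine sum_congr rfl fun χ' _ => ?_
    rw [star_mul']; ring
  have h3 : ∑ n ∈ range N, g1 q Y n ^ 2 * ‖∑ χ ∈ X, b χ * chi χ n‖ ^ 2 ≤ ∑ χ ∈ X, ∑ χ' ∈ X, (‖b χ‖ * ‖b χ'‖) * ((if χ = χ' then D else 0) + E) := by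
    refine (le_abs_self _).trans ?_
    rw [← Real.norm_eq_abs, ← Complex.norm_real, h2]
    refine (norm_sum_le _ _).trans (sum_le_sum fun χ hχ => (norm_sum_le _ _).trans (sum_le_sum fun χ' hχ' => ?_))
    rw [norm_mul, norm_mul, norm_star]
    refine mll ?_ (by positivity)
    split_ifs with h
    · refine le_trans ?_ (le_add_of_nonneg_right hE0)
      refine (norm_sum_le _ _).trans (sum_le_sum fun n _ => ?_)
      rw [norm_mul, Complex.norm_real, Real.norm_of_nonneg (by positivity), norm_mul, norm_star]
      exact mul_le_of_le_one_right (by positivity) (mul_le_one₀ (chi_norm _ _) (norm_nonneg _) (chi_norm _ _))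
    · rw [zero_add]
      refine (ls_off hp hco χ χ' h Y hY N).trans ?_
      rw [hE, pow_two Q]
      have := hX χ hχ
      have := hX χ' hχ'
      have : (0:ℝ) ≤ cndt χ := by positivity
      gcongr
      linarith
  refine h3.trans ?_
  have h4 : ∑ χ ∈ X, ∑ χ' ∈ X, (‖b χ‖ * ‖b χ'‖) * ((if χ = χ' then D else 0) + E) = D * ∑ χ ∈ X, ‖b χ‖ ^ 2 + E * (∑ χ ∈ X, ‖b χ‖) ^ 2 := by
    simp only [mul_add, sum_add_distrib, mul_ite, mul_zero]
    congr 1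
    · rw [mul_sum]
      refine sum_congr rfl fun χ hχ => ?_
      rw [Finset.sum_ite_eq, if_pos hχ]; ring
    · rw [pow_two, sum_mul_sum, mul_sum]
      refine sum_congr rfl fun χ hχ => ?_
      rw [mul_sum]
      refine sum_congr rfl fun χ hχ => ?_
      ring
  rw [h4]
  have h5 := sq_sum_le_card_mul_sum_sq (s := X) (f := fun χ => ‖b χ‖)
  nlinarith [mll h5 hE0]
lemma ls_dual {q : ι → ℕ} (X : Finset (Tp q)) (S : Finset ℕ) (Δ : ℝ) (hΔ : 0 ≤ Δ)
    (h : ∀ b : Tp q → ℂ, ∑ n ∈ S, ‖∑ χ ∈ X, b χ * chi χ n‖ ^ 2 ≤ Δ * ∑ χ ∈ X, ‖b χ‖ ^ 2) :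
    ∑ χ ∈ X, ‖∑ n ∈ S, chi χ n‖ ^ 2 ≤ Δ * #S := by
  set b : Tp q → ℂ := fun χ => star (∑ n ∈ S, chi χ n)
  set B := ∑ χ ∈ X, ‖∑ n ∈ S, chi χ n‖ ^ 2 with hB
  have hb := h b
  have e : (∑ χ ∈ X, ‖b χ‖ ^ 2) = B := by simp only [b, norm_star, hB]
  rw [e] at hb
  have h2 : (B : ℂ) = ∑ n ∈ S, ∑ χ ∈ X, b χ * chi χ n := by
    rw [Finset.sum_comm, hB, Complex.ofReal_sum]
    refine sum_congr rfl fun χ _ => ?_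
    rw [← mul_sum, Complex.ofReal_pow, ← Complex.conj_mul', ← Complex.star_def]
  have hB0 : 0 ≤ B := by positivity
  have h3 : B ≤ ∑ n ∈ S, ‖∑ χ ∈ X, b χ * chi χ n‖ := by
    have : ‖(B:ℂ)‖ = B := by rw [Complex.norm_real, Real.norm_of_nonneg hB0]
    rw [← this, h2]; exact norm_sum_le _ _
  have h4 := sq_sum_le_card_mul_sum_sq (s := S) (f := fun n => ‖∑ χ ∈ X, b χ * chi χ n‖)
  have h5 : B ^ 2 ≤ #S * (Δ * B) := (pow_le_pow_left₀ hB0 h3 2).trans (h4.trans (mll hb (by positivity)))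
  rcases hB0.eq_or_lt with h0 | h0
  · rw [← h0]; positivity
  · nlinarith
open Classical in
lemma card_X {q : ι → ℕ} (hp : ∀ l, (q l).Prime) (Q : ℝ) (hQ : 0 ≤ Q) (X : Finset (Tp q)) (hX : ∀ χ ∈ X, (cndt χ : ℝ) ≤ Q) :
    (#X : ℝ) ≤ Q ^ 3 * exp (∑ l, 1 / (q l : ℝ) ^ 2) := by
  haveI : ∀ l, NeZero (q l) := fun l => ⟨(hp l).ne_zero⟩
  have h1 : (#X : ℝ) ≤ ∑ χ : Tp q, Q ^ 3 * ∏ l, (if χ l = 1 then (1:ℝ) else 1 / (q l : ℝ) ^ 3) := by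
    have : ∀ χ ∈ X, (1:ℝ) ≤ Q ^ 3 * ∏ l, (if χ l = 1 then (1:ℝ) else 1 / (q l : ℝ) ^ 3) := by
      intro χ hχ
      have hc : (0:ℝ) < cndt χ := by
        have : 0 < cndt χ := prod_pos fun l _ => by split_ifs; exacts [one_pos, (hp l).pos]
        exact_mod_cast this
      have : ∏ l, (if χ l = 1 then (1:ℝ) else 1 / (q l : ℝ) ^ 3) = 1 / (cndt χ : ℝ) ^ 3 := by
        rw [cndt, Nat.cast_prod, ← prod_pow, one_div, ← prod_inv_distrib]
        refine prod_congr rfl fun l _ => ?_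
        split_ifs <;> simp
      rw [this, mul_one_div, one_le_div (by positivity)]
      exact pow_le_pow_left₀ hc.le (hX χ hχ) 3
    calc (#X : ℝ) = ∑ χ ∈ X, 1 := by simp
      _ ≤ _ := sum_le_sum this
      _ ≤ _ := sum_le_sum_of_subset_of_nonneg (subset_univ _) fun χ _ _ => mul_nonneg (by positivity) (prod_nonneg fun l _ => by split_ifs <;> positivity)
  refine h1.trans ?_
  rw [← mul_sum]
  refine mll ?_ (by positivity)
  rw [← Fintype.piFinset_univ, ← Finset.prod_univ_sum (fun l => (univ : Finset (DirichletCharacter ℂ (q l)))) (fun l χ => if χ = 1 then (1:ℝ) else 1 / (q l : ℝ) ^ 3), Real.exp_sum]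
  refine prod_le_prod (fun l _ => sum_nonneg fun χ _ => by split_ifs <;> positivity) fun l _ => ?_
  have hq : (0:ℝ) < q l := by exact_mod_cast (hp l).pos
  have hcard : (Fintype.card (DirichletCharacter ℂ (q l)) : ℝ) ≤ q l := by
    rw [← Nat.card_eq_fintype_card, DirichletCharacter.card_eq_totient_of_hasEnoughRootsOfUnity]
    exact_mod_cast Nat.totient_le _
  calc _ ≤ ∑ χ : DirichletCharacter ℂ (q l), ((if χ = 1 then (1:ℝ) else 0) + 1 / (q l : ℝ) ^ 3) :=
        sum_le_sum fun χ _ => by split_ifs <;> simp <;> positivity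
    _ = 1 + Fintype.card (DirichletCharacter ℂ (q l)) * (1 / (q l : ℝ) ^ 3) := by
        rw [sum_add_distrib]; simp
    _ ≤ 1 + q l * (1 / (q l : ℝ) ^ 3) := by gcongr
    _ = 1 / (q l : ℝ) ^ 2 + 1 := by field_simp; ring
    _ ≤ _ := Real.add_one_le_exp _
end F2
section K1
variable {ι : Type} [Fintype ι] [DecidableEq ι] {k : ℕ}
noncomputable def bl (i : Fin k) (l : ℕ) (c : Fin k → ℕ) (a a' : Option (Fin k)) (χ : DirichletCharacter ℂ l) : ℂ :=
  (tau l : ℂ) * ∑ n ∈ range l, if l ∣ n then 0 else ((phU i l c a n * phU i l c a' n : ℝ) : ℂ) * star (χ (n : ZMod l))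
lemma bl_none (i : Fin k) {l : ℕ} (hl : l.Prime) (c : Fin k → ℕ) (χ : DirichletCharacter ℂ l) (h : χ ≠ 1) : bl i l c none none χ = 0 := by
  haveI : NeZero l := ⟨hl.ne_zero⟩
  have e : ∀ n : ℕ, (if l ∣ n then 0 else ((phU i l c none n * phU i l c none n : ℝ) : ℂ) * star (χ (n : ZMod l))) = χ⁻¹ (n : ZMod l) := by
    intro n
    split_ifs with hn
    · rw [MulChar.map_nonunit]; rw [cop_iff hl]; simpa using hn
    · rw [MulChar.star_apply']; simp [phU, ph]
  rw [bl, sum_congr rfl fun n _ => e n, sum_zmod l (fun a => χ⁻¹ a), MulChar.sum_eq_zero_of_ne_one, mul_zero]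
  simpa using h
lemma loc_inv {l : ℕ} [NeZero l] (hl : l.Prime) (F : ℕ → ℂ) (hF : Function.Periodic F l) (n : ℕ) (hn : ¬ l ∣ n) :
    ∑ χ : DirichletCharacter ℂ l, ((tau l : ℂ) * ∑ m ∈ range l, if l ∣ m then 0 else F m * star (χ (m : ZMod l))) * χ (n : ZMod l) = F n := by
  haveI : Fact l.Prime := ⟨hl⟩
  have e : ∀ χ : DirichletCharacter ℂ l, ((tau l : ℂ) * ∑ m ∈ range l, if l ∣ m then 0 else F m * star (χ (m : ZMod l))) * χ (n : ZMod l)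
      = ∑ m ∈ range l, if l ∣ m then 0 else (tau l : ℂ) * F m * (χ (m : ZMod l)⁻¹ * χ (n : ZMod l)) := by
    intro χ
    rw [mul_assoc, sum_mul, mul_sum]
    refine sum_congr rfl fun m _ => ?_
    split_ifs with h
    · simp
    · rw [MulChar.star_apply', MulChar.inv_apply']; ring
  rw [sum_congr rfl fun χ _ => e χ, Finset.sum_comm, sum_eq_single (n % l)]
  · have h' : ¬ l ∣ n % l := by rwa [Nat.dvd_mod_iff dvd_rfl]
    have hu : IsUnit ((n % l : ℕ) : ZMod l) := (cop_iff hl _).2 h'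
    simp only [if_neg h']
    rw [← mul_sum, DirichletCharacter.sum_char_inv_mul_char_eq ℂ hu, if_pos (by simp), hF.map_mod_nat, Nat.totient_prime hl, tau]
    have : ((l:ℂ) - 1) ≠ 0 := by
      rw [sub_ne_zero]; exact_mod_cast hl.one_lt.ne'
    rw [Nat.cast_sub hl.one_lt.le]; push_cast; field_simp
  · intro m hm hne
    split_ifs with h
    · simp
    · have hu : IsUnit (m : ZMod l) := (cop_iff hl _).2 h
      rw [← mul_sum, DirichletCharacter.sum_char_inv_mul_char_eq ℂ hu, if_neg, mul_zero]
      intro h2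
      rw [ZMod.natCast_eq_natCast_iff'] at h2
      rw [Nat.mod_eq_of_lt (mem_range.1 hm)] at h2
      exact hne h2
  · intro h; exact absurd (mem_range.2 (Nat.mod_lt _ hl.pos)) h
noncomputable def BB (q : ι → ℕ) (i : Fin k) (c : ι → Fin k → ℕ) (Z : (ι → Option (Fin k)) → ℝ) (χ : Tp q) : ℂ :=
  ∑ s, ∑ s', ((Z s * Z s' : ℝ) : ℂ) * ∏ l, bl i (q l) (c l) (s l) (s' l) (χ l)
lemma gU_sq (q : ι → ℕ) (i : Fin k) (c : ι → Fin k → ℕ) (Z : (ι → Option (Fin k)) → ℝ) (n : ℕ) :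
    gU q i c Z n ^ 2 = ∑ s, ∑ s', Z s * Z s' * ∏ l, (phU i (q l) (c l) (s l) n * phU i (q l) (c l) (s' l) n) := by
  rw [gU, sq, sum_mul_sum]
  exact sum_congr rfl fun s _ => sum_congr rfl fun s' _ => by rw [pmd]; ring
lemma phU_per (i : Fin k) (l : ℕ) (c : Fin k → ℕ) (a : Option (Fin k)) (n : ℕ) : phU i l c a (n + l) = phU i l c a n := by
  unfold phU; rw [ph_periodic]
lemma chi_unit {q : ι → ℕ} (hp : ∀ l, (q l).Prime) (χ : Tp q) (n : ℕ) (hn : ∀ l, ¬ q l ∣ n) : chi χ n = ∏ l, χ l (n : ZMod (q l)) :=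
  prod_congr rfl fun l _ => ch0_unit (hp l) _ _ (hn l)
open Classical in
lemma BB_inv (q : ι → ℕ) [∀ l, NeZero (q l)] (hp : ∀ l, (q l).Prime) (i : Fin k) (c : ι → Fin k → ℕ) (Z : (ι → Option (Fin k)) → ℝ) (n : ℕ)
    (hn : ∀ l, ¬ q l ∣ n) : ((gU q i c Z n ^ 2 : ℝ) : ℂ) = ∑ χ : Tp q, BB q i c Z χ * chi χ n := by
  rw [gU_sq]
  simp only [BB, sum_mul]
  conv_rhs => rw [Finset.sum_comm]
  rw [Complex.ofReal_sum]
  refine sum_congr rfl fun s _ => ?_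
  conv_rhs => rw [Finset.sum_comm]
  rw [Complex.ofReal_sum]
  refine sum_congr rfl fun s' _ => ?_
  simp only [chi_unit hp _ n hn, mul_assoc, ← pmd]
  rw [← mul_assoc (Z s), Complex.ofReal_mul, ← mul_sum, Complex.ofReal_prod]
  congr 1
  rw [← Fintype.piFinset_univ, ← Finset.prod_univ_sum (fun l => (univ : Finset (DirichletCharacter ℂ (q l)))) (fun l χ => bl i (q l) (c l) (s l) (s' l) χ * χ (n : ZMod (q l)))]
  refine prod_congr rfl fun l _ => ?_
  exact (loc_inv (hp l) (fun n => ((phU i (q l) (c l) (s l) n * phU i (q l) (c l) (s' l) n : ℝ) : ℂ)) (fun n => by simp only [phU_per]) n (hn l)).symm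
lemma BB_eq (q : ι → ℕ) (hp : ∀ l, (q l).Prime) (hco : HC q) (i : Fin k) (c : ι → Fin k → ℕ)
    (Z : (ι → Option (Fin k)) → ℝ) (χ : Tp q) :
    BB q i c Z χ = (∏ l, tau (q l) : ℝ) * ∑ n ∈ (range (∏ l, q l)).filter (fun n => ∀ l, ¬ q l ∣ n), ((gU q i c Z n ^ 2 : ℝ) : ℂ) * star (chi χ n) := by
  simp only [gU_sq, Complex.ofReal_sum, sum_mul]
  rw [Finset.sum_comm, mul_sum, BB]
  refine sum_congr rfl fun s _ => ?_
  rw [Finset.sum_comm, mul_sum]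
  refine sum_congr rfl fun s' _ => ?_
  have := crt_prod univ q (fun l => (hp l).pos) hco (fun l n => if q l ∣ n then 0 else ((phU i (q l) (c l) (s l) n * phU i (q l) (c l) (s' l) n : ℝ) : ℂ) * star (χ l (n : ZMod (q l)))) (by
    intro l n
    simp only [phU_per, Nat.dvd_add_self_right]
    simp)
  simp only [bl, pmd]
  rw [← this, sum_filter, Complex.ofReal_prod, mul_left_comm, mul_sum]
  congr 1
  refine sum_congr rfl fun n _ => ?_
  split_ifs with h
  · rw [chi_unit hp χ n h, star_prod, prod_congr rfl fun l _ => if_neg (h l), pmd, ← Complex.ofReal_prod, pmd]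
    push_cast; ring
  · push Not at h; obtain ⟨l, hl⟩ := h
    rw [prod_eq_zero (mem_univ l) (by simp [hl]), mul_zero]
lemma BB_one (q : ι → ℕ) (hp : ∀ l, (q l).Prime) (hco : HC q) (i : Fin k) (c : ι → Fin k → ℕ)
    (Z : (ι → Option (Fin k)) → ℝ) : BB q i c Z 1 = (EU q (fun n => gU q i c Z n ^ 2) : ℝ) := by
  rw [BB_eq q hp hco, EU, Complex.ofReal_mul, Complex.ofReal_sum]
  congr 1
  refine sum_congr rfl fun n _ => ?_
  have : chi (1 : Tp q) n = 1 := by simp [chi, ch0]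
  rw [this]; simp
lemma BB_supp (q : ι → ℕ) (hp : ∀ l, (q l).Prime) (i : Fin k) (c : ι → Fin k → ℕ)
    (Z : (ι → Option (Fin k)) → ℝ) (R : ℝ) (hZ : ∀ s, Z s ≠ 0 → (NN q s : ℝ) ≤ R) (χ : Tp q) (h : BB q i c Z χ ≠ 0) : (cndt χ : ℝ) ≤ R ^ 2 := by
  obtain ⟨s, _, h1⟩ := exists_ne_zero_of_sum_ne_zero h
  obtain ⟨s', _, h2⟩ := exists_ne_zero_of_sum_ne_zero h1
  obtain ⟨h3, h4⟩ := mul_ne_zero_iff.1 h2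
  have h5 : Z s * Z s' ≠ 0 := by exact_mod_cast h3
  obtain ⟨h6, h7⟩ := mul_ne_zero_iff.1 h5
  have h8 : cndt χ ≤ NN q s * NN q s' := by
    unfold cndt NN
    rw [← pmd]
    refine prod_le_prod' fun l _ => ?_
    have hq := (hp l).one_le
    split_ifs with a b d <;> try nlinarith
    rename_i b d
    exact absurd (by rw [b, d]; exact bl_none i (hp l) (c l) (χ l) a) (prod_ne_zero_iff.1 h4 l (mem_univ l))
  have h9 : (cndt χ : ℝ) ≤ NN q s * NN q s' := by exact_mod_cast h8
  refine h9.trans ?_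
  rw [pow_two]
  exact mul_le_mul (hZ s h6) (hZ s' h7) (by positivity) ((Nat.cast_nonneg _).trans (hZ s h6))
lemma BB_bound (q : ι → ℕ) (hp : ∀ l, (q l).Prime) (hco : HC q) (i : Fin k)
    (c : ι → Fin k → ℕ) (hc : ∀ l j j', j ≠ i → j' ≠ i → c l j % q l = c l j' % q l → j = j')
    (hc0 : ∀ l j, j ≠ i → c l j % q l ≠ 0) (R : ℝ) (g : Finset ι → ℝ) (hg0 : ∀ A, 0 ≤ g A) (hga : ∀ A B, A ⊆ B → g B ≤ g A) 
    (χ : Tp q) (l0 : ι) (hχ : χ l0 ≠ 1) (ε : ℝ) (hε : 0 < ε) :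
    ‖BB q i c (ZZ q i (YY q R g)) χ‖ ≤ (ε + (1 + 1 / ε) * (k * tau (q l0))) * (G1 q g ^ 2 * G2 q g ^ (k - 1)) := by
  set Z := ZZ q i (YY q R g) with hZ
  set Za : (ι → Option (Fin k)) → ℝ := fun s => if s l0 = none then Z s else 0 with hZa
  set Zb : (ι → Option (Fin k)) → ℝ := fun s => if s l0 = none then 0 else Z s with hZb
  have hq : ∀ l, 2 ≤ q l := fun l => (hp l).two_le
  have hsplit : ∀ n, gU q i c Z n = gU q i c Za n + gU q i c Zb n := by
    intro n
    simp only [gU, ← sum_add_distrib, ← add_mul]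
    refine sum_congr rfl fun s _ => ?_
    simp only [hZa, hZb]; split_ifs <;> simp
  have ha0 : BB q i c Za χ = 0 := by
    refine sum_eq_zero fun s _ => sum_eq_zero fun s' _ => ?_
    by_cases h1 : s l0 = none
    · by_cases h2 : s' l0 = none
      · rw [prod_eq_zero (mem_univ l0), mul_zero]
        rw [h1, h2]; exact bl_none i (hp l0) _ _ hχ
      · simp [hZa, h2]
    · simp [hZa, h1]
  have hTa := T_upper q hq hco i c hc hc0 R g hg0 Za (fun s => by simp only [hZa]; split_ifs; exacts [Or.inr rfl, Or.inl rfl])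
  have hTb := T_beta q hq hco i c hc hc0 R g hg0 hga l0
  have htau : 0 ≤ ∏ l, tau (q l) := prod_nonneg fun l _ => (tau_pos (hq l)).le
  have key : ‖BB q i c Z χ‖ ≤ ε * EU q (fun n => gU q i c Za n ^ 2) + (1 + 1 / ε) * EU q (fun n => gU q i c Zb n ^ 2) := by
    rw [← sub_zero (BB q i c Z χ), ← ha0, BB_eq q hp hco, BB_eq q hp hco, ← mul_sub, ← sum_sub_distrib, norm_mul, Complex.norm_real, Real.norm_of_nonneg htau]
    simp only [EU]
    rw [mul_left_comm, mul_left_comm (1 + 1 / ε), ← mul_add]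
    refine mll ?_ htau
    rw [mul_sum, mul_sum, ← sum_add_distrib]
    refine (norm_sum_le _ _).trans (sum_le_sum fun n _ => ?_)
    rw [← sub_mul, norm_mul, norm_star, ← Complex.ofReal_sub, Complex.norm_real, Real.norm_eq_abs]
    refine (mul_le_of_le_one_right (abs_nonneg _) (chi_norm _ _)).trans ?_
    rw [hsplit n]
    generalize gU q i c Za n = a
    generalize gU q i c Zb n = b
    have h1 : 0 ≤ (ε * a - b) ^ 2 / ε := by positivity
    have h2 : 0 ≤ (ε * a + b) ^ 2 / ε := by positivity
    have e1 : (ε * a - b) ^ 2 / ε = ε * a ^ 2 - 2 * a * b + 1 / ε * b ^ 2 := by field_simp; try ring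
    have e2 : (ε * a + b) ^ 2 / ε = ε * a ^ 2 + 2 * a * b + 1 / ε * b ^ 2 := by field_simp; try ring
    rw [abs_le]; constructor <;> nlinarith [sq_nonneg b]
  refine key.trans ?_
  have := mll hTa hε.le
  have := mll hTb (show 0 ≤ 1 + 1 / ε by positivity)
  linarith
end K1
section K2
variable {ι : Type} [Fintype ι] [DecidableEq ι] {k : ℕ}
lemma chi_quot {q : ι → ℕ} (hp : ∀ l, (q l).Prime) (χ : Tp q) (u t p : ℕ) (ht : ∀ l, ¬ q l ∣ t) (hpp : ∀ l, ¬ q l ∣ p)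
    (h : ∀ l, u * t ≡ p [MOD q l]) : (∀ l, ¬ q l ∣ u) ∧ chi χ u = chi χ p * star (chi χ t) := by
  have hu : ∀ l, ¬ q l ∣ u := by
    intro l hl
    apply hpp l
    have := (h l).symm.dvd_iff (dvd_refl _)
    exact this.2 (hl.mul_right _)
  refine ⟨hu, ?_⟩
  rw [chi_unit hp _ _ hu, chi_unit hp _ _ ht, chi_unit hp _ _ hpp, star_prod, ← pmd]
  refine prod_congr rfl fun l _ => ?_
  have e : (p : ZMod (q l)) = u * t := by
    have := (ZMod.natCast_eq_natCast_iff _ _ _).2 (h l)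
    rw [← this]; push_cast; ring
  have hut : IsUnit (t : ZMod (q l)) := (cop_iff (hp l) t).2 (ht l)
  have h1 : χ l (t : ZMod (q l)) * star (χ l (t : ZMod (q l))) = 1 := by
    rw [MulChar.star_apply', ← MulChar.mul_apply, mul_inv_cancel, MulChar.one_apply hut]
  rw [e, map_mul, mul_assoc, h1, mul_one]
lemma var_bound (q : ι → ℕ) (hp : ∀ l, (q l).Prime) (hco : HC q) (i : Fin k) (c : ι → Fin k → ℕ)
    (Z : (ι → Option (Fin k)) → ℝ) (X : Finset (Tp q)) (hX : ∀ χ, BB q i c Z χ ≠ 0 → χ ∈ X) (β : ℝ) (hβ : 0 ≤ β) (hB : ∀ χ, χ ≠ 1 → ‖BB q i c Z χ‖ ≤ β)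
    (P S : Finset ℕ) (hP : ∀ n ∈ P, ∀ l, ¬ q l ∣ n) (hS : ∀ n ∈ S, ∀ l, ¬ q l ∣ n) (u : ℕ → ℕ → ℕ)
    (hu : ∀ p ∈ P, ∀ t ∈ S, ∀ l, u p t * t ≡ p [MOD q l]) (ΔP ΔS : ℝ) (hΔP : 0 ≤ ΔP) (hΔS : 0 ≤ ΔS)
    (hLP : ∀ b : Tp q → ℂ, ∑ n ∈ P, ‖∑ χ ∈ X, b χ * chi χ n‖ ^ 2 ≤ ΔP * ∑ χ ∈ X, ‖b χ‖ ^ 2)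
    (hLS : ∀ b : Tp q → ℂ, ∑ n ∈ S, ‖∑ χ ∈ X, b χ * chi χ n‖ ^ 2 ≤ ΔS * ∑ χ ∈ X, ‖b χ‖ ^ 2) :
    ∑ t ∈ S, (∑ p ∈ P, gU q i c Z (u p t) ^ 2 - #P * EU q (fun n => gU q i c Z n ^ 2)) ^ 2 ≤ ΔS * (β ^ 2 * (ΔP * #P)) := by
  classical
  haveI : ∀ l, NeZero (q l) := fun l => ⟨(hp l).ne_zero⟩
  set b : Tp q → ℂ := fun χ => if χ = 1 then 0 else BB q i c Z χ * ∑ p ∈ P, chi χ p with hb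
  have key : ∀ t ∈ S, (∑ p ∈ P, gU q i c Z (u p t) ^ 2 - #P * EU q (fun n => gU q i c Z n ^ 2)) ^ 2 = ‖∑ χ ∈ X, star (b χ) * chi χ t‖ ^ 2 := by
    intro t ht
    have e1 : ((∑ p ∈ P, gU q i c Z (u p t) ^ 2 : ℝ) : ℂ) = ∑ χ : Tp q, BB q i c Z χ * (∑ p ∈ P, chi χ p) * star (chi χ t) := by
      rw [Complex.ofReal_sum]
      simp only [mul_sum, sum_mul]
      conv_rhs => rw [Finset.sum_comm]
      refine sum_congr rfl fun p hp' => ?_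
      have hq := fun χ : Tp q => chi_quot hp χ (u p t) t p (hS t ht) (hP p hp') (hu p hp' t ht)
      rw [BB_inv q hp i c Z _ (hq 1).1]
      refine sum_congr rfl fun χ _ => ?_
      rw [(hq χ).2]; ring
    have e2 : ((∑ p ∈ P, gU q i c Z (u p t) ^ 2 - #P * EU q (fun n => gU q i c Z n ^ 2) : ℝ) : ℂ) = ∑ χ ∈ X, b χ * star (chi χ t) := by
      have h1 : ∀ n, chi (1 : Tp q) n = 1 := by simp [chi, ch0]
      have : ∑ χ ∈ X, b χ * star (chi χ t) = ∑ χ : Tp q, b χ * star (chi χ t) := by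
        refine sum_subset (subset_univ _) fun χ _ hχ => ?_
        have : BB q i c Z χ = 0 := by by_contra h; exact hχ (hX χ h)
        simp [hb, this]
      rw [this, Complex.ofReal_sub, e1, ← add_sum_erase _ _ (mem_univ (1 : Tp q)), ← add_sum_erase _ (fun χ => b χ * star (chi χ t)) (mem_univ (1 : Tp q)), BB_one q hp hco]
      simp only [h1, hb]
      simp only [if_true, sum_const, star_one, mul_one, nsmul_eq_mul, zero_mul, zero_add]
      have e5 : ∑ χ ∈ univ.erase (1 : Tp q), (if χ = 1 then 0 else BB q i c Z χ * ∑ p ∈ P, chi χ p) * star (chi χ t) =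
          ∑ χ ∈ univ.erase (1 : Tp q), BB q i c Z χ * (∑ p ∈ P, chi χ p) * star (chi χ t) :=
        sum_congr rfl fun χ hχ => by rw [if_neg (mem_erase.1 hχ).1]
      rw [e5]
      push_cast; ring
    have e3 : ∑ χ ∈ X, b χ * star (chi χ t) = star (∑ χ ∈ X, star (b χ) * chi χ t) := by
      rw [star_sum]; refine sum_congr rfl fun χ _ => ?_
      rw [star_mul', star_star]
    rw [← sq_abs, ← Real.norm_eq_abs, ← Complex.norm_real, e2, e3, norm_star]
  rw [sum_congr rfl key]
  refine (hLS _).trans (mll ?_ hΔS)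
  have hd := ls_dual X P ΔP hΔP hLP
  refine le_trans ?_ (mll hd (sq_nonneg β))
  rw [mul_sum]
  refine sum_le_sum fun χ _ => ?_
  rw [norm_star]
  simp only [hb]
  split_ifs with h
  · simp; positivity
  · rw [norm_mul, mul_pow]
    have := hB χ h
    gcongr
end K2
section N1
variable {ι : Type} [Fintype ι] [DecidableEq ι] {k : ℕ}
noncomputable def cU (W : ℕ) (i : Fin k) (l : ℕ) (j : Fin k) : ℕ := ((((j:ℕ):ZMod l) - ((i:ℕ):ZMod l)) * (W : ZMod l))⁻¹.val
lemma fin_cast_inj {l : ℕ} (hk : k ≤ l) (i j : Fin k) (h : ((j:ℕ):ZMod l) = ((i:ℕ):ZMod l)) : j = i := by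
  rw [ZMod.natCast_eq_natCast_iff', Nat.mod_eq_of_lt (j.2.trans_le hk), Nat.mod_eq_of_lt (i.2.trans_le hk)] at h
  exact Fin.ext h
lemma cU_cast {l : ℕ} (hl : l.Prime) (W : ℕ) (i j : Fin k) :
    ((cU W i l j : ℕ) : ZMod l) = ((((j:ℕ):ZMod l) - ((i:ℕ):ZMod l)) * (W : ZMod l))⁻¹ := by
  haveI : NeZero l := ⟨hl.ne_zero⟩
  simp [cU]
lemma cU_ne {l : ℕ} (hl : l.Prime) (hk : k ≤ l) (W : ℕ) (hW : ¬ l ∣ W) (i j : Fin k) (h : j ≠ i) : cU W i l j % l ≠ 0 := by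
  haveI : Fact l.Prime := ⟨hl⟩
  intro h0
  have h1 : ((cU W i l j : ℕ) : ZMod l) = 0 := (ZMod.natCast_eq_zero_iff _ _).2 (Nat.dvd_of_mod_eq_zero h0)
  rw [cU_cast hl, inv_eq_zero, mul_eq_zero, sub_eq_zero, ZMod.natCast_eq_zero_iff] at h1
  rcases h1 with h1 | h1
  · exact h (fin_cast_inj hk i j h1)
  · exact hW h1
lemma cU_inj {l : ℕ} (hl : l.Prime) (hk : k ≤ l) (W : ℕ) (hW : ¬ l ∣ W) (i j j' : Fin k) (h : cU W i l j % l = cU W i l j' % l) : j = j' := by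
  haveI : Fact l.Prime := ⟨hl⟩
  have h1 := (ZMod.natCast_eq_natCast_iff' _ _ _).2 h
  rw [cU_cast hl, cU_cast hl, inv_inj] at h1
  have hW' : (W : ZMod l) ≠ 0 := by rwa [Ne, ZMod.natCast_eq_zero_iff]
  have h2 := mul_right_cancel₀ hW' h1
  exact fin_cast_inj hk j' j (by simpa using h2)
lemma link_loc {l : ℕ} (hl : l.Prime) (hk : k ≤ l) (W : ℕ) (hW : ¬ l ∣ W) (i : Fin k) (t p u : ℕ) (ht : ¬ l ∣ t) (hu : u * t ≡ p [MOD l])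
    (a : Option (Fin k)) : ph l (fun j => j * W * p) a (t + i * W * p) = phT i l (cU W i l) a u := by
  haveI : Fact l.Prime := ⟨hl⟩
  have ht' : (t : ZMod l) ≠ 0 := by rwa [Ne, ZMod.natCast_eq_zero_iff]
  have hW' : (W : ZMod l) ≠ 0 := by rwa [Ne, ZMod.natCast_eq_zero_iff]
  have hp' : (p : ZMod l) = u * t := by
    have := (ZMod.natCast_eq_natCast_iff _ _ _).2 hu
    rw [← this]; push_cast; ring
  cases a with
  | none => simp [ph, phT]
  | some j =>
    by_cases hj : j = i
    · subst hj
      simp only [phT, ph, if_true]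
      rw [if_neg, sub_zero]
      intro h
      have := (ZMod.natCast_eq_natCast_iff' _ _ _).2 h
      push_cast at this
      exact ht' (by simpa using this)
    · have hne : (((j:ℕ):ZMod l) - ((i:ℕ):ZMod l)) ≠ 0 := fun h => hj (fin_cast_inj hk i j (sub_eq_zero.1 h))
      have : (t + i * W * p) % l = (j * W * p) % l ↔ u % l = cU W i l j % l := by
        rw [← ZMod.natCast_eq_natCast_iff', ← ZMod.natCast_eq_natCast_iff', cU_cast hl, ← mul_eq_one_iff_eq_inv₀ (mul_ne_zero hne hW')]
        push_cast
        rw [hp']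
        constructor
        · intro h
          apply mul_right_cancel₀ ht'
          linear_combination -h
        · intro h
          linear_combination (-(t:ZMod l)) * h
      simp [ph, phT, hj, this]
lemma link (q : ι → ℕ) (hp : ∀ l, (q l).Prime) (hk : ∀ l, k ≤ q l) (W : ℕ) (hW : ∀ l, ¬ q l ∣ W) (i : Fin k) (Y : (ι → Option (Fin k)) → ℝ)
    (t p u : ℕ) (ht : ∀ l, ¬ q l ∣ t) (hu : ∀ l, u * t ≡ p [MOD q l]) :
    gg q (fun _ j => j * W * p) Y (t + i * W * p) = gU q i (fun l => cU W i (q l)) (ZZ q i Y) u := by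
  rw [← gT_eq, gg]
  exact sum_congr rfl fun r _ => by
    congr 1
    exact prod_congr rfl fun l _ => link_loc (hp l) (hk l) W (hW l) i t p u (ht l) (hu l) _
lemma exists_u (q : ι → ℕ) (hp : ∀ l, (q l).Prime) (hco : HC q) (t p : ℕ) (ht : ∀ l, ¬ q l ∣ t) :
    ∃ u, ∀ l, u * t ≡ p [MOD q l] := by
  have hc : t.Coprime (∏ l, q l) := Nat.Coprime.prod_right fun l _ => ((hp l).coprime_iff_not_dvd.2 (ht l)).symm
  have hD : 0 < ∏ l, q l := prod_pos fun l _ => (hp l).pos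
  haveI : NeZero (∏ l, q l) := ⟨hD.ne'⟩
  refine ⟨p * ((t : ZMod (∏ l, q l))⁻¹).val, fun l => ?_⟩
  have h : p * ((t : ZMod (∏ l, q l))⁻¹).val * t ≡ p [MOD ∏ l, q l] := by
    rw [← ZMod.natCast_eq_natCast_iff]
    push_cast
    rw [ZMod.natCast_zmod_val, mul_assoc, mul_comm (t : ZMod (∏ l, q l))⁻¹, ZMod.coe_mul_inv_eq_one t hc, mul_one]
  exact h.of_dvd (dvd_prod_of_mem q (mem_univ l))
lemma ZZ_supp (q : ι → ℕ) (hq : ∀ l, 2 ≤ q l) (i : Fin k) (R : ℝ) (g : Finset ι → ℝ) (s : ι → Option (Fin k)) (h : ZZ q i (YY q R g) s ≠ 0) :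
    (NN q s : ℝ) ≤ R := by
  obtain ⟨r, _, h1⟩ := exists_ne_zero_of_sum_ne_zero h
  obtain ⟨h2, h3⟩ := mul_ne_zero_iff.1 h1
  have h4 : (NN q r : ℝ) ≤ R := by by_contra h; exact h2 (by simp [YY, h])
  refine le_trans ?_ h4
  have : NN q s ≤ NN q r := by
    refine prod_le_prod' fun l _ => ?_
    have h5 := prod_ne_zero_iff.1 h3 l (mem_univ l)
    have := hq l
    by_cases hs : s l = none
    · rw [if_pos hs]; split_ifs <;> omega
    · have hr : r l = s l := by
        by_contra hne
        apply h5; unfold Mx; simp [hs, hne]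
      rw [hr]
  exact_mod_cast this
end N1
section
lemma Lc_tau_sq (w R : ℕ) (hw : 2 ≤ w) : ∑ l : Lc w R, tau (qL w R l) ^ 2 ≤ 2 / w := by
  have key : ∀ n : ℕ, w ≤ n → ∑ l ∈ Ioc w n, tau l ^ 2 ≤ 1 / ((w:ℝ) - 1) - 1 / ((n:ℝ) - 1) := by
    intro n hn
    induction n, hn using Nat.le_induction with
    | base => simp
    | succ n hn ih =>
      rw [← Finset.insert_Ioc_right_eq_Ioc_add_one (by omega), sum_insert (by simp)]
      have h2 : (2:ℝ) ≤ n := by exact_mod_cast hw.trans hn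
      have : tau (n+1) ^ 2 ≤ 1 / ((n:ℝ) - 1) - 1 / (((n+1:ℕ):ℝ) - 1) := by
        unfold tau
        push_cast
        rw [div_sub_div _ _ (by linarith) (by linarith), div_pow, ddi (by nlinarith) (by nlinarith)]
        nlinarith
      linarith
  have h2 : (2:ℝ) ≤ w := by exact_mod_cast hw
  have e1 : ∑ l : Lc w R, tau (qL w R l) ^ 2 = ∑ l ∈ Lc w R, tau l ^ 2 := by
    rw [← Finset.sum_coe_sort (Lc w R) (fun l => tau l ^ 2)]
  have e2 : ∑ l ∈ Lc w R, tau l ^ 2 ≤ ∑ l ∈ Ioc w (max w R), tau l ^ 2 := by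
    refine sum_le_sum_of_subset_of_nonneg ?_ fun _ _ _ => sq_nonneg _
    intro l hl
    have := mem_filter.1 hl
    have h3 := (Nat.mem_primesLE.1 this.1).1
    simp [this.2, h3]
  have e3 := key (max w R) (le_max_left _ _)
  have e4 : 0 ≤ 1 / (((max w R : ℕ):ℝ) - 1) := by
    have : (2:ℝ) ≤ (max w R : ℕ) := by exact_mod_cast hw.trans (le_max_left _ _)
    exact div_nonneg zero_le_one (by linarith)
  have e5 : 1 / ((w:ℝ) - 1) ≤ 2 / w := by
    rw [ddi (by linarith) (by linarith)]; linarith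
  linarith
lemma Lc_sums (w R : ℕ) (hw : 2 ≤ w) (k : ℕ) (hk : 2 * k ≤ w) :
    exp (∑ l : Lc w R, k / (qL w R l : ℝ) ^ 2) ≤ 3 ∧
    exp (∑ l : Lc w R, k / ((qL w R l : ℝ) * ((qL w R l : ℝ) - 1))) ≤ 3 := by
  have h := Lc_tau_sq w R hw
  have h2 : (2:ℝ) ≤ w := by exact_mod_cast hw
  have hk' : 2 * (k:ℝ) ≤ w := by exact_mod_cast hk
  have hb : k * (∑ l : Lc w R, tau (qL w R l) ^ 2) ≤ 1 := by
    calc _ ≤ k * (2 / (w:ℝ)) := by gcongr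
      _ ≤ 1 := by rw [mul_div_assoc', div_le_one (by linarith)]; linarith
  have e3 : exp 1 ≤ 3 := by linarith [Real.exp_one_lt_d9]
  constructor <;>
  · refine le_trans (Real.exp_le_exp.2 ?_) e3
    refine le_trans ?_ hb
    rw [mul_sum]
    refine sum_le_sum fun l _ => ?_
    have hl : (2:ℝ) ≤ qL w R l := by exact_mod_cast Lc_two l
    unfold tau
    rw [div_eq_mul_one_div, div_pow, one_pow]
    refine mll (one_div_le_one_div_of_le (by nlinarith) (by nlinarith)) (by positivity)
lemma NA_eq1 {ι : Type} [Fintype ι] [DecidableEq ι] (q : ι → ℕ) (r : ι → Option (Fin 1)) : NN q r = NA q (AA r 0) := by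
  rw [NN_eq]; simp
lemma sum_fin1 {ι : Type} [Fintype ι] [DecidableEq ι] (F : Finset ι → ℝ) :
    ∑ r : ι → Option (Fin 1), F (AA r 0) = ∑ A, F A := by
  refine sum_bij (fun r _ => AA r 0) (fun _ _ => mem_univ _) ?_ ?_ (fun _ _ => rfl)
  · intro r _ r' _ h
    apply AA_inj
    funext j
    fin_cases j; exact h
  · intro A _
    obtain ⟨r, hr⟩ := AA_exists (k := 1) (fun _ => A) (fun i j h => absurd (Subsingleton.elim i j) h)
    exact ⟨r, mem_univ _, congrFun hr 0⟩
lemma V0_eq (w R : ℕ) (hR : 1 ≤ R) : V0 (qL w R) (YY (qL w R) R (fun _ => 1)) = VV w R (log R) := by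
  unfold V0 VV
  rw [← sum_fin1 (fun A => if log (NA (qL w R) A) ≤ log R then mm (qL w R) A else 0)]
  refine sum_congr rfl fun r _ => ?_
  have hN : (0:ℝ) < NA (qL w R) (AA r 0) := by exact_mod_cast NA_pos (qL w R) Lc_two (AA r 0)
  have hiff := Real.log_le_log_iff hN (by exact_mod_cast hR : (0:ℝ) < R)
  have h2 : ∏ l, tA (qL w R l) (r l) = mm (qL w R) (AA r 0) := by
    have := cfg_prod (fun l => tau (qL w R l)) r
    unfold tA mm
    rw [this]; simp
  rw [YY, NA_eq1, h2]
  by_cases h : (NA (qL w R) (AA r 0) : ℝ) ≤ R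
  · rw [if_pos h, if_pos (hiff.2 h)]; simp
  · rw [if_neg h, if_neg (fun h' => h (hiff.1 h'))]; simp
lemma LS_num (R N : ℕ) (hR : 2 ≤ R) (hN : R ^ 100 ≤ N) (p V : ℝ) (hP : 1 ≤ p) (hV1 : 1 ≤ V) (hVge : log R / (2 * p) ≤ V)
    (C : ℝ) (hcnt0 : 0 ≤ C) (hcnt : C ≤ 3 * (R:ℝ) ^ 3) (c : ℝ) (hc0 : 0 ≤ c) (hcX : c ≤ 3 * (R:ℝ) ^ 12) (G : ℝ) (hg1 : G ≤ 3 * N * V + 18 * (R:ℝ) ^ 6) :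
    G + c * (C ^ 2 * ((R:ℝ)^4) ^ 2) ≤ V ^ 2 * (60 * p * N / log R) := by
  have hR' : (2:ℝ) ≤ R := by exact_mod_cast hR
  have hlR : 0 < log R := Real.log_pos (by linarith)
  have a1 : c * (C ^ 2 * ((R:ℝ)^4) ^ 2) ≤ 27 * (R:ℝ)^26 := by
    calc _ ≤ 3 * (R:ℝ)^12 * ((3 * (R:ℝ)^3) ^ 2 * ((R:ℝ)^4) ^ 2) := by gcongr
      _ = _ := by ring
  have a2 : (R:ℝ)^6 ≤ (R:ℝ)^26 := pow_le_pow_right₀ (by linarith) (by norm_num)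
  have a3 : (R:ℝ)^26 ≤ N / log R := by
    rw [le_div_iff₀ hlR]
    have : log R ≤ R := (Real.log_le_sub_one_of_pos (by linarith)).trans (by linarith)
    calc _ ≤ (R:ℝ)^26 * R := by gcongr
      _ = (R:ℝ)^27 := by ring
      _ ≤ (R:ℝ)^100 := pow_le_pow_right₀ (by linarith) (by norm_num)
      _ ≤ N := by exact_mod_cast hN
  have a4 : (N:ℝ) * V ≤ V ^ 2 * (2 * p * N / log R) := by
    have : 1 ≤ V * (2 * p) / log R := by
      rw [le_div_iff₀ hlR, one_mul]; rwa [div_le_iff₀ (by positivity)] at hVge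
    calc (N:ℝ) * V = N * V * 1 := by ring
      _ ≤ N * V * (V * (2 * p) / log R) := by gcongr
      _ = _ := by ring
  have a5 : N / log R ≤ V ^ 2 * (p * N / log R) := by
    have : 1 ≤ V ^ 2 * p := by nlinarith
    calc N / log R = 1 * (N / log R) := by ring
      _ ≤ V ^ 2 * p * (N / log R) := by gcongr
      _ = _ := by ring
  calc _ ≤ 3 * (N * V) + 45 * (N / log R) := by linarith
    _ ≤ 3 * (V ^ 2 * (2 * p * N / log R)) + 45 * (V ^ 2 * (p * N / log R)) := by gcongr
    _ = V ^ 2 * (51 * p * N / log R) := by ring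
    _ ≤ _ := by gcongr; norm_num
lemma LSc (w R N : ℕ) (hw : 2 ≤ w) (hR : 2 ≤ R) (hN : R ^ 100 ≤ N) (X : Finset (Tp (qL w R))) (hX : ∀ χ ∈ X, (cndt χ : ℝ) ≤ (R:ℝ) ^ 4)
    (S : Finset ℕ) (hS : ∀ n ∈ S, n < N ∧ ∀ l, ¬ qL w R l ∣ n) (b : Tp (qL w R) → ℂ) :
    ∑ n ∈ S, ‖∑ χ ∈ X, b χ * chi χ n‖ ^ 2 ≤ (60 * PP w * N / log R) * ∑ χ ∈ X, ‖b χ‖ ^ 2 := by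
  set Y : (Lc w R → Option (Fin 1)) → ℝ := YY (qL w R) R (fun _ => 1) with hY
  set V := V0 (qL w R) Y with hV
  have hR' : (2:ℝ) ≤ R := by exact_mod_cast hR
  have hlR : 0 < log R := Real.log_pos (by linarith)
  have hP := PP_ge_one w
  have hVV : V = VV w R (log R) := V0_eq w R (by omega)
  have hVge : log R / (2 * PP w) ≤ V := by rw [hVV]; exact VV_ge w R _ (by omega) le_rfl
  have hV1 : 1 ≤ V := by
    rw [hVV, VV]
    refine le_trans (le_of_eq ?_) (single_le_sum (f := fun A : Finset (Lc w R) => if log (NA (qL w R) A) ≤ log R then mm (qL w R) A else 0) (fun A _ => ?_) (mem_univ ∅))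
    · simp [NA, mm, hlR.le]
    · split_ifs
      · exact mm_nonneg _ Lc_two _
      · exact le_rfl
  have hY0 : ∀ r, 0 ≤ Y r := by intro r; rw [hY, YY]; split_ifs <;> simp
  have hY1 : ∀ r, Y r ≤ 1 := by intro r; rw [hY, YY]; split_ifs <;> simp
  have hYs : ∀ r, Y r ≠ 0 → (NN (qL w R) r : ℝ) ≤ R := by
    intro r hr; by_contra h; exact hr (by rw [hY, YY, if_neg h])
  obtain ⟨hs1, hs2⟩ := Lc_sums w R hw 1 (by omega)
  have hcnt : ∑ r, Y r * NN (qL w R) r ≤ 3 * (R:ℝ) ^ 3 := by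
    refine (cfg_count (qL w R) Lc_two R (by positivity) Y 1 hY0 hY1 hYs).trans ?_
    rw [one_mul, mul_comm]; gcongr
  have hcnt0 : 0 ≤ ∑ r, Y r * NN (qL w R) r := sum_nonneg fun r _ => mul_nonneg (hY0 r) (by positivity)
  have hcX : (#X : ℝ) ≤ 3 * (R:ℝ) ^ 12 := by
    refine (card_X (fun l => Lc_prime l) ((R:ℝ)^4) (by positivity) X hX).trans ?_
    rw [← pow_mul, mul_comm]; norm_num at hs1 ⊢; gcongr
  have hsv := sieve_upper (qL w R) (c := fun _ (_ : Fin 1) => 0) Lc_two Lc_co (fun l i j _ => Subsingleton.elim _ _) 1 one_pos (fun l => Nat.coprime_one_left _) Y hY0 N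
  have hg1 : ∑ n ∈ range N, g1 (qL w R) Y n ^ 2 ≤ 3 * N * V + 18 * (R:ℝ) ^ 6 := by
    have h1 : ∑ r, (∏ l, cc 1 ((qL w R) l) (r l)) * Y r ^ 2 ≤ 3 * V := by
      rw [hV, V0, mul_sum]
      refine sum_le_sum fun r _ => ?_
      have h3 := cc_prod_le (qL w R) Lc_two r
      have h2 : ∏ l, tA (qL w R l) (r l) = ∏ j, mm (qL w R) (AA r j) := by
        have := cfg_prod (fun l => tau (qL w R l)) r
        unfold tA mm
        rw [this]
      rw [h2]
      have hm : 0 ≤ ∏ j, mm (qL w R) (AA r j) := prod_nonneg fun j _ => mm_nonneg _ Lc_two _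
      have h4 : ∏ l, cc 1 ((qL w R) l) (r l) ≤ 3 * ∏ j, mm (qL w R) (AA r j) := h3.trans (by gcongr)
      calc _ ≤ (3 * ∏ j, mm (qL w R) (AA r j)) * Y r ^ 2 := by gcongr
        _ ≤ (3 * ∏ j, mm (qL w R) (AA r j)) * Y r := by
          refine mll ?_ (by positivity)
          nlinarith [hY0 r, hY1 r]
        _ = _ := by ring
    calc _ = ∑ m ∈ range N, (if (1:ℕ).Coprime m then (1:ℝ) else 0) * gg (qL w R) (fun _ _ => 0) Y m ^ 2 := by
          simp [g1]
      _ ≤ _ := hsv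
      _ ≤ N * 1 * (3 * V) + 2 * 1 * (3 * (R:ℝ)^3) ^ 2 := by
          simp only [Nat.totient_one, Nat.cast_one, div_one]
          gcongr
      _ = _ := by ring
  have hls := ls (q := qL w R) (fun l => Lc_prime l) Lc_co Y hY0 N X ((R:ℝ)^4) hX S hS b
  have hB : 0 ≤ ∑ χ ∈ X, ‖b χ‖ ^ 2 := by positivity
  have hkey := LS_num R N hR hN (PP w) V hP hV1 hVge _ hcnt0 hcnt _ (by positivity) hcX _ hg1
  have hVp : 0 < V ^ 2 := by positivity
  have := hls.trans (mlr hkey hB)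
  rw [mul_assoc] at this
  exact le_of_mul_le_mul_left this hVp
end
section
lemma prim_ndvd {w R : ℕ} (l : Lc w R) : ¬ qL w R l ∣ primorial w := by
  rw [Nat.Prime.dvd_primorial_iff (Lc_prime l)]
  exact not_le.2 (Lc_gt l)
lemma prim_tot (w : ℕ) : ((primorial w).totient : ℝ) / (primorial w : ℕ) = 1 / PP w := by
  have h := Nat.totient_eq_mul_prod_factors (primorial w)
  have h' : ((primorial w).totient : ℝ) = (primorial w : ℕ) * ∏ p ∈ (primorial w).primeFactors, (1 - (p:ℝ)⁻¹) := by
    have := congrArg (fun x : ℚ => (x:ℝ)) h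
    push_cast at this
    exact this
  have h0 : ((primorial w : ℕ) : ℝ) ≠ 0 := by exact_mod_cast (primorial_pos w).ne'
  rw [h', mul_div_cancel_left₀ _ h0, PP, one_div, ← prod_inv_distrib]
  rw [primeFactors_primorial]
  refine prod_congr ?_ fun p _ => by simp
  first | rfl | (ext p; simp [Nat.mem_primesLE]; try omega)
variable {w R k : ℕ} (g : Finset (Lc w R) → ℝ)
lemma YY_facts (hg0 : ∀ A, 0 ≤ g A) (hg2 : ∀ A, g A ≤ 2) (Q : ℝ) (r : Lc w R → Option (Fin k)) :
    0 ≤ YY (qL w R) Q g r ∧ YY (qL w R) Q g r ≤ 2 ^ k ∧ YY (qL w R) Q g r ^ 2 ≤ ∏ j, g (AA r j) ^ 2 ∧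
      (YY (qL w R) Q g r ≠ 0 → (NN (qL w R) r : ℝ) ≤ Q) := by
  have h0 : 0 ≤ ∏ j, g (AA r j) := prod_nonneg fun j _ => hg0 _
  have h2 : ∏ j, g (AA r j) ≤ 2 ^ k := by
    refine (prod_le_prod (fun j _ => hg0 _) (fun j _ => hg2 _)).trans ?_
    simp
  rw [YY]
  split_ifs with h
  · exact ⟨h0, h2, by rw [prod_pow], fun _ => h⟩
  · exact ⟨le_rfl, by positivity, by rw [prod_pow, zero_pow two_ne_zero]; exact sq_nonneg _, fun h' => absurd rfl h'⟩
lemma Y_count (hw : 2 ≤ w) (hk : 2 * k ≤ w) (hg0 : ∀ A, 0 ≤ g A) (hg2 : ∀ A, g A ≤ 2) :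
    ∑ r : Lc w R → Option (Fin k), YY (qL w R) ((R:ℝ)^2) g r * NN (qL w R) r ≤ 3 * 2 ^ k * (R:ℝ)^6 := by
  refine (cfg_count (qL w R) Lc_two ((R:ℝ)^2) (by positivity) _ (2 ^ k) (fun r => (YY_facts g hg0 hg2 _ r).1) (fun r => (YY_facts g hg0 hg2 _ r).2.1)
    (fun r => (YY_facts g hg0 hg2 _ r).2.2.2)).trans ?_
  have := (Lc_sums w R hw k hk).1
  calc _ ≤ 2 ^ k * ((R:ℝ)^2)^3 * 3 := by gcongr
    _ = _ := by ring
lemma gg_abs (hw : 2 ≤ w) (hk : 2 * k ≤ w) (hg0 : ∀ A, 0 ≤ g A) (hg2 : ∀ A, g A ≤ 2) (c : Lc w R → Fin k → ℕ) (m : ℕ) :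
    gg (qL w R) c (YY (qL w R) ((R:ℝ)^2) g) m ^ 2 ≤ 9 * 4 ^ k * (R:ℝ) ^ 12 := by
  have h : |gg (qL w R) c (YY (qL w R) ((R:ℝ)^2) g) m| ≤ 3 * 2 ^ k * (R:ℝ)^6 := by
    refine le_trans ?_ (Y_count (R := R) g hw hk hg0 hg2)
    unfold gg
    refine (abs_sum_le_sum_abs _ _).trans (sum_le_sum fun r _ => ?_)
    have hY := (YY_facts (R := R) g hg0 hg2 ((R:ℝ)^2) r).1
    rw [abs_mul, abs_of_nonneg hY]
    refine mll ?_ hY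
    rw [abs_prod]
    refine (prod_le_one (fun _ _ => abs_nonneg _) (fun l _ => ph_abs (Lc_two l) _ _ _)).trans ?_
    have : 1 ≤ NN (qL w R) r := Nat.one_le_iff_ne_zero.2 (prod_ne_zero_iff.2 fun l _ => by
      split_ifs
      · simp
      · exact (Lc_prime l).ne_zero)
    exact_mod_cast this
  have h2 := pow_le_pow_left₀ (abs_nonneg _) h 2
  rw [sq_abs] at h2
  refine h2.trans (le_of_eq ?_)
  rw [show (4:ℝ) = 2 ^ 2 by norm_num, ← pow_mul]; ring
lemma S_up (hw : 2 ≤ w) (hk : 2 * k ≤ w) (hg0 : ∀ A, 0 ≤ g A) (hg2 : ∀ A, g A ≤ 2) (hG : 1 ≤ G2 (qL w R) g)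
    (p : ℕ) (hp : ∀ l, ¬ qL w R l ∣ p) (y : ℕ) (hy : (R:ℝ)^12 * (3 * (primorial w : ℕ) * 4 ^ k * PP w) ≤ y) :
    ∑ m ∈ range (2 * y), (if (primorial w).Coprime m then (1:ℝ) else 0) * gg (qL w R) (fun _ (j : Fin k) => j * primorial w * p) (YY (qL w R) ((R:ℝ)^2) g) m ^ 2
      ≤ 12 * y / PP w * G2 (qL w R) g ^ k := by
  have hP := PP_ge_one w
  have hsv := sieve_upper (qL w R) (c := fun _ (j : Fin k) => j * primorial w * p) Lc_two Lc_co (fun l i j h => by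
      haveI : Fact (qL w R l).Prime := ⟨Lc_prime l⟩
      have h1 : ((i * primorial w * p : ℕ) : ZMod (qL w R l)) = ((j * primorial w * p : ℕ) : ZMod (qL w R l)) :=
        (ZMod.natCast_eq_natCast_iff _ _ _).2 h
      push_cast at h1
      have hp0 : (p : ZMod (qL w R l)) ≠ 0 := by rw [Ne, ZMod.natCast_eq_zero_iff]; exact hp l
      have hW0 : ((primorial w : ℕ) : ZMod (qL w R l)) ≠ 0 := by rw [Ne, ZMod.natCast_eq_zero_iff]; exact prim_ndvd l
      exact fin_cast_inj (by have := Lc_gt l; omega) _ _ (mul_right_cancel₀ hW0 (mul_right_cancel₀ hp0 h1)))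
    (primorial w) (primorial_pos w) (fun l => ((Nat.Prime.coprime_iff_not_dvd (Lc_prime l)).2 (prim_ndvd l)).symm)
    (YY (qL w R) ((R:ℝ)^2) g) (fun r => (YY_facts g hg0 hg2 _ r).1) (2 * y)
  refine hsv.trans ?_
  rw [prim_tot]
  have h1 : ∑ r : Lc w R → Option (Fin k), (∏ l, cc k (qL w R l) (r l)) * YY (qL w R) ((R:ℝ)^2) g r ^ 2 ≤ 3 * G2 (qL w R) g ^ k := by
    have e1 : ∀ r : Lc w R → Option (Fin k), (∏ l, cc k (qL w R l) (r l)) * YY (qL w R) ((R:ℝ)^2) g r ^ 2 ≤ 3 * ∏ j, (g (AA r j) ^ 2 * mm (qL w R) (AA r j)) := by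
      intro r
      have hm : 0 ≤ ∏ j, mm (qL w R) (AA r j) := prod_nonneg fun j _ => mm_nonneg _ Lc_two _
      have hc := (cc_prod_le (qL w R) Lc_two r).trans (mlr (Lc_sums w R hw k hk).2 hm)
      calc _ ≤ (3 * ∏ j, mm (qL w R) (AA r j)) * ∏ j, g (AA r j) ^ 2 :=
            mul_le_mul hc (YY_facts g hg0 hg2 _ r).2.2.1 (sq_nonneg _) (by positivity)
        _ = _ := by rw [pmd]; ring
    refine (sum_le_sum fun r _ => e1 r).trans ?_
    rw [← mul_sum]
    refine mll ?_ (by norm_num)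
    refine (cfg_sum_le (fun _ A => g A ^ 2 * mm (qL w R) A) (fun _ A => mul_nonneg (sq_nonneg _) (mm_nonneg _ Lc_two _))).trans ?_
    simp [G2]
  have h2 := Y_count (R := R) g hw hk hg0 hg2
  have h20 : 0 ≤ ∑ r : Lc w R → Option (Fin k), YY (qL w R) ((R:ℝ)^2) g r * NN (qL w R) r :=
    sum_nonneg fun r _ => mul_nonneg (YY_facts g hg0 hg2 _ r).1 (by positivity)
  have h3 : 2 * ((primorial w : ℕ):ℝ) * (3 * 2 ^ k * (R:ℝ)^6) ^ 2 ≤ 6 * y / PP w * G2 (qL w R) g ^ k := by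
    have e : 2 * ((primorial w : ℕ):ℝ) * (3 * 2 ^ k * (R:ℝ)^6) ^ 2 = 6 * ((R:ℝ)^12 * (3 * (primorial w : ℕ) * 4 ^ k * PP w)) / PP w := by
      rw [show (4:ℝ) = 2 ^ 2 by norm_num, ← pow_mul]; field_simp; ring
    rw [e]
    have : (1:ℝ) ≤ G2 (qL w R) g ^ k := one_le_pow₀ hG
    calc _ ≤ 6 * y / PP w * 1 := by rw [mul_one]; gcongr
      _ ≤ _ := by gcongr
  calc _ ≤ ((2 * y : ℕ):ℝ) * (1 / PP w) * (3 * G2 (qL w R) g ^ k) + 2 * ((primorial w : ℕ):ℝ) * (3 * 2 ^ k * (R:ℝ)^6) ^ 2 := by gcongr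
    _ ≤ ((2 * y : ℕ):ℝ) * (1 / PP w) * (3 * G2 (qL w R) g ^ k) + 6 * y / PP w * G2 (qL w R) g ^ k := by gcongr
    _ = _ := by push_cast; ring
end
section
noncomputable abbrev Tup (w R M : ℕ) (lam : ℝ) : ℝ := G1 (qL w R) (gW lam M) ^ 2 * G2 (qL w R) (gW lam M) ^ (2 ^ M - 1)
lemma Lc_tau_le {w R : ℕ} (hw : 2 ≤ w) (l : Lc w R) : tau (qL w R l) ≤ 1 / w := by
  have h : (w:ℝ) + 1 ≤ qL w R l := by exact_mod_cast Lc_gt l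
  have h2 : (2:ℝ) ≤ w := by exact_mod_cast hw
  exact one_div_le_one_div_of_le (by linarith) (by linarith)
lemma T_half (w R M : ℕ) (lam : ℝ) (hw : 16 * ((2^M)^2 + 2^M) ≤ w) (hR : 2 ≤ R)
    (hlam : lam = log R / (32 * CM * 2^M * (M+1))) (hlw : log w ≤ lam) (i : Fin (2^M)) :
    Tup w R M lam / 2 ≤ EU (qL w R) (fun n => gU (qL w R) i (fun l => cU (primorial w) i (qL w R l)) (ZZ (qL w R) i (YY (qL w R) ((R:ℝ)^2) (gW lam M))) n ^ 2) := by
  have hk1 : 1 ≤ 2^M := Nat.one_le_two_pow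
  have hkw : 2^M ≤ w := by nlinarith
  have hw2 : 2 ≤ w := by nlinarith
  have hw' : (16:ℝ) * ((2^M)^2 + 2^M) ≤ w := by exact_mod_cast hw
  have hw2' : (2:ℝ) ≤ w := by exact_mod_cast hw2
  have hR' : (2:ℝ) ≤ R := by exact_mod_cast hR
  have hlR : 0 < log R := Real.log_pos (by linarith)
  have hC : 0 < CM := by positivity
  have hC1 : 1 ≤ CM := by have := Real.add_one_le_exp (6:ℝ); unfold CM; linarith
  have hlam0 : 0 < lam := by rw [hlam]; positivity
  have hlM : lam * 2 ^ M ≤ log R := by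
    rw [hlam, div_mul_eq_mul_div, div_le_iff₀ (by positivity)]
    have : (2:ℝ)^M ≤ 32 * CM * 2^M * (M+1) := by
      have : (1:ℝ) ≤ 32 * CM * (M+1) := by nlinarith [hC1, (Nat.cast_nonneg M : (0:ℝ) ≤ M)]
      calc (2:ℝ)^M = 2^M * 1 := by ring
        _ ≤ 2^M * (32 * CM * (M+1)) := by gcongr
        _ = _ := by ring
    gcongr
  have hP := PP_ge_one w
  set δ := 8 * CM * lam * (M+1) / log R with hδ
  have hkδ : (2:ℝ)^M * δ = 1/4 := by rw [hδ, hlam]; field_simp; norm_num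
  have hG2 := G2_ge w R lam M (by omega) hlam0.le hlM
  have hlog : ∑ A, log (NA (qL w R) A) * (gW lam M A ^ 2 * mm (qL w R) A) ≤ δ * log R * G2 (qL w R) (gW lam M) := by
    refine (logmom w R lam M hw2 hlw).trans ?_
    calc _ = (8 * CM * lam * (M+1)) * (lam / (2 * PP w)) := by field_simp; norm_num
      _ = δ * log R * (lam / (2 * PP w)) := by rw [hδ]; field_simp
      _ ≤ _ := by gcongr
  have hl := T_lower (qL w R) Lc_two Lc_co i (fun l => cU (primorial w) i (qL w R l))
    (fun l j j' _ _ h => cU_inj (Lc_prime l) (by have := Lc_gt l; omega) _ (prim_ndvd l) i j j' h)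
    (fun l j h => cU_ne (Lc_prime l) (by have := Lc_gt l; omega) _ (prim_ndvd l) i j h)
    (fun l => by
      have := Lc_tau_le hw2 l
      have hkw' : (((2^M:ℕ)):ℝ) ≤ w := by exact_mod_cast hkw
      calc _ ≤ ((2^M:ℕ):ℝ) * (1 / w) := by gcongr
        _ ≤ 1 := by rw [mul_one_div, div_le_one (by linarith)]; exact hkw')
    R δ (by linarith) (by positivity) (gW lam M) (gW_nonneg lam M) (gW_anti lam M)
    (fun A hA => gW_supp lam R (by linarith) hlam0.le M hlM A hA) hlog
  refine le_trans ?_ hl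
  rw [Tup, mul_div_assoc]
  refine mll ?_ (sq_nonneg _)
  rw [div_eq_mul_one_div]
  have hG20 : 0 ≤ G2 (qL w R) (gW lam M) := le_trans (by positivity) hG2
  refine mll ?_ (by positivity)
  have ht := Lc_tau_sq w R hw2
  push_cast
  have h4 : (2 * ((2:ℝ)^M)^2 + 2 * 2^M) * ∑ l : Lc w R, tau (qL w R l) ^ 2 ≤ 1/4 := by
    calc _ ≤ (2 * ((2:ℝ)^M)^2 + 2 * 2^M) * (2 / w) := by gcongr
      _ ≤ _ := by rw [mul_div_assoc', div_le_iff₀ (by linarith)]; linarith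
  linarith
lemma bad_i (w R M : ℕ) (lam : ℝ) (hw : 16 * ((2^M)^2 + 2^M) ≤ w) (hR : 2 ≤ R)
    (hlam : lam = log R / (32 * CM * 2^M * (M+1))) (hlw : log w ≤ lam) (i : Fin (2^M))
    (P S : Finset ℕ) (NP NS : ℕ) (hNP : R ^ 100 ≤ NP) (hNS : R ^ 100 ≤ NS)
    (hP : ∀ n ∈ P, n < NP ∧ ∀ l, ¬ qL w R l ∣ n) (hS : ∀ n ∈ S, n < NS ∧ ∀ l, ¬ qL w R l ∣ n)
    (ε : ℝ) (hε : 0 < ε) (T : ℝ) (hT : T = Tup w R M lam) (hT0 : 0 < T) :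
    (#(S.filter fun t => ∑ p ∈ P, gg (qL w R) (fun _ (j : Fin (2^M)) => j * primorial w * p) (YY (qL w R) ((R:ℝ)^2) (gW lam M)) (t + i * primorial w * p) ^ 2 < #P * T / 4) : ℝ) * #P
      ≤ 16 * (60 * PP w * NS / log R) * (60 * PP w * NP / log R) * (ε + (1 + 1/ε) * (2^M / w)) ^ 2 := by
  have hk1 : 1 ≤ 2^M := Nat.one_le_two_pow
  have hw2 : 2 ≤ w := by nlinarith
  have hkw : 2^M ≤ w := by nlinarith
  have hR' : (2:ℝ) ≤ R := by exact_mod_cast hR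
  have hlR : 0 < log R := Real.log_pos (by linarith)
  have hPP := PP_ge_one w
  haveI : ∀ l, NeZero (qL w R l) := fun l => ⟨(Lc_prime l).ne_zero⟩
  classical
  have hux : ∀ p t : ℕ, ∃ u : ℕ, (∀ l, ¬ qL w R l ∣ t) → ∀ l, u * t ≡ p [MOD qL w R l] := by
    intro p t
    by_cases ht : ∀ l, ¬ qL w R l ∣ t
    · obtain ⟨u, hu⟩ := exists_u (qL w R) (fun l => Lc_prime l) Lc_co t p ht
      exact ⟨u, fun _ => hu⟩
    · exact ⟨0, fun h => absurd h ht⟩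
  choose u hu using hux
  have hlink : ∀ t ∈ S, ∀ p, gg (qL w R) (fun _ (j : Fin (2^M)) => j * primorial w * p) (YY (qL w R) ((R:ℝ)^2) (gW lam M)) (t + i * primorial w * p)
      = gU (qL w R) i (fun l => cU (primorial w) i (qL w R l)) (ZZ (qL w R) i (YY (qL w R) ((R:ℝ)^2) (gW lam M))) (u p t) := fun t ht p =>
    link (qL w R) (fun l => Lc_prime l) (fun l => by have := Lc_gt l; omega) (primorial w) prim_ndvd i _ t p (u p t) (hS t ht).2 (hu p t (hS t ht).2)
  have hEU := T_half w R M lam hw hR hlam hlw i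
  rw [← hT] at hEU
  set c := fun l => cU (primorial w) i (qL w R l) with hc
  set Z := ZZ (qL w R) i (YY (qL w R) ((R:ℝ)^2) (gW lam M)) with hZ
  set b := ε + (1 + 1/ε) * ((2:ℝ)^M / w) with hb
  have hb0 : 0 ≤ b := by positivity
  set E := EU (qL w R) (fun n => gU (qL w R) i c Z n ^ 2) with hE
  have hvar := var_bound (qL w R) (fun l => Lc_prime l) Lc_co i c Z (univ.filter fun χ : Tp (qL w R) => (cndt χ : ℝ) ≤ (R:ℝ)^4)
    (fun χ h => by
      rw [mem_filter]
      refine ⟨mem_univ _, (BB_supp (qL w R) (fun l => Lc_prime l) i c Z ((R:ℝ)^2) (fun s hs => ZZ_supp (qL w R) Lc_two i _ _ s hs) χ h).trans (le_of_eq (by ring))⟩)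
    (b * T) (by positivity)
    (fun χ hχ => by
      obtain ⟨l0, hl0⟩ := Function.ne_iff.1 hχ
      refine (BB_bound (qL w R) (fun l => Lc_prime l) Lc_co i c
        (fun l j j' _ _ h => cU_inj (Lc_prime l) (by have := Lc_gt l; omega) _ (prim_ndvd l) i j j' h)
        (fun l j h => cU_ne (Lc_prime l) (by have := Lc_gt l; omega) _ (prim_ndvd l) i j h)
        ((R:ℝ)^2) (gW lam M) (gW_nonneg lam M) (gW_anti lam M) χ l0 hl0 ε hε).trans ?_
      rw [← Tup, ← hT]
      refine mlr ?_ hT0.le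
      rw [hb]
      have := Lc_tau_le hw2 l0
      push_cast
      have h2 : (2:ℝ)^M * tau (qL w R l0) ≤ 2^M / w := by
        rw [div_eq_mul_one_div]; gcongr
      gcongr)
    P S (fun n h => (hP n h).2) (fun n h => (hS n h).2) u (fun p _ t ht => hu p t (hS t ht).2)
    (60 * PP w * NP / log R) (60 * PP w * NS / log R) (by positivity) (by positivity)
    (LSc w R NP hw2 hR hNP _ (fun χ h => (mem_filter.1 h).2) P hP)
    (LSc w R NS hw2 hR hNS _ (fun χ h => (mem_filter.1 h).2) S hS)
  rw [← hE] at hvar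
  set B := S.filter fun t => ∑ p ∈ P, gg (qL w R) (fun _ (j : Fin (2^M)) => j * primorial w * p) (YY (qL w R) ((R:ℝ)^2) (gW lam M)) (t + i * primorial w * p) ^ 2 < #P * T / 4 with hB
  have h1 : (#B : ℝ) * (#P * T / 4) ^ 2 ≤ (60 * PP w * NS / log R) * ((b * T) ^ 2 * ((60 * PP w * NP / log R) * #P)) := by
    refine le_trans ?_ hvar
    refine le_trans ?_ (sum_le_sum_of_subset_of_nonneg (show B ⊆ S from filter_subset _ S) fun _ _ _ => sq_nonneg _)
    rw [← nsmul_eq_mul]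
    refine card_nsmul_le_sum _ _ _ fun t ht => ?_
    obtain ⟨htS, hlt⟩ := mem_filter.1 ht
    rw [sum_congr rfl fun p _ => by rw [hlink t htS p]] at hlt
    have hPE : (#P:ℝ) * (T / 2) ≤ #P * E := by gcongr
    have h0 : 0 ≤ #P * T / 4 := by positivity
    nlinarith
  rcases eq_or_lt_of_le (Nat.zero_le #P) with h0 | h0
  · rw [← h0]; simp only [Nat.cast_zero, mul_zero]; positivity
  · have h0' : (0:ℝ) < #P := by exact_mod_cast h0
    have hpos : 0 < #P * T ^ 2 := by positivity
    refine le_of_mul_le_mul_right ?_ hpos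
    nlinarith
end
section
lemma ratio_num (M : ℕ) (p lam C LR x y cP G1v G2v : ℝ) (k : ℕ) (hk : 1 ≤ k) (hp : 1 ≤ p) (hC : 0 < C) (hLR : 0 < LR) (hx : 0 < x) (hy : 0 < y)
    (hlam : lam = LR / (32 * C * k * (M+1))) (hG1 : lam * (M + 1) / (2 * p) ≤ G1v) (hG2 : G2v ≤ 8 * C * lam / p) (hG20 : 0 < G2v)
    (hcP : x / (200 * LR) ≤ cP) :
    (M + 1) / (9830400 * C ^ 2) * (x / y) ≤ k * (cP * (G1v ^ 2 * G2v ^ (k - 1)) / 4) / (12 * y / p * G2v ^ k) := by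
  have hk' : (0:ℝ) < k := by exact_mod_cast hk
  have hl : 0 < lam := by rw [hlam]; positivity
  have e : G2v ^ k = G2v ^ (k - 1) * G2v := by rw [← pow_succ]; congr 1; omega
  have h1 : (k:ℝ) * (cP * (G1v ^ 2 * G2v ^ (k - 1)) / 4) / (12 * y / p * G2v ^ k) = k * cP * p * (G1v ^ 2 / G2v) / (48 * y) := by
    rw [e]; field_simp; ring
  have h2 : lam * (M+1)^2 / (32 * C * p) ≤ G1v ^ 2 / G2v := by
    calc _ = (lam * (M + 1) / (2 * p)) ^ 2 / (8 * C * lam / p) := by field_simp; norm_num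
      _ ≤ _ := by gcongr
  rw [h1]
  have hcP0 : 0 ≤ cP := le_trans (by positivity) hcP
  calc _ = k * (x / (200 * LR)) * p * (lam * (M+1)^2 / (32 * C * p)) / (48 * y) := by rw [hlam]; field_simp; norm_num
    _ ≤ _ := by gcongr
lemma bad_num (p LR Lx x y cP b D k η B : ℝ) (hp : 1 ≤ p) (hLR : 0 < LR) (hx : 0 < x) (hy : 0 < y) (hD : 0 ≤ D) (hk : 0 ≤ k)
    (hL : Lx ≤ 200 * LR) (hLx : 0 < Lx) (hcP : x / Lx ≤ cP) (NS NP : ℝ) (hNS0 : 0 ≤ NS) (hNP0 : 0 ≤ NP) (hNS : NS ≤ 2 * y) (hNP : NP ≤ 2 * D * x)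
    (hB : B * cP ≤ 16 * (60 * p * NS / LR) * (60 * p * NP / LR) * b ^ 2) (hη : k * (9216000000 * p ^ 2 * D * b ^ 2) ≤ η) : k * B ≤ η * (y / Lx) := by
  have hcP0 : 0 < cP := lt_of_lt_of_le (by positivity) hcP
  have h1 : B ≤ 9216000000 * p ^ 2 * D * b ^ 2 * (y / Lx) := by
    refine le_of_mul_le_mul_right ?_ hcP0
    calc B * cP ≤ 16 * (60 * p * NS / LR) * (60 * p * NP / LR) * b ^ 2 := hB
      _ ≤ 16 * (60 * p * (2 * y) / LR) * (60 * p * (2 * D * x) / LR) * b ^ 2 := by gcongr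
      _ = 230400 * p ^ 2 * D * b ^ 2 * y * x * (1 / LR ^ 2) := by field_simp; ring
      _ ≤ 230400 * p ^ 2 * D * b ^ 2 * y * x * (40000 / Lx ^ 2) := by
          have : 1 / LR ^ 2 ≤ 40000 / Lx ^ 2 := by
            rw [ddi (by positivity) (by positivity)]; nlinarith
          gcongr
      _ = 9216000000 * p ^ 2 * D * b ^ 2 * (y / Lx) * (x / Lx) := by field_simp; ring
      _ ≤ _ := by gcongr
  calc k * B ≤ k * (9216000000 * p ^ 2 * D * b ^ 2 * (y / Lx)) := by gcongr
    _ = k * (9216000000 * p ^ 2 * D * b ^ 2) * (y / Lx) := by ring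
    _ ≤ _ := by gcongr
set_option maxHeartbeats 1000000 in
lemma NT_core (M w D0 x R y : ℕ) (η lam : ℝ) (hw : 16 * ((2^M)^2 + 2^M) ≤ w) (hR : 2 ≤ R) (hx : R ^ 100 ≤ x)
    (hLx : log x ≤ 200 * log R)
    (hlam : lam = log R / (32 * CM * 2^M * (M+1))) (hlw : log w ≤ lam) (h2 : 2 * PP w ≤ lam)
    (hR2 : 3 * (primorial w : ℕ) * 4 ^ (2^M) * PP w ≤ R) (hwR : w ≤ R) (hD : 1 ≤ D0) (hy : (2^M * primorial w * D0 + 1) * x ≤ y)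
    (ε : ℝ) (hε : 0 < ε) (hη : (2:ℝ)^M * (9216000000 * (PP w)^2 * D0 * (ε + (1 + 1/ε) * (2^M / w)) ^ 2) ≤ η)
    (P S : Finset ℕ) (hP : ∀ p ∈ P, p.Prime ∧ x < p ∧ p ≤ D0 * x) (hS : ∀ t ∈ S, t.Prime ∧ x < t ∧ t ≤ y) (hcP : x / log x ≤ #P) :
    ∃ wt : ℕ → ℕ → ℝ, (∀ p m, 0 ≤ wt p m) ∧ (∀ p ∈ P, ∑ m ∈ range (2 * y), wt p m ≤ 1) ∧ (∀ p m, wt p m ≤ 1 / √x) ∧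
      (#(S.filter fun t => ∑ p ∈ P, ∑ i : Fin (2^M), wt p (t + i * primorial w * p) < (M + 1) / (9830400 * CM ^ 2) * (x / y)) : ℝ) ≤ η * (y / log x) := by
  have hk1 : 1 ≤ 2^M := Nat.one_le_two_pow
  have hw2 : 2 ≤ w := by nlinarith
  have hkw : 2 * 2^M ≤ w := by nlinarith
  have hR' : (2:ℝ) ≤ R := by exact_mod_cast hR
  have hlR : 0 < log R := Real.log_pos (by linarith)
  have hPP := PP_ge_one w
  have hC1 : 1 ≤ CM := by have := Real.add_one_le_exp (6:ℝ); unfold CM; linarith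
  have hRx : R ≤ x := le_trans (Nat.le_self_pow (by norm_num) R) hx
  have hx' : (R:ℝ)^100 ≤ x := by exact_mod_cast hx
  have hx0 : (2:ℝ) ≤ x := hR'.trans (by exact_mod_cast hRx)
  have hxy : x ≤ y := le_trans (Nat.le_mul_of_pos_left _ (Nat.succ_pos _)) hy
  have hxy' : (x:ℝ) ≤ y := by exact_mod_cast hxy
  have hlx : 0 < log x := Real.log_pos (by linarith)
  have hlam0 : 0 < lam := by rw [hlam]; positivity
  have hlM : lam * 2 ^ M ≤ log R := by
    rw [hlam, div_mul_eq_mul_div, div_le_iff₀ (by positivity)]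
    have : (2:ℝ)^M ≤ 32 * CM * 2^M * (M+1) := by
      have : (1:ℝ) ≤ 32 * CM * (M+1) := by nlinarith [hC1, (Nat.cast_nonneg M : (0:ℝ) ≤ M)]
      calc (2:ℝ)^M = 2^M * 1 := by ring
        _ ≤ 2^M * (32 * CM * (M+1)) := by gcongr
        _ = _ := by ring
    gcongr
  have hG2 := G2_ge w R lam M (by omega) hlam0.le hlM
  have hG1 := G1_ge w R lam M (by omega) hlam0.le hlM
  have hG2u := G2_le w R lam M hw2 hlw
  have hG2one : 1 ≤ G2 (qL w R) (gW lam M) := by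
    refine le_trans ?_ hG2
    rw [le_div_iff₀ (by positivity)]; linarith
  have hG1pos : 0 < G1 (qL w R) (gW lam M) := lt_of_lt_of_le (by positivity) hG1
  have hndv : ∀ n, n.Prime → x < n → ∀ l, ¬ qL w R l ∣ n := by
    intro n hn hxn l hl
    have h3 := (Nat.prime_dvd_prime_iff_eq (Lc_prime l) hn).1 hl
    have := Lc_le l
    omega
  set A : ℝ := 12 * y / PP w * G2 (qL w R) (gW lam M) ^ (2^M) with hA
  have hy0 : (0:ℝ) < y := by linarith
  have hAy : 12 * y / PP w ≤ A := by
    rw [hA]; exact le_mul_of_one_le_right (by positivity) (one_le_pow₀ hG2one)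
  have hA0 : 0 < A := lt_of_lt_of_le (by positivity) hAy
  set T := Tup w R M lam with hT
  have hT0 : 0 < T := by rw [hT, Tup]; positivity
  set F : ℕ → ℕ → ℝ := fun p m => gg (qL w R) (fun _ (j : Fin (2^M)) => j * primorial w * p) (YY (qL w R) ((R:ℝ)^2) (gW lam M)) m ^ 2 with hF
  refine ⟨fun p m => (if (primorial w).Coprime m then (1:ℝ) else 0) * F p m / A, ?_, ?_, ?_, ?_⟩
  · intro p m
    refine div_nonneg (mul_nonneg (by split_ifs <;> norm_num) (sq_nonneg _)) hA0.le
  · intro p hp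
    rw [← sum_div, div_le_one hA0]
    refine S_up (gW lam M) hw2 hkw (gW_nonneg lam M) (gW_le lam M) hG2one p (hndv p (hP p hp).1 (hP p hp).2.1) y ?_
    calc _ ≤ (R:ℝ)^12 * R := by gcongr
      _ = (R:ℝ)^13 := by ring
      _ ≤ (R:ℝ)^100 := pow_le_pow_right₀ (by linarith) (by norm_num)
      _ ≤ y := by linarith
  · intro p m
    have h1 : F p m ≤ 9 * 4 ^ (2^M) * (R:ℝ) ^ 12 := gg_abs (gW lam M) hw2 hkw (gW_nonneg lam M) (gW_le lam M) _ m
    have h3 : (if (primorial w).Coprime m then (1:ℝ) else 0) * F p m ≤ F p m := by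
      have : 0 ≤ F p m := sq_nonneg _
      split_ifs <;> simp [this]
    have hW1 : (1:ℝ) ≤ (primorial w : ℕ) := by exact_mod_cast primorial_pos w
    have h5 : 4 ^ (2^M) * PP w ≤ R := by
      refine le_trans ?_ hR2
      rw [mul_assoc (3 * _)]
      exact le_mul_of_one_le_left (by positivity) (by linarith)
    have hsq : (R:ℝ) ^ 50 ≤ √x := by
      rw [← Real.sqrt_sq (by positivity : (0:ℝ) ≤ (R:ℝ)^50)]
      refine Real.sqrt_le_sqrt ?_
      rw [← pow_mul]; exact hx'
    have hs : √(x:ℝ) * √x = x := Real.mul_self_sqrt (by linarith)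
    have hspos : 0 < √(x:ℝ) := Real.sqrt_pos.2 (by linarith)
    rw [ddi hA0 hspos]
    have hAy' : 12 * x / PP w ≤ A := le_trans (by gcongr) hAy
    calc _ ≤ 9 * 4 ^ (2^M) * (R:ℝ) ^ 12 * √x := mlr (h3.trans h1) hspos.le
      _ = 9 * (4 ^ (2^M) * PP w) * (R:ℝ) ^ 12 * √x / PP w := by field_simp
      _ ≤ 12 * R * (R:ℝ) ^ 12 * √x / PP w := by gcongr; norm_num
      _ = 12 * (R:ℝ) ^ 13 * √x / PP w := by ring
      _ ≤ 12 * √x * √x / PP w := by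
          have : (R:ℝ)^13 ≤ √x := le_trans (pow_le_pow_right₀ (by linarith) (by norm_num)) hsq
          gcongr
      _ = 12 * x / PP w := by rw [mul_assoc, hs]
      _ ≤ 1 * A := by rw [one_mul]; exact hAy'
  · set B : Fin (2^M) → Finset ℕ := fun i => S.filter fun t => ∑ p ∈ P, F p (t + i * primorial w * p) < #P * T / 4 with hB
    have hBi : ∀ i, (2:ℝ)^M * #(B i) ≤ η * (y / log x) := by
      intro i
      have hb := bad_i w R M lam hw hR hlam hlw i P S (D0 * x + 1) (y + 1) (by nlinarith) (by omega)
        (fun n hn => ⟨by have := (hP n hn).2.2; omega, hndv n (hP n hn).1 (hP n hn).2.1⟩)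
        (fun n hn => ⟨by have := (hS n hn).2.2; omega, hndv n (hS n hn).1 (hS n hn).2.1⟩) ε hε T hT hT0
      refine bad_num (PP w) (log R) (log x) x y #P _ D0 (2^M) η _ hPP hlR (by linarith) hy0 (by positivity) (by positivity)
        hLx hlx hcP _ _ (by positivity) (by positivity) ?_ ?_ hb hη
      · push_cast; linarith
      · push_cast
        have : (1:ℝ) ≤ D0 * x := by
          have : (1:ℝ) ≤ D0 := by exact_mod_cast hD
          nlinarith
        linarith
    have hsub : (S.filter fun t => ∑ p ∈ P, ∑ i : Fin (2^M), (if (primorial w).Coprime (t + i * primorial w * p) then (1:ℝ) else 0) * F p (t + i * primorial w * p) / A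
        < (M + 1) / (9830400 * CM ^ 2) * (x / y)) ⊆ univ.biUnion B := by
      intro t ht
      obtain ⟨htS, hlt⟩ := mem_filter.1 ht
      by_contra hn
      simp only [mem_biUnion, mem_univ, true_and, not_exists] at hn
      have hcop : ∀ i : ℕ, ∀ p : ℕ, (primorial w).Coprime (t + i * primorial w * p) := by
        intro i p
        have h1 : (primorial w).Coprime t := by
          refine ((Nat.Prime.coprime_iff_not_dvd (hS t htS).1).2 ?_).symm
          rw [Nat.Prime.dvd_primorial_iff (hS t htS).1]
          have := (hS t htS).2.1
          omega
        rw [show t + i * primorial w * p = t + primorial w * (i * p) by ring]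
        exact (Nat.coprime_add_mul_left_right _ _ _).2 h1
      rw [sum_congr rfl fun p _ => sum_congr rfl fun (i : Fin (2^M)) _ => by rw [if_pos (hcop i p), one_mul]] at hlt
      rw [Finset.sum_comm] at hlt
      have hge : ∀ i : Fin (2^M), (#P * T / 4) / A ≤ ∑ p ∈ P, F p (t + i * primorial w * p) / A := by
        intro i
        rw [← sum_div]
        have := hn i
        rw [hB] at this
        simp only [mem_filter, not_and, not_lt] at this
        have h4 := this htS
        gcongr
      have h5 := sum_le_sum fun (i : Fin (2^M)) (_ : i ∈ univ) => hge i
      rw [sum_const, card_univ, Fintype.card_fin, nsmul_eq_mul] at h5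
      have h6 := ratio_num M (PP w) lam CM (log R) x y #P _ _ (2^M) hk1 hPP (by linarith) hlR (by linarith) hy0 (by rw [hlam]; push_cast; rfl) hG1 hG2u (by linarith)
        (le_trans (by gcongr) hcP)
      rw [mul_div_assoc] at h6
      have h7 := h6.trans h5
      linarith
    have hcard : (#(S.filter fun t => ∑ p ∈ P, ∑ i : Fin (2^M), (if (primorial w).Coprime (t + i * primorial w * p) then (1:ℝ) else 0) * F p (t + i * primorial w * p) / A
        < (M + 1) / (9830400 * CM ^ 2) * (x / y)) : ℝ) ≤ ∑ i : Fin (2^M), (#(B i) : ℝ) := by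
      exact_mod_cast (card_le_card hsub).trans card_biUnion_le
    refine hcard.trans ?_
    have hk0 : (0:ℝ) < 2^M := by positivity
    calc ∑ i : Fin (2^M), (#(B i) : ℝ) ≤ ∑ i : Fin (2^M), (η * (y / log x)) / 2^M := by
          refine sum_le_sum fun i _ => ?_
          rw [le_div_iff₀ hk0, mul_comm]; exact hBi i
      _ = _ := by rw [sum_const, card_univ, Fintype.card_fin, nsmul_eq_mul]; push_cast; field_simp
end
section
lemma exists_w (k D η : ℝ) (hk : 1 ≤ k) (hD : 0 ≤ D) (hη : 0 < η) (w0 : ℕ) : ∃ w : ℕ, w0 ≤ w ∧ 2 ≤ w ∧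
    k * (9216000000 * (PP w)^2 * D * (1 / √w + (1 + 1/(1 / √w)) * (k / w)) ^ 2) ≤ η := by
  set C := k * (9216000000 * CM ^ 2 * D * (9 * k ^ 2)) with hC
  have hC0 : 0 ≤ C := by positivity
  have h := (Real.isLittleO_pow_log_id_atTop (n := 2)).def (show 0 < η / (C + 1) by positivity)
  obtain ⟨w, hw⟩ := ((tendsto_natCast_atTop_atTop.eventually h).and ((eventually_ge_atTop w0).and (eventually_ge_atTop 2))).exists
  obtain ⟨h1, h2, h3⟩ := hw
  refine ⟨w, h2, h3, ?_⟩
  have hw : (2:ℝ) ≤ w := by exact_mod_cast h3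
  have hs : √(w:ℝ) * √w = w := Real.mul_self_sqrt (by linarith)
  have hs1 : 1 ≤ √(w:ℝ) := Real.one_le_sqrt.2 (by linarith)
  have hm := mertens_upper w h3
  have hP := PP_ge_one w
  have hl : 0 ≤ log w := Real.log_nonneg (by linarith)
  simp only [Real.norm_eq_abs, id] at h1
  rw [abs_of_nonneg (by positivity), abs_of_nonneg (by positivity)] at h1
  have hb : 1 / √(w:ℝ) + (1 + 1/(1 / √(w:ℝ))) * (k / w) ≤ 3 * k / √w := by
    rw [one_div_one_div]
    have e : (1 + √(w:ℝ)) * (k / w) ≤ 2 * k / √w := by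
      rw [mul_div_assoc', ddi (by linarith) (by linarith)]
      calc _ ≤ (√(w:ℝ) + √w) * k * √w := by gcongr
        _ = 2 * k * (√w * √w) := by ring
        _ = _ := by rw [hs]
    have : 1 / √(w:ℝ) ≤ k / √w := by gcongr
    calc _ ≤ k / √w + 2 * k / √w := by linarith
      _ = _ := by ring
  calc _ ≤ k * (9216000000 * (CM * log w)^2 * D * (3 * k / √w) ^ 2) := by gcongr
    _ = C * log w ^ 2 / (√w * √w) := by rw [hC]; field_simp; ring
    _ = C * log w ^ 2 / w := by rw [hs]
    _ ≤ C * (η / (C + 1) * w) / w := by gcongr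
    _ = C / (C + 1) * η := by field_simp
    _ ≤ 1 * η := by
      gcongr
      rw [div_le_one (by positivity)]; linarith
    _ = η := one_mul _
lemma exists_R (R0 x : ℕ) (hR0 : 2 ≤ R0) (hx : R0 ^ 100 ≤ x) : ∃ R, R0 ≤ R ∧ R ^ 100 ≤ x ∧ log x ≤ 200 * log R := by
  set R := Nat.findGreatest (fun r => r ^ 100 ≤ x) x with hR
  have hle : R0 ≤ x := le_trans (Nat.le_self_pow (by norm_num) R0) hx
  have h1 : R0 ≤ R := Nat.le_findGreatest hle hx
  have h2 : R ^ 100 ≤ x := Nat.findGreatest_spec (P := fun r => r ^ 100 ≤ x) hle hx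
  refine ⟨R, h1, h2, ?_⟩
  have h3 : x < (R + 1) ^ 100 := by
    by_contra h
    push Not at h
    have h4 : R + 1 ≤ x := le_trans (Nat.le_self_pow (by norm_num) _) h
    have := Nat.le_findGreatest (P := fun r => r ^ 100 ≤ x) h4 h
    rw [← hR] at this
    omega
  have h5 : R + 1 ≤ R ^ 2 := by nlinarith
  have h6 : x ≤ R ^ 200 := by
    calc x ≤ (R + 1) ^ 100 := h3.le
      _ ≤ (R ^ 2) ^ 100 := Nat.pow_le_pow_left h5 _
      _ = R ^ 200 := by rw [← pow_mul]
  have h7 : (x:ℝ) ≤ (R:ℝ) ^ 200 := by exact_mod_cast h6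
  have hx0 : (0:ℝ) < x := by exact_mod_cast lt_of_lt_of_le (by omega : 0 < R0) hle
  calc log x ≤ log ((R:ℝ) ^ 200) := Real.log_le_log hx0 h7
    _ = _ := by rw [Real.log_pow]; norm_num
theorem NT (K η : ℝ) (hη : 0 < η) (D0 : ℕ) (hD : 1 ≤ D0) : ∃ k W x0 : ℕ, 1 ≤ k ∧ 1 ≤ W ∧ ∀ x ≥ x0, ∀ y : ℕ, (k * W * D0 + 1) * x ≤ y →
    ∀ P S : Finset ℕ, (∀ p ∈ P, p.Prime ∧ x < p ∧ p ≤ D0 * x) → (∀ t ∈ S, t.Prime ∧ x < t ∧ t ≤ y) → x / log x ≤ #P →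
    ∃ wt : ℕ → ℕ → ℝ, (∀ p m, 0 ≤ wt p m) ∧ (∀ p ∈ P, ∑ m ∈ range (2 * y), wt p m ≤ 1) ∧ (∀ p m, wt p m ≤ 1 / √x) ∧
      (#(S.filter fun t => ∑ p ∈ P, ∑ i : Fin k, wt p (t + i * W * p) < K * (x / y)) : ℝ) ≤ η * (y / log x) := by
  obtain ⟨M, hM⟩ := exists_nat_ge (K * (9830400 * CM ^ 2))
  obtain ⟨w, hw0, hw2, hwη⟩ := exists_w ((2:ℝ)^M) D0 η (one_le_pow₀ (by norm_num)) (by positivity) hη (16 * ((2^M)^2 + 2^M))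
  have hCM : 0 < CM := by positivity
  have hlog : Tendsto (fun R : ℕ => log R / (32 * CM * 2^M * (M+1))) atTop atTop :=
    (Real.tendsto_log_atTop.comp tendsto_natCast_atTop_atTop).atTop_div_const (by positivity)
  obtain ⟨R0, hR0⟩ := eventually_atTop.1 ((hlog.eventually_ge_atTop (log w)).and ((hlog.eventually_ge_atTop (2 * PP w)).and
    (((tendsto_natCast_atTop_atTop (R := ℝ)).eventually_ge_atTop (3 * (primorial w : ℕ) * 4 ^ (2^M) * PP w)).and
      ((eventually_ge_atTop w).and (eventually_ge_atTop 2)))))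
  refine ⟨2^M, primorial w, (max R0 2) ^ 100, Nat.one_le_two_pow, primorial_pos w, fun x hx y hy P S hP hS hc => ?_⟩
  obtain ⟨R, h1, h2, h3⟩ := exists_R (max R0 2) x (le_max_right _ _) hx
  obtain ⟨a1, a2, a3, a4, a5⟩ := hR0 R (le_trans (le_max_left _ _) h1)
  have hws : (0:ℝ) < √w := Real.sqrt_pos.2 (by exact_mod_cast (by omega : 0 < w))
  obtain ⟨wt, b1, b2, b3, b4⟩ := NT_core M w D0 x R y η _ hw0 a5 h2 h3 rfl a1 a2 a3 a4 hD hy (1 / √w) (by positivity) hwη P S hP hS hc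
  refine ⟨wt, b1, b2, b3, le_trans ?_ b4⟩
  have : K ≤ (M + 1) / (9830400 * CM ^ 2) := by rw [le_div_iff₀ (by positivity)]; linarith
  have h9 : K * ((x:ℝ) / y) ≤ (M + 1) / (9830400 * CM ^ 2) * (x / y) := by gcongr
  exact Nat.cast_le.2 <| card_le_card (fun t ht => by
    rw [mem_filter] at ht ⊢
    exact ⟨ht.1, ht.2.trans_le h9⟩)
end
section
noncomputable def sv (S : Finset ℕ) (n : ℕ) (E : Finset ℤ) : ℝ := ∏ s ∈ S, if ∃ e ∈ E, (s:ℤ) ∣ e + n then 0 else 1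
noncomputable def EX (S : Finset ℕ) (h : ℕ → ℝ) : ℝ := (∑ n ∈ range (∏ s ∈ S, s), h n) / ((∏ s ∈ S, s : ℕ) : ℝ)
def ci (s : ℕ) (E : Finset ℤ) : ℕ := #(E.image (fun e : ℤ => (e : ZMod s)))
lemma sv_eq (S : Finset ℕ) (n : ℕ) (E : Finset ℤ) : sv S n E = if ∀ e ∈ E, ∀ s ∈ S, ¬ (s:ℤ) ∣ e + n then 1 else 0 := by
  unfold sv
  split_ifs with h
  · exact prod_eq_one fun s hs => by rw [if_neg]; rintro ⟨e, he, hd⟩; exact h e he s hs hd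
  · push Not at h
    obtain ⟨e, he, s, hs, hd⟩ := h
    exact prod_eq_zero hs (if_pos ⟨e, he, hd⟩)
lemma sv_mul (S : Finset ℕ) (n : ℕ) (E F : Finset ℤ) : sv S n E * sv S n F = sv S n (E ∪ F) := by
  rw [sv, sv, sv, ← pmd]
  refine prod_congr rfl fun s _ => ?_
  by_cases h1 : ∃ e ∈ E, (s:ℤ) ∣ e + n
  · rw [if_pos h1, zero_mul, if_pos]
    obtain ⟨e, he, h⟩ := h1; exact ⟨e, mem_union_left _ he, h⟩
  · by_cases h2 : ∃ e ∈ F, (s:ℤ) ∣ e + n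
    · rw [if_pos h2, mul_zero, if_pos]
      obtain ⟨e, he, h⟩ := h2; exact ⟨e, mem_union_right _ he, h⟩
    · rw [if_neg h1, if_neg h2, if_neg]; · norm_num
      rintro ⟨e, he, h⟩
      rcases mem_union.1 he with he | he
      · exact h1 ⟨e, he, h⟩
      · exact h2 ⟨e, he, h⟩
lemma sv_nonneg (S : Finset ℕ) (n : ℕ) (E : Finset ℤ) : 0 ≤ sv S n E := by rw [sv_eq]; split_ifs <;> norm_num
lemma sv_le_one (S : Finset ℕ) (n : ℕ) (E : Finset ℤ) : sv S n E ≤ 1 := by rw [sv_eq]; split_ifs <;> norm_num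
lemma EX_add (S : Finset ℕ) (f g : ℕ → ℝ) : EX S (fun n => f n + g n) = EX S f + EX S g := by
  simp only [EX, sum_add_distrib, add_div]
lemma EX_mul (S : Finset ℕ) (c : ℝ) (f : ℕ → ℝ) : EX S (fun n => c * f n) = c * EX S f := by
  simp only [EX, ← mul_sum, mul_div_assoc]
lemma EX_sum (S : Finset ℕ) {α : Type} (T : Finset α) (f : α → ℕ → ℝ) : EX S (fun n => ∑ t ∈ T, f t n) = ∑ t ∈ T, EX S (f t) := by
  simp only [EX]; rw [Finset.sum_comm, sum_div]
lemma EX_mono (S : Finset ℕ) (f g : ℕ → ℝ) (h : ∀ n, f n ≤ g n) : EX S f ≤ EX S g := by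
  simp only [EX]; gcongr; exact h _
lemma EX_exists (S : Finset ℕ) (hS : ∀ s ∈ S, 0 < s) (f : ℕ → ℝ) : ∃ n, f n ≤ EX S f := by
  by_contra h
  push Not at h
  have hD : 0 < ∏ s ∈ S, s := prod_pos hS
  have hD' : (0:ℝ) < ((∏ s ∈ S, s : ℕ) : ℝ) := by exact_mod_cast hD
  have : ∑ n ∈ range (∏ s ∈ S, s), EX S f < ∑ n ∈ range (∏ s ∈ S, s), f n :=
    sum_lt_sum_of_nonempty (nonempty_range_iff.2 hD.ne') fun n _ => h n
  rw [sum_const, card_range, nsmul_eq_mul] at this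
  nth_rw 1 [EX] at this
  rw [mul_div_cancel₀ _ hD'.ne'] at this
  exact lt_irrefl _ this
lemma loc_count (s : ℕ) (hs : 0 < s) (E : Finset ℤ) :
    ∑ n ∈ range s, (if ∃ e ∈ E, (s:ℤ) ∣ e + n then (0:ℝ) else 1) = s - ci s E := by
  haveI : NeZero s := ⟨hs.ne'⟩
  have h1 : ∑ n ∈ range s, (if ∃ e ∈ E, (s:ℤ) ∣ e + n then (0:ℝ) else 1) = s - ∑ n ∈ range s, (if ∃ e ∈ E, (s:ℤ) ∣ e + n then (1:ℝ) else 0) := by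
    rw [eq_sub_iff_add_eq, ← sum_add_distrib, sum_congr rfl (g := fun _ => (1:ℝ)) fun n _ => by split_ifs <;> norm_num]
    simp
  rw [h1, ← sum_filter, sum_const, nsmul_eq_mul, mul_one]
  congr 2
  refine card_bij (fun n _ => -(n : ZMod s)) ?_ ?_ ?_
  · intro n hn
    obtain ⟨-, e, he, hd⟩ := mem_filter.1 hn
    rw [mem_image]
    refine ⟨e, he, ?_⟩
    rw [← ZMod.intCast_zmod_eq_zero_iff_dvd] at hd
    push_cast at hd
    exact eq_neg_of_add_eq_zero_left hd
  · intro n hn n' hn' h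
    have h2 := neg_injective h
    rw [ZMod.natCast_eq_natCast_iff] at h2
    exact h2.eq_of_lt_of_lt (mem_range.1 (mem_filter.1 hn).1) (mem_range.1 (mem_filter.1 hn').1)
  · intro b hb
    obtain ⟨e, he, rfl⟩ := mem_image.1 hb
    refine ⟨(-(e : ZMod s)).val, ?_, by rw [ZMod.natCast_zmod_val]; ring⟩
    rw [mem_filter]
    refine ⟨mem_range.2 (ZMod.val_lt _), e, he, ?_⟩
    rw [← ZMod.intCast_zmod_eq_zero_iff_dvd]
    push_cast
    rw [ZMod.natCast_zmod_val]; ring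
lemma EX_sv (S : Finset ℕ) (hS : ∀ s ∈ S, s.Prime) (E : Finset ℤ) : EX S (fun n => sv S n E) = ∏ s ∈ S, (1 - ci s E / (s:ℝ)) := by
  have h := crt_prod (univ : Finset S) (fun s => (s:ℕ)) (fun s => (hS s s.2).pos)
    (fun s s' hne => (Nat.coprime_primes (hS s s.2) (hS s' s'.2)).2 fun h => hne (Subtype.ext h))
    (fun s n => if ∃ e ∈ E, ((s:ℕ):ℤ) ∣ e + n then (0:ℝ) else 1) (fun s n => by
      have : ∀ e : ℤ, ((s:ℕ):ℤ) ∣ e + ((n + s : ℕ) : ℤ) ↔ ((s:ℕ):ℤ) ∣ e + n := fun e => by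
        push_cast; rw [← add_assoc]; simp
      simp only [this])
  have e1 : ∏ s : S, (s:ℕ) = ∏ s ∈ S, s := prod_coe_sort S (fun s => s)
  rw [e1] at h
  unfold EX
  have e2 : ∀ n, sv S n E = ∏ s : S, if ∃ e ∈ E, ((s:ℕ):ℤ) ∣ e + n then (0:ℝ) else 1 := fun n => by
    rw [sv, ← prod_coe_sort S]
  simp only [e2]
  rw [h, ← prod_coe_sort S (fun s => 1 - ci s E / (s:ℝ)), ← e1]
  push_cast
  rw [← prod_div_distrib]
  refine prod_congr rfl fun s _ => ?_
  have hs := (hS s s.2).pos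
  rw [loc_count _ hs, sub_div, div_self (by exact_mod_cast hs.ne')]
end
section
noncomputable def sg (S : Finset ℕ) (k : ℕ) : ℝ := ∏ s ∈ S, (1 - k / (s:ℝ))
lemma card_dvd_le (S : Finset ℕ) (hS : ∀ s ∈ S, s.Prime) (d : ℤ) (hd : d ≠ 0) (N : ℕ) (hN : d.natAbs < 2 ^ N) :
    #(S.filter fun s : ℕ => (s:ℤ) ∣ d) ≤ N := by
  have h1 : (∏ s ∈ S.filter (fun s : ℕ => (s:ℤ) ∣ d), s) ∣ d.natAbs :=
    Finset.prod_primes_dvd _ (fun s hs => (hS s (mem_filter.1 hs).1).prime) fun s hs => Int.natCast_dvd.1 (mem_filter.1 hs).2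
  have h2 : 2 ^ #(S.filter fun s : ℕ => (s:ℤ) ∣ d) ≤ ∏ s ∈ S.filter (fun s : ℕ => (s:ℤ) ∣ d), s := by
    rw [← prod_const]
    exact prod_le_prod' fun s hs => (hS s (mem_filter.1 hs).1).two_le
  have h3 := Nat.le_of_dvd (Int.natAbs_pos.2 hd) h1
  exact ((Nat.pow_lt_pow_iff_right (by norm_num : 1 < 2)).1 (by omega : 2 ^ #(S.filter fun s : ℕ => (s:ℤ) ∣ d) < 2 ^ N)).le
lemma pairProb (S : Finset ℕ) (hS : ∀ s ∈ S, s.Prime) (k : ℕ) (hk : 1 ≤ k) (z : ℝ) (hz : 0 < z) (h2k : ∀ s ∈ S, 2 * k ≤ s) (hzs : ∀ s ∈ S, z ≤ s)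
    (E E' : Finset ℤ) (hE : #E = k) (hE' : #E' = k) (c1 : ∀ s ∈ S, ci s E = k) (c2 : ∀ s ∈ S, ci s E' = k) (b : ℕ) (hb : b ≤ 1)
    (hB : #(E ∩ E') = b) (N : ℕ) (hN : ∀ e ∈ E, ∀ e' ∈ E', (e - e').natAbs < 2 ^ N) :
    EX S (fun n => sv S n (E ∪ E')) * sg S 1 ^ b ≤ sg S k ^ 2 * (1 + 2 * k / z) ^ (k * k * N) := by
  classical
  set bad := S.filter fun s : ℕ => ∃ e ∈ E, ∃ e' ∈ E', e ≠ e' ∧ (s:ℤ) ∣ e - e' with hbad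
  have hcard : #bad ≤ k * k * N := by
    have : bad ⊆ ((E ×ˢ E').filter fun x => x.1 ≠ x.2).biUnion fun x => S.filter fun s : ℕ => (s:ℤ) ∣ x.1 - x.2 := by
      intro s hs
      obtain ⟨h1, e, he, e', he', hne, hd⟩ := mem_filter.1 hs
      exact mem_biUnion.2 ⟨(e, e'), mem_filter.2 ⟨mem_product.2 ⟨he, he'⟩, hne⟩, mem_filter.2 ⟨h1, hd⟩⟩
    refine (card_le_card this).trans (card_biUnion_le.trans ?_)
    refine (sum_le_card_nsmul _ _ N fun x hx => ?_).trans ?_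
    · obtain ⟨h1, h2⟩ := mem_filter.1 hx
      exact card_dvd_le S hS _ (sub_ne_zero.2 h2) N (hN _ (mem_product.1 h1).1 _ (mem_product.1 h1).2)
    · rw [smul_eq_mul]
      refine Nat.mul_le_mul_right _ ((card_filter_le _ _).trans ?_)
      rw [card_product, hE, hE']
  have hk0 : (0:ℝ) ≤ 2 * k / z := by positivity
  have hF : (1 + 2 * k / z) ^ #bad ≤ (1 + 2 * k / z) ^ (k * k * N) := pow_le_pow_right₀ (by linarith) hcard
  have hbp : (1 + 2 * k / z) ^ #bad = ∏ s ∈ S, if s ∈ bad then (1 + 2 * k / z) else 1 := by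
    rw [prod_ite, prod_const, prod_const_one, mul_one, filter_mem_eq_inter, inter_eq_right.2 (filter_subset _ _)]
  refine le_trans ?_ (mll hF (by positivity))
  rw [EX_sv S hS, sg, sg, ← prod_pow, ← prod_pow, hbp, ← pmd, ← pmd]
  have hunion : #(E ∪ E') + b = 2 * k := by rw [← hB, card_union_add_card_inter]; omega
  refine prod_le_prod (fun s hs => ?_) fun s hs => ?_
  · have hs0 : (0:ℝ) < s := by exact_mod_cast (hS s hs).pos
    have h1 : ci s (E ∪ E') ≤ #(E ∪ E') := card_image_le
    have h2 : (ci s (E ∪ E') : ℝ) ≤ s := by have := h2k s hs; exact_mod_cast (by omega : ci s (E ∪ E') ≤ s)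
    have h3 : (1:ℝ) ≤ s := by exact_mod_cast (hS s hs).one_le
    have h4 := (div_le_one hs0).2 h2
    have h5 : ((1:ℕ):ℝ) / s ≤ 1 := (div_le_one hs0).2 (by simpa using h3)
    exact mul_nonneg (by linarith) (pow_nonneg (by linarith) _)
  · have hs0 : (0:ℝ) < s := by exact_mod_cast (hS s hs).pos
    have h3 : (1:ℝ) ≤ s := by exact_mod_cast (hS s hs).one_le
    have h5 : (0:ℝ) ≤ ((1:ℕ):ℝ) / s := by positivity
    have h5' : ((1:ℕ):ℝ) / s ≤ 1 := (div_le_one hs0).2 (by simpa using h3)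
    have hks : (k:ℝ) / s ≤ 1 / 2 := by
      rw [div_le_iff₀ hs0]; have : ((2 * k : ℕ):ℝ) ≤ s := by exact_mod_cast h2k s hs
      push_cast at this; linarith
    have hks0 : (0:ℝ) ≤ k / s := by positivity
    split_ifs with hsb
    · have h6 : (k:ℝ) / s ≤ ci s (E ∪ E') / s := by
        gcongr
        rw [← c1 s hs]
        exact card_le_card (image_subset_image subset_union_left)
      have h7 : (k:ℝ) / s ≤ k / z := by gcongr; exact hzs s hs
      have h8 : (1 - ((1:ℕ):ℝ) / s) ^ b ≤ 1 := pow_le_one₀ (by linarith) (by linarith)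
      have h9 : (0:ℝ) ≤ (1 - ((1:ℕ):ℝ) / s) ^ b := pow_nonneg (by linarith) _
      have ee : 2 * (k:ℝ) / z = 2 * (k / z) := by ring
      rw [ee]
      generalize (k:ℝ) / s = u at *
      generalize (k:ℝ) / z = v at *
      generalize (ci s (E ∪ E') : ℝ) / s = w at *
      calc _ ≤ (1 - u) * (1 - ((1:ℕ):ℝ) / s) ^ b := by gcongr
        _ ≤ (1 - u) * 1 := by gcongr; linarith
        _ ≤ (1 - u) ^ 2 * (1 + 2 * u) := by nlinarith [mul_nonneg (mul_nonneg hks0 (by linarith : (0:ℝ) ≤ 1 - 2 * u)) (by linarith : (0:ℝ) ≤ 1 - u)]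
        _ ≤ _ := by gcongr
    · have hc : ci s (E ∪ E') = #(E ∪ E') := by
        refine card_image_iff.2 ?_
        have i1 := card_image_iff.1 ((c1 s hs).trans hE.symm)
        have i2 := card_image_iff.1 ((c2 s hs).trans hE'.symm)
        have cr : ∀ e ∈ E, ∀ e' ∈ E', (e : ZMod s) = e' → e = e' := by
          intro e he e' he' h
          by_contra hne
          refine hsb (mem_filter.2 ⟨hs, e, he, e', he', hne, ?_⟩)
          rw [← ZMod.intCast_zmod_eq_zero_iff_dvd]; push_cast; rw [h, sub_self]
        intro e he e' he' h
        rcases mem_union.1 (mem_coe.1 he) with h1 | h1 <;> rcases mem_union.1 (mem_coe.1 he') with h2 | h2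
        · exact i1 h1 h2 h
        · exact cr _ h1 _ h2 h
        · exact (cr _ h2 _ h1 h.symm).symm
        · exact i2 h1 h2 h
      have hu : (#(E ∪ E') : ℝ) = 2 * k - b := by
        have : ((#(E ∪ E') + b : ℕ) : ℝ) = ((2 * k : ℕ):ℝ) := by rw [hunion]
        push_cast at this; linarith
      have hk1 : (1:ℝ) ≤ k := by exact_mod_cast hk
      rw [hc, hu, mul_one]
      interval_cases b
      · have : 1 - (2 * (k:ℝ) - (0:ℕ)) / s = 1 - 2 * (k / s) := by push_cast; ring
        rw [this]; nlinarith [sq_nonneg ((k:ℝ) / s)]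
      · have : (2 * (k:ℝ) - (1:ℕ)) / s = 2 * (k / s) - 1 / s := by push_cast; ring
        have h6 : (1:ℝ) / s ≤ k / s := by gcongr
        rw [this, pow_one]
        push_cast
        nlinarith [sq_nonneg ((k:ℝ) / s - 1 / s)]
lemma moment (S : Finset ℕ) {ι : Type} (T : Finset ι) (a : ι → ℝ) (ha : ∀ τ ∈ T, 0 ≤ a τ) (E : ι → Finset ℤ)
    (B : Finset ℤ) (hBE : ∀ τ ∈ T, B ⊆ E τ) (β s ε κ Bd : ℝ) (hβ : 0 < β) (hB : EX S (fun n => sv S n B) = β)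
    (hs : ∀ τ ∈ T, EX S (fun n => sv S n (E τ)) = s) (hκ : ∑ τ ∈ T, a τ = κ) (good : ι → ι → Prop) [DecidableRel good]
    (hε : 0 ≤ ε)
    (hg : ∀ τ ∈ T, ∀ τ' ∈ T, good τ τ' → EX S (fun n => sv S n (E τ ∪ E τ')) * β ≤ s ^ 2 * (1 + ε))
    (hp : ∀ F, EX S (fun n => sv S n F) ≤ 1)
    (hb : ∑ τ ∈ T, ∑ τ' ∈ T, (if good τ τ' then 0 else a τ * a τ') ≤ Bd) :
    EX S (fun n => sv S n B * (∑ τ ∈ T, a τ * sv S n (E τ) - κ * s / β) ^ 2) ≤ ε * κ ^ 2 * s ^ 2 / β + Bd := by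
  set c := κ * s / β with hc
  have h1 : ∀ n, sv S n B * (∑ τ ∈ T, a τ * sv S n (E τ) - c) ^ 2 =
      (∑ τ ∈ T, ∑ τ' ∈ T, (a τ * a τ') * sv S n (E τ ∪ E τ')) + ((-2 * c) * (∑ τ ∈ T, a τ * sv S n (E τ)) + c ^ 2 * sv S n B) := by
    intro n
    have e1 : sv S n B * (∑ τ ∈ T, a τ * sv S n (E τ)) = ∑ τ ∈ T, a τ * sv S n (E τ) := by
      rw [mul_sum]
      refine sum_congr rfl fun τ hτ => ?_
      rw [mul_left_comm, sv_mul, union_eq_right.2 (hBE τ hτ)]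
    have e2 : (∑ τ ∈ T, a τ * sv S n (E τ)) ^ 2 = ∑ τ ∈ T, ∑ τ' ∈ T, (a τ * a τ') * sv S n (E τ ∪ E τ') := by
      rw [sq, sum_mul_sum]
      refine sum_congr rfl fun τ _ => sum_congr rfl fun τ' _ => ?_
      rw [← sv_mul]; ring
    rw [← e2]
    linear_combination ((∑ τ ∈ T, a τ * sv S n (E τ)) - 2 * c) * e1
  simp only [h1]
  rw [EX_add, EX_add, EX_mul, EX_mul, hB, EX_sum, EX_sum]
  have h2 : ∑ τ ∈ T, EX S (fun n => a τ * sv S n (E τ)) = κ * s := by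
    rw [← hκ, sum_mul]
    exact sum_congr rfl fun τ hτ => by rw [EX_mul, hs τ hτ]
  have h3 : ∑ τ ∈ T, EX S (fun n => ∑ τ' ∈ T, (a τ * a τ') * sv S n (E τ ∪ E τ')) ≤
      ∑ τ ∈ T, ∑ τ' ∈ T, ((a τ * a τ') * (s ^ 2 * (1 + ε) / β) + (if good τ τ' then 0 else a τ * a τ')) := by
    refine sum_le_sum fun τ hτ => ?_
    rw [EX_sum]
    refine sum_le_sum fun τ' hτ' => ?_
    rw [EX_mul]
    have ha2 := mul_nonneg (ha τ hτ) (ha τ' hτ')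
    split_ifs with h
    · rw [add_zero]; gcongr
      rw [le_div_iff₀ hβ]; exact hg τ hτ τ' hτ' h
    · have h5 : 0 ≤ a τ * a τ' * (s ^ 2 * (1 + ε) / β) := by positivity
      nlinarith [mll (hp (E τ ∪ E τ')) ha2]
  rw [h2]
  simp only [sum_add_distrib] at h3
  have h4 : ∑ τ ∈ T, ∑ τ' ∈ T, (a τ * a τ') * (s ^ 2 * (1 + ε) / β) = κ ^ 2 * (s ^ 2 * (1 + ε) / β) := by
    simp only [← sum_mul]; rw [← hκ, sq (∑ τ ∈ T, a τ), sum_mul_sum]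
  rw [h4] at h3
  have h5 : κ ^ 2 * (s ^ 2 * (1 + ε) / β) + (-2 * c * (κ * s) + c ^ 2 * β) = ε * κ ^ 2 * s ^ 2 / β := by
    rw [hc]; field_simp; ring
  linarith
end
section
lemma cover (M : ℕ) (hM : 0 < M) (cov : ℕ → ℕ → ℕ → Prop) [∀ p m t, Decidable (cov p m t)] (pr : ℕ → ℕ → ℝ) (hpr : ∀ p m, 0 ≤ pr p m)
    (T P : Finset ℕ) : (∀ p ∈ P, ∑ m ∈ range M, pr p m ≤ 1) → ∀ c : ℕ → ℝ, (∀ t, 0 ≤ c t) →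
    ∃ f : ℕ → ℕ, ∑ t ∈ T, c t * (if ∀ p ∈ P, ¬ cov p (f p) t then 1 else 0) ≤
      ∑ t ∈ T, c t * ∏ p ∈ P, (1 - ∑ m ∈ range M, if cov p m t then pr p m else 0) := by
  induction P using Finset.induction_on with
  | empty => intro _ c _; exact ⟨fun _ => 0, by simp⟩
  | insert p P hp ih =>
    intro h1 c hc
    have hP : ∀ p ∈ P, ∑ m ∈ range M, pr p m ≤ 1 := fun q hq => h1 q (mem_insert_of_mem hq)
    set D : ℕ → ℝ := fun t => c t * ∏ p ∈ P, (1 - ∑ m ∈ range M, if cov p m t then pr p m else 0) with hD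
    have hD0 : ∀ t, 0 ≤ D t := fun t => mul_nonneg (hc t) (prod_nonneg fun q hq => by
      have : ∑ m ∈ range M, (if cov q m t then pr q m else 0) ≤ ∑ m ∈ range M, pr q m := sum_le_sum fun m _ => by
        split_ifs; exacts [le_rfl, hpr q m]
      linarith [hP q hq])
    set A : ℕ → ℝ := fun m => ∑ t ∈ T, D t * (if cov p m t then 1 else 0) with hA
    obtain ⟨m0, hm0, hmax⟩ := exists_max_image (range M) A (nonempty_range_iff.2 hM.ne')
    obtain ⟨f, hf⟩ := ih hP (fun t => c t * (if cov p m0 t then 0 else 1)) (fun t => mul_nonneg (hc t) (by split_ifs <;> norm_num))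
    refine ⟨fun q => if q = p then m0 else f q, ?_⟩
    have e1 : ∀ t, c t * (if ∀ q ∈ insert p P, ¬ cov q (if q = p then m0 else f q) t then (1:ℝ) else 0) =
        c t * (if cov p m0 t then 0 else 1) * (if ∀ q ∈ P, ¬ cov q (f q) t then 1 else 0) := by
      intro t
      rw [mul_assoc]; congr 1
      have : (∀ q ∈ insert p P, ¬ cov q (if q = p then m0 else f q) t) ↔ ¬ cov p m0 t ∧ ∀ q ∈ P, ¬ cov q (f q) t := by
        rw [forall_mem_insert, if_pos rfl]
        refine and_congr_right fun _ => forall₂_congr fun q hq => ?_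
        rw [if_neg (fun h : q = p => hp (h ▸ hq))]
      rw [if_congr this rfl rfl]
      by_cases h : cov p m0 t <;> simp [h]
    rw [sum_congr rfl fun t _ => e1 t]
    refine hf.trans ?_
    have e2 : ∑ t ∈ T, c t * (if cov p m0 t then 0 else 1) * ∏ p ∈ P, (1 - ∑ m ∈ range M, if cov p m t then pr p m else 0) = ∑ t ∈ T, D t - A m0 := by
      rw [hA, ← sum_sub_distrib]
      refine sum_congr rfl fun t _ => ?_
      simp only [hD]
      split_ifs <;> ring
    have e3 : ∑ t ∈ T, c t * ∏ p ∈ insert p P, (1 - ∑ m ∈ range M, if cov p m t then pr p m else 0) = ∑ t ∈ T, D t - ∑ m ∈ range M, pr p m * A m := by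
      simp only [hA, mul_sum]
      rw [Finset.sum_comm, ← sum_sub_distrib]
      refine sum_congr rfl fun t _ => ?_
      rw [prod_insert hp]
      have : ∑ m ∈ range M, pr p m * (D t * if cov p m t then 1 else 0) = D t * ∑ m ∈ range M, if cov p m t then pr p m else 0 := by
        rw [mul_sum]; refine sum_congr rfl fun m _ => ?_
        split_ifs <;> ring
      rw [this]; simp only [hD]; ring
    rw [e2, e3]
    have hA0 : 0 ≤ A m0 := sum_nonneg fun t _ => mul_nonneg (hD0 t) (by split_ifs <;> norm_num)
    have : ∑ m ∈ range M, pr p m * A m ≤ A m0 := by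
      calc _ ≤ ∑ m ∈ range M, pr p m * A m0 := sum_le_sum fun m hm => mll (hmax m hm) (hpr p m)
        _ = (∑ m ∈ range M, pr p m) * A m0 := by rw [sum_mul]
        _ ≤ 1 * A m0 := mlr (h1 p (mem_insert_self _ _)) hA0
        _ = _ := one_mul _
    linarith
lemma cover_exp (M : ℕ) (hM : 0 < M) (cov : ℕ → ℕ → ℕ → Prop) [∀ p m t, Decidable (cov p m t)] (pr : ℕ → ℕ → ℝ) (hpr : ∀ p m, 0 ≤ pr p m)
    (T P : Finset ℕ) (h1 : ∀ p ∈ P, ∑ m ∈ range M, pr p m ≤ 1) (g : ℕ → ℝ)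
    (hg : ∀ t ∈ T, g t ≤ ∑ p ∈ P, ∑ m ∈ range M, if cov p m t then pr p m else 0) :
    ∃ f : ℕ → ℕ, (#(T.filter fun t => ∀ p ∈ P, ¬ cov p (f p) t) : ℝ) ≤ ∑ t ∈ T, exp (- g t) := by
  obtain ⟨f, hf⟩ := cover M hM cov pr hpr T P h1 (fun _ => 1) (fun _ => zero_le_one)
  refine ⟨f, ?_⟩
  simp only [one_mul] at hf
  rw [← sum_filter, sum_const, nsmul_eq_mul, mul_one] at hf
  refine hf.trans (sum_le_sum fun t ht => ?_)
  calc _ ≤ ∏ p ∈ P, exp (-∑ m ∈ range M, if cov p m t then pr p m else 0) := by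
        refine prod_le_prod (fun p hp => ?_) fun p _ => ?_
        · have : ∑ m ∈ range M, (if cov p m t then pr p m else 0) ≤ ∑ m ∈ range M, pr p m := sum_le_sum fun m _ => by
            split_ifs; exacts [le_rfl, hpr p m]
          linarith [h1 p hp]
        · linarith [add_one_le_exp (-∑ m ∈ range M, if cov p m t then pr p m else 0)]
    _ = exp (-∑ p ∈ P, ∑ m ∈ range M, if cov p m t then pr p m else 0) := by rw [← exp_sum, sum_neg_distrib]
    _ ≤ _ := exp_le_exp.2 (by linarith [hg t ht])
def Ep (k W p : ℕ) (m : ℤ) : Finset ℤ := univ.image fun j : Fin k => m - ((j:ℕ):ℤ) * W * p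
lemma Ep_card (k W p : ℕ) (m : ℤ) (hW : 1 ≤ W) (hp : 1 ≤ p) : #(Ep k W p m) = k := by
  rw [Ep, card_image_of_injective, card_fin]
  intro j j' h
  have h1 : ((j:ℕ):ℤ) * (W * p) = ((j':ℕ):ℤ) * (W * p) := by simp only at h; linarith
  have h2 : ((W:ℤ) * p) ≠ 0 := by positivity
  exact Fin.ext (by exact_mod_cast mul_right_cancel₀ h2 h1)
lemma Ep_ci (k W p s : ℕ) (m : ℤ) (hs : s.Prime) (hW : 1 ≤ W) (hsW : W < s) (hk : k ≤ s) (hp : p.Prime) (hsp : s ≠ p) : ci s (Ep k W p m) = k := by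
  have hinj : Set.InjOn (fun e : ℤ => (e : ZMod s)) (Ep k W p m) := by
    intro e he e' he' h
    obtain ⟨j, -, rfl⟩ := mem_image.1 (mem_coe.1 he)
    obtain ⟨j', -, rfl⟩ := mem_image.1 (mem_coe.1 he')
    have hd : (s:ℤ) ∣ (((j':ℕ):ℤ) - ((j:ℕ):ℤ)) * W * p := by
      rw [← ZMod.intCast_zmod_eq_zero_iff_dvd]
      simp only at h; push_cast at h ⊢; linear_combination h
    have hsi : Prime (s:ℤ) := Nat.prime_iff_prime_int.1 hs
    rcases hsi.dvd_or_dvd hd with hd | hd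
    · rcases hsi.dvd_or_dvd hd with hd | hd
      · have := Int.eq_zero_of_abs_lt_dvd hd (by have := j.2; have := j'.2; rw [abs_lt]; omega)
        have : (j':ℕ) = j := by omega
        simp only [this]
      · have := Nat.le_of_dvd hW (Int.natCast_dvd_natCast.1 hd); omega
    · exact absurd ((Nat.prime_dvd_prime_iff_eq hs hp).1 (Int.natCast_dvd_natCast.1 hd)) hsp
  rw [ci, card_image_of_injOn hinj, Ep_card _ _ _ _ hW hp.one_le]
lemma Ep_inter (k W p p' t i i' : ℕ) (hW : 1 ≤ W) (hp : p.Prime) (hp' : p'.Prime) (hne : p ≠ p') (hk : k ≤ p') (hi : i < k) (hi' : i' < k) :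
    Ep k W p ((t + i * W * p : ℕ)) ∩ Ep k W p' ((t + i' * W * p' : ℕ)) = {(t:ℤ)} := by
  ext e
  rw [mem_inter, mem_singleton]
  constructor
  · rintro ⟨h1, h2⟩
    obtain ⟨j, -, rfl⟩ := mem_image.1 h1
    obtain ⟨j', -, h⟩ := mem_image.1 h2
    push_cast at h ⊢
    have hW' : (W:ℤ) ≠ 0 := by positivity
    have h3 : ((i':ℤ) - (j':ℕ)) * p' = ((i:ℤ) - (j:ℕ)) * p := by
      apply mul_left_cancel₀ hW'; linear_combination h
    have hd : (p':ℤ) ∣ ((i:ℤ) - (j:ℕ)) * p := ⟨(i':ℤ) - (j':ℕ), by rw [← h3]; ring⟩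
    rcases (Nat.prime_iff_prime_int.1 hp').dvd_or_dvd hd with hd | hd
    · have := Int.eq_zero_of_abs_lt_dvd hd (by have := j.2; rw [abs_lt]; omega)
      linear_combination (W * p : ℤ) * this
    · exact absurd ((Nat.prime_dvd_prime_iff_eq hp' hp).1 (Int.natCast_dvd_natCast.1 hd)) (Ne.symm hne)
  · rintro rfl
    exact ⟨mem_image.2 ⟨⟨i, hi⟩, mem_univ _, by push_cast; ring⟩, mem_image.2 ⟨⟨i', hi'⟩, mem_univ _, by push_cast; ring⟩⟩
lemma EX_sv_le_one (S : Finset ℕ) (hS : ∀ s ∈ S, s.Prime) (F : Finset ℤ) : EX S (fun n => sv S n F) ≤ 1 := by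
  have h := EX_sv S hS ∅
  refine (EX_mono S _ (fun n => sv S n ∅) fun n => ?_).trans ?_
  · rw [sv_eq S n ∅]; simpa using sv_le_one S n F
  · rw [h]; simp [ci]
end
section
structure SH (x y k W N : ℕ) (z ε : ℝ) (S P T : Finset ℕ) (wt : ℕ → ℕ → ℝ) : Prop where
  hS : ∀ s ∈ S, s.Prime ∧ 2 * k ≤ s ∧ W < s ∧ s ≤ x ∧ z ≤ s
  hP : ∀ p ∈ P, p.Prime ∧ x < p ∧ k * W * p ≤ y
  hT : ∀ t ∈ T, t ≤ y
  hk : 1 ≤ k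
  hW : 1 ≤ W
  hx : 1 ≤ x
  hkx : k ≤ x
  hz : 0 < z
  hε0 : 0 ≤ ε
  hε : (1 + 2 * k / z) ^ (k * k * N) ≤ 1 + ε
  hN : 3 * y < 2 ^ N
  w0 : ∀ p m, 0 ≤ wt p m
  w1 : ∀ p ∈ P, ∑ m ∈ range (2 * y), wt p m ≤ 1
  w2 : ∀ p m, wt p m ≤ 1 / √x
variable {x y k W N : ℕ} {z ε : ℝ} {S P T : Finset ℕ} {wt : ℕ → ℕ → ℝ}
lemma SH.sg_pos (h : SH x y k W N z ε S P T wt) (j : ℕ) (hj : j ≤ k) : 0 < sg S j := by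
  refine prod_pos fun s hs => ?_
  obtain ⟨h1, h2, -⟩ := h.hS s hs
  have : (0:ℝ) < s := by exact_mod_cast h1.pos
  rw [sub_pos, div_lt_one this]
  have := h.hk
  exact_mod_cast (by omega : j < s)
lemma SH.EXE (h : SH x y k W N z ε S P T wt) {p : ℕ} (hp : p ∈ P) (m : ℤ) : (∀ s ∈ S, ci s (Ep k W p m) = k) ∧ EX S (fun n => sv S n (Ep k W p m)) = sg S k := by
  have h0 : ∀ s ∈ S, ci s (Ep k W p m) = k := fun s hs => by
    obtain ⟨h1, h2, h3, h4, -⟩ := h.hS s hs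
    obtain ⟨h5, h6, -⟩ := h.hP p hp
    exact Ep_ci k W p s m h1 h.hW h3 (by omega) h5 (by omega)
  refine ⟨h0, ?_⟩
  rw [EX_sv S fun s hs => (h.hS s hs).1]
  exact prod_congr rfl fun s hs => by rw [h0 s hs]
lemma SH.mem_lt (h : SH x y k W N z ε S P T wt) {p : ℕ} (hp : p ∈ P) {m : ℕ} (hm : m < 2 * y) {e : ℤ} (he : e ∈ Ep k W p m) : -(y:ℤ) ≤ e ∧ e < 2 * y := by
  obtain ⟨j, -, rfl⟩ := mem_image.1 he
  have h1 : (j:ℕ) * W * p ≤ k * W * p := by gcongr; exact j.2.le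
  have h2 := (h.hP p hp).2.2
  have h3 : (((j:ℕ) * W * p : ℕ):ℤ) ≤ y := by exact_mod_cast h1.trans h2
  push_cast at h3
  have h4 : (0:ℤ) ≤ ((j:ℕ):ℤ) * W * p := by positivity
  omega
lemma SH.pp (h : SH x y k W N z ε S P T wt) {p p' : ℕ} (hp : p ∈ P) (hp' : p' ∈ P) {m m' : ℕ} (hm : m < 2 * y) (hm' : m' < 2 * y) (b : ℕ) (hb : b ≤ 1)
    (hB : #(Ep k W p m ∩ Ep k W p' m') = b) :
    EX S (fun n => sv S n (Ep k W p m ∪ Ep k W p' m')) * sg S 1 ^ b ≤ sg S k ^ 2 * (1 + ε) := by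
  refine (pairProb S (fun s hs => (h.hS s hs).1) k h.hk z h.hz (fun s hs => (h.hS s hs).2.1) (fun s hs => (h.hS s hs).2.2.2.2) _ _
    (Ep_card k W p m h.hW (h.hP p hp).1.one_le) (Ep_card k W p' m' h.hW (h.hP p' hp').1.one_le) (h.EXE hp m).1 (h.EXE hp' m').1 b hb hB N ?_).trans ?_
  · intro e he e' he'
    have h1 := h.mem_lt hp hm he
    have h2 := h.mem_lt hp' hm' he'
    have h3 := h.hN
    omega
  · have := h.hε
    gcongr
lemma SH.tlt (h : SH x y k W N z ε S P T wt) {p t : ℕ} (hp : p ∈ P) (ht : t ∈ T) (i : Fin k) : t + i * W * p < 2 * y := by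
  have h1 : (i:ℕ) * W * p < k * W * p := by
    have h1 := (h.hP p hp).1.pos; have h2 := h.hW; have h3 := i.2
    gcongr
  have := (h.hP p hp).2.2
  have := h.hT t ht
  omega
lemma SH.varX (h : SH x y k W N z ε S P T wt) {p : ℕ} (hp : p ∈ P) :
    EX S (fun n => (∑ m ∈ range (2 * y), wt p m * sv S n (Ep k W p m) - (∑ m ∈ range (2 * y), wt p m) * sg S k) ^ 2) ≤ ε * sg S k ^ 2 + k ^ 2 / √x := by
  have hS : ∀ s ∈ S, s.Prime := fun s hs => (h.hS s hs).1
  have h1 := moment S (range (2 * y)) (wt p) (fun m _ => h.w0 p m) (fun m : ℕ => Ep k W p m) ∅ (fun _ _ => empty_subset _) 1 (sg S k) ε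
    (∑ m ∈ range (2 * y), wt p m) (k ^ 2 / √x) one_pos (by rw [EX_sv S hS]; simp [ci]) (fun m _ => (h.EXE hp m).2) rfl
    (fun m m' => Ep k W p m ∩ Ep k W p m' = ∅) h.hε0 (fun m hm m' hm' hg => by
      simpa using h.pp hp hp (mem_range.1 hm) (mem_range.1 hm') 0 (by norm_num) (by rw [hg, card_empty]))
    (EX_sv_le_one S hS) ?_
  · have e : ∀ n, sv S n ∅ = 1 := fun n => by simp [sv]
    simp only [e, one_mul, div_one] at h1
    refine h1.trans ?_
    have h2 := h.w1 p hp
    have h3 : 0 ≤ ∑ m ∈ range (2 * y), wt p m := sum_nonneg fun m _ => h.w0 p m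
    have h4 := h.hε0
    have h5 : (∑ m ∈ range (2 * y), wt p m) ^ 2 ≤ 1 := pow_le_one₀ h3 h2
    nlinarith [mll h5 (mul_nonneg h4 (sq_nonneg (sg S k)))]
  · have h2 : ∀ m ∈ range (2 * y), ∑ m' ∈ range (2 * y), (if Ep k W p m ∩ Ep k W p m' = ∅ then 0 else wt p m * wt p m') ≤ wt p m * (k ^ 2 / √x) := by
      intro m _
      have e : ∀ m' : ℕ, (if Ep k W p m ∩ Ep k W p m' = ∅ then 0 else wt p m * wt p m') = if ¬ (Ep k W p m ∩ Ep k W p m' = ∅) then wt p m * wt p m' else 0 := fun m' => by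
        split_ifs <;> simp_all
      rw [sum_congr rfl fun m' _ => e m', ← sum_filter]
      have hc : #((range (2 * y)).filter fun m' : ℕ => ¬ (Ep k W p m ∩ Ep k W p m' = ∅)) ≤ k ^ 2 := by
        have : (range (2 * y)).filter (fun m' : ℕ => ¬ (Ep k W p m ∩ Ep k W p m' = ∅)) ⊆
            (univ : Finset (Fin k × Fin k)).image fun c => ((m:ℤ) - ((c.1:ℕ):ℤ) * W * p + ((c.2:ℕ):ℤ) * W * p).toNat := by
          intro m' hm'
          obtain ⟨e, he⟩ := nonempty_iff_ne_empty.2 (mem_filter.1 hm').2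
          obtain ⟨h1, h2⟩ := mem_inter.1 he
          obtain ⟨j, -, rfl⟩ := mem_image.1 h1
          obtain ⟨j', -, h3⟩ := mem_image.1 h2
          refine mem_image.2 ⟨(j, j'), mem_univ _, ?_⟩
          simp only at h3 ⊢
          rw [← h3, sub_add_cancel, Int.toNat_natCast]
        refine (card_le_card this).trans (card_image_le.trans ?_)
        rw [card_univ, Fintype.card_prod, Fintype.card_fin, sq]
      calc _ ≤ ∑ m' ∈ (range (2 * y)).filter (fun m' : ℕ => ¬ (Ep k W p m ∩ Ep k W p m' = ∅)), wt p m * (1 / √x) :=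
            sum_le_sum fun m' _ => mll (h.w2 p m') (h.w0 p m)
        _ ≤ (k ^ 2 : ℝ) * (wt p m * (1 / √x)) := by
            rw [sum_const, nsmul_eq_mul]
            have := h.w0 p m
            gcongr
            exact_mod_cast hc
        _ = _ := by ring
    refine (sum_le_sum h2).trans ?_
    rw [← sum_mul]
    exact mul_le_of_le_one_left (by positivity) (h.w1 p hp)
lemma SH.EXt (h : SH x y k W N z ε S P T wt) (t : ℕ) : EX S (fun n => sv S n {(t:ℤ)}) = sg S 1 := by
  rw [EX_sv S fun s hs => (h.hS s hs).1]; simp [ci, sg]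
lemma SH.varZ (h : SH x y k W N z ε S P T wt) {t : ℕ} (ht : t ∈ T) (κ : ℝ) (hκ : ∑ p ∈ P, ∑ i : Fin k, wt p (t + i * W * p) = κ) :
    EX S (fun n => sv S n {(t:ℤ)} * (∑ p ∈ P, ∑ i : Fin k, wt p (t + i * W * p) * sv S n (Ep k W p (t + i * W * p : ℕ)) - κ * sg S k / sg S 1) ^ 2) ≤
      ε * κ ^ 2 * sg S k ^ 2 / sg S 1 + κ * (k / √x) := by
  have hS : ∀ s ∈ S, s.Prime := fun s hs => (h.hS s hs).1
  have h1 := moment S (P ×ˢ (univ : Finset (Fin k))) (fun τ => wt τ.1 (t + τ.2 * W * τ.1)) (fun m _ => h.w0 _ _) (fun τ => Ep k W τ.1 (t + τ.2 * W * τ.1 : ℕ)) {(t:ℤ)}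
    (fun τ _ => singleton_subset_iff.2 (mem_image.2 ⟨τ.2, mem_univ _, by push_cast; ring⟩)) (sg S 1) (sg S k) ε
    κ (κ * (k / √x)) (h.sg_pos 1 h.hk) (h.EXt t) (fun m hm => (h.EXE (mem_product.1 hm).1 _).2) (by rw [sum_product, hκ])
    (fun τ τ' => τ.1 ≠ τ'.1) h.hε0 (fun τ hτ τ' hτ' hg => by
      have a1 := (mem_product.1 hτ).1
      have a2 := (mem_product.1 hτ').1
      have a3 := h.hP _ a2
      have a4 := h.hkx
      have := h.pp a1 a2 (h.tlt a1 ht τ.2) (h.tlt a2 ht τ'.2) 1 le_rfl (by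
        rw [Ep_inter k W _ _ t _ _ h.hW (h.hP _ a1).1 a3.1 hg (by omega) τ.2.2 τ'.2.2, card_singleton])
      simpa using this)
    (EX_sv_le_one S hS) ?_
  · simp only [sum_product] at h1
    exact h1
  · rw [← hκ, sum_product, sum_mul]
    refine sum_le_sum fun p hp => ?_
    rw [sum_mul]
    refine sum_le_sum fun i _ => ?_
    rw [sum_product]
    have hw := h.w0 p (t + i * W * p)
    calc _ = ∑ i' : Fin k, wt p (t + i * W * p) * wt p (t + i' * W * p) := by
          rw [sum_eq_single p]
          · simp
          · intro p' _ hne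
            simp [Ne.symm hne]
          · exact fun h => absurd hp h
      _ ≤ ∑ i' : Fin k, wt p (t + i * W * p) * (1 / √x) := sum_le_sum fun i' _ => mll (h.w2 _ _) hw
      _ = _ := by rw [sum_const, card_univ, Fintype.card_fin, nsmul_eq_mul]; ring
end
section
variable {x y k W N : ℕ} {z ε : ℝ} {S P T : Finset ℕ} {wt : ℕ → ℕ → ℝ}
lemma s5_num {σ s K κ Z Y : ℝ} (hσ : 0 < σ) (hs : 0 < s) (hK : 0 < K) (hY : 0 ≤ Y) (hκ : K ≤ κ) :
    min 1 (exp (-((Z - Y) / (2 * s)))) ≤ exp (-(K / (8 * σ))) + 4 * σ ^ 2 / (κ ^ 2 * s ^ 2) * (Z - κ * s / σ) ^ 2 + 4 * σ / (K * s) * Y := by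
  have hκ0 : 0 < κ := lt_of_lt_of_le hK hκ
  have p1 := exp_pos (-(K / (8 * σ)))
  have p2 : 0 ≤ 4 * σ ^ 2 / (κ ^ 2 * s ^ 2) * (Z - κ * s / σ) ^ 2 := by positivity
  have p3 : 0 ≤ 4 * σ / (K * s) * Y := by positivity
  by_cases h1 : Z < κ * s / (2 * σ)
  · refine (min_le_left _ _).trans ?_
    have h2 : κ * s / (2 * σ) ≤ κ * s / σ - Z := by
      have : κ * s / σ = κ * s / (2 * σ) + κ * s / (2 * σ) := by field_simp; ring
      linarith
    have h3 : (κ * s / (2 * σ)) ^ 2 ≤ (Z - κ * s / σ) ^ 2 := by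
      rw [← neg_sq (Z - _), neg_sub]; gcongr
    have h4 : 1 ≤ 4 * σ ^ 2 / (κ ^ 2 * s ^ 2) * (Z - κ * s / σ) ^ 2 := by
      calc (1:ℝ) = 4 * σ ^ 2 / (κ ^ 2 * s ^ 2) * (κ * s / (2 * σ)) ^ 2 := by field_simp; ring
        _ ≤ _ := by gcongr
    linarith
  by_cases h2 : K * s / (4 * σ) < Y
  · refine (min_le_left _ _).trans ?_
    have : 1 ≤ 4 * σ / (K * s) * Y := by
      calc (1:ℝ) = 4 * σ / (K * s) * (K * s / (4 * σ)) := by field_simp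
        _ ≤ _ := by gcongr
    linarith
  · refine (min_le_right _ _).trans ?_
    push Not at h1 h2
    have h3 : K * s / (2 * σ) ≤ κ * s / (2 * σ) := by gcongr
    have h4 : exp (-((Z - Y) / (2 * s))) ≤ exp (-(K / (8 * σ))) := by
      apply exp_le_exp.2
      rw [neg_le_neg_iff]
      calc K / (8 * σ) = (K * s / (2 * σ) - K * s / (4 * σ)) / (2 * s) := by field_simp; ring
        _ ≤ _ := by gcongr; linarith
    linarith
lemma s5_num2 {s X w : ℝ} (hs : 0 < s) (hw : w ≤ 1) (hX : 2 * s < X) : X ≤ 2 / s * (X - w * s) ^ 2 := by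
  have h1 : X / 2 ≤ X - w * s := by nlinarith
  have h2 : (X / 2) ^ 2 ≤ (X - w * s) ^ 2 := by gcongr; linarith
  rw [div_mul_eq_mul_div, le_div_iff₀ hs]
  nlinarith
lemma SH.det (h : SH x y k W N z ε S P T wt) (hy : 0 < y) (K : ℝ) (hK : 0 < K) (n : ℕ) : ∃ f : ℕ → ℕ,
    (#(T.filter fun t : ℕ => sv S n {(t:ℤ)} = 1 ∧ ∀ p ∈ P, ¬ (p:ℤ) ∣ (f p : ℤ) - t) : ℝ) ≤
    ∑ t ∈ T, exp (-(K / (8 * sg S 1))) * sv S n {(t:ℤ)}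
    + ∑ t ∈ T.filter (fun t => ∑ p ∈ P, ∑ i : Fin k, wt p (t + i * W * p) < K), sv S n {(t:ℤ)}
    + ∑ t ∈ T.filter (fun t => ¬ ∑ p ∈ P, ∑ i : Fin k, wt p (t + i * W * p) < K),
        4 * sg S 1 ^ 2 / ((∑ p ∈ P, ∑ i : Fin k, wt p (t + i * W * p)) ^ 2 * sg S k ^ 2) *
        (sv S n {(t:ℤ)} * (∑ p ∈ P, ∑ i : Fin k, wt p (t + i * W * p) * sv S n (Ep k W p (t + i * W * p : ℕ)) - (∑ p ∈ P, ∑ i : Fin k, wt p (t + i * W * p)) * sg S k / sg S 1) ^ 2)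
    + ∑ p ∈ P, 4 * sg S 1 / (K * sg S k) * k * (2 / sg S k) *
        (∑ m ∈ range (2 * y), wt p m * sv S n (Ep k W p m) - (∑ m ∈ range (2 * y), wt p m) * sg S k) ^ 2 := by
  classical
  have hσ := h.sg_pos 1 h.hk
  have hs := h.sg_pos k le_rfl
  set σ := sg S 1
  set s := sg S k
  set X : ℕ → ℝ := fun p => ∑ m ∈ range (2 * y), wt p m * sv S n (Ep k W p m) with hX
  set q : ℕ → ℕ → ℝ := fun p m => wt p m * sv S n (Ep k W p m) with hq
  have hq0 : ∀ p m, 0 ≤ q p m := fun p m => mul_nonneg (h.w0 p m) (sv_nonneg _ _ _)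
  set Y : ℕ → ℝ := fun t => ∑ p ∈ P.filter (fun p => ¬ X p ≤ 2 * s), ∑ i : Fin k, q p (t + i * W * p) with hY
  set Z : ℕ → ℝ := fun t => ∑ p ∈ P, ∑ i : Fin k, q p (t + i * W * p) with hZ
  set pr : ℕ → ℕ → ℝ := fun p m => if X p ≤ 2 * s then q p m / (2 * s) else 0 with hpr
  have hpr0 : ∀ p m, 0 ≤ pr p m := fun p m => by
    simp only [hpr]; split_ifs
    · exact div_nonneg (hq0 p m) (by positivity)
    · exact le_rfl
  have inj : ∀ p ∈ P, ∀ t, Function.Injective (fun i : Fin k => t + (i:ℕ) * W * p) := by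
    intro p hp t i i' hii
    have h1 : (i:ℕ) * (W * p) = i' * (W * p) := by simp only at hii; rw [← mul_assoc, ← mul_assoc]; omega
    exact Fin.ext (Nat.eq_of_mul_eq_mul_right (Nat.mul_pos h.hW (h.hP p hp).1.pos) h1)
  obtain ⟨f, hf⟩ := cover_exp (2 * y) (by omega) (fun p m t => (p:ℤ) ∣ (m:ℤ) - t) pr hpr0 (T.filter fun t : ℕ => sv S n {(t:ℤ)} = 1) P (fun p hp => by
      simp only [hpr]
      split_ifs with hx
      · rw [← sum_div, div_le_one (by positivity)]; exact hx
      · simp) (fun t => (Z t - Y t) / (2 * s)) (fun t ht => by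
      have e : (Z t - Y t) / (2 * s) = ∑ p ∈ P, ∑ i : Fin k, pr p (t + i * W * p) := by
        have : Z t - Y t = ∑ p ∈ P.filter (fun p => X p ≤ 2 * s), ∑ i : Fin k, q p (t + i * W * p) := by
          simp only [hZ, hY]
          rw [← sum_filter_add_sum_filter_not P (fun p => X p ≤ 2 * s)]; ring
        rw [this, sum_div, sum_filter]
        refine sum_congr rfl fun p _ => ?_
        simp only [hpr]
        split_ifs
        · rw [sum_div]
        · simp
      rw [e]
      refine sum_le_sum fun p hp => ?_
      rw [← sum_filter (p := fun m : ℕ => (p:ℤ) ∣ (m:ℤ) - t), ← sum_image (s := univ) (g := fun i : Fin k => t + (i:ℕ) * W * p) (f := pr p) (fun i _ i' _ hh => inj p hp t hh)]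
      refine sum_le_sum_of_subset_of_nonneg (fun m hm => ?_) fun m _ _ => hpr0 p m
      obtain ⟨i, -, rfl⟩ := mem_image.1 hm
      refine mem_filter.2 ⟨mem_range.2 (h.tlt hp (mem_filter.1 ht).1 i), ?_⟩
      push_cast
      exact ⟨(i:ℕ) * W, by ring⟩)
  refine ⟨f, ?_⟩
  rw [filter_filter] at hf
  have hmin : (#(T.filter fun t : ℕ => sv S n {(t:ℤ)} = 1 ∧ ∀ p ∈ P, ¬ (p:ℤ) ∣ (f p : ℤ) - t) : ℝ) ≤ ∑ t ∈ T, sv S n {(t:ℤ)} * exp (-((Z t - Y t) / (2 * s))) := by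
    refine hf.trans ?_
    rw [sum_filter]
    refine sum_le_sum fun t _ => ?_
    split_ifs with h1
    · rw [h1, one_mul]
    · exact mul_nonneg (sv_nonneg _ _ _) (exp_pos _).le
  have hYZ : ∀ t, 0 ≤ Z t - Y t := fun t => by
    simp only [hZ, hY]
    rw [sub_nonneg]
    exact sum_le_sum_of_subset_of_nonneg (filter_subset _ _) fun p _ _ => sum_nonneg fun i _ => hq0 _ _
  have hY0 : ∀ t, 0 ≤ Y t := fun t => sum_nonneg fun p _ => sum_nonneg fun i _ => hq0 _ _
  have hYs : ∑ t ∈ T, 4 * σ / (K * s) * Y t ≤ ∑ p ∈ P, 4 * σ / (K * s) * k * (2 / s) * (X p - (∑ m ∈ range (2 * y), wt p m) * s) ^ 2 := by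
    rw [← mul_sum]
    simp only [hY]
    rw [Finset.sum_comm, mul_sum, sum_filter]
    refine sum_le_sum fun p hp => ?_
    by_cases hc : ¬ X p ≤ 2 * s
    · rw [if_pos hc]
      push Not at hc
      have h1 := s5_num2 hs (h.w1 p hp) hc
      have h2 : ∑ t ∈ T, ∑ i : Fin k, q p (t + i * W * p) ≤ k * X p := by
        rw [Finset.sum_comm]
        calc _ ≤ ∑ i : Fin k, X p := by
              refine sum_le_sum fun i _ => ?_
              rw [← sum_image (s := T) (g := fun t => t + (i:ℕ) * W * p) (f := q p) (fun t _ t' _ hh => by simpa using hh)]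
              refine sum_le_sum_of_subset_of_nonneg (fun m hm => ?_) fun m _ _ => hq0 p m
              obtain ⟨t, ht, rfl⟩ := mem_image.1 hm
              exact mem_range.2 (h.tlt hp ht i)
          _ = _ := by simp
      calc _ ≤ 4 * σ / (K * s) * (k * X p) := by gcongr
        _ ≤ 4 * σ / (K * s) * (k * (2 / s * (X p - (∑ m ∈ range (2 * y), wt p m) * s) ^ 2)) := by gcongr
        _ = _ := by ring
    · rw [if_neg hc]; positivity
  refine hmin.trans ?_
  have key : ∀ t ∈ T, sv S n {(t:ℤ)} * exp (-((Z t - Y t) / (2 * s))) ≤ exp (-(K / (8 * σ))) * sv S n {(t:ℤ)} +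
      (if ∑ p ∈ P, ∑ i : Fin k, wt p (t + i * W * p) < K then sv S n {(t:ℤ)} else 0) +
      (if ¬ ∑ p ∈ P, ∑ i : Fin k, wt p (t + i * W * p) < K then 4 * σ ^ 2 / ((∑ p ∈ P, ∑ i : Fin k, wt p (t + i * W * p)) ^ 2 * s ^ 2) *
        (sv S n {(t:ℤ)} * (Z t - (∑ p ∈ P, ∑ i : Fin k, wt p (t + i * W * p)) * s / σ) ^ 2) else 0) + 4 * σ / (K * s) * Y t := by
    intro t _
    have a1 := sv_nonneg S n {(t:ℤ)}
    have a2 := sv_le_one S n {(t:ℤ)}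
    have a3 : exp (-((Z t - Y t) / (2 * s))) ≤ 1 := by
      rw [exp_le_one_iff, neg_nonpos]; exact div_nonneg (hYZ t) (by positivity)
    have a4 : 0 ≤ 4 * σ / (K * s) * Y t := mul_nonneg (by positivity) (hY0 t)
    have a5 := (exp_pos (-(K / (8 * σ)))).le
    by_cases hc : ∑ p ∈ P, ∑ i : Fin k, wt p (t + i * W * p) < K
    · rw [if_pos hc, if_neg (not_not.2 hc)]
      nlinarith [mul_nonneg a5 a1, mll a3 a1]
    · rw [if_neg hc, if_pos hc]
      push Not at hc
      have := s5_num (Z := Z t) hσ hs hK (hY0 t) hc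
      rw [min_eq_right a3] at this
      have := mll this a1
      nlinarith [mlr a2 a4]
  refine (sum_le_sum key).trans ?_
  rw [sum_add_distrib, sum_add_distrib, sum_add_distrib, ← sum_filter, ← sum_filter]
  exact add_le_add_right hYs _
lemma SH.final (h : SH x y k W N z ε S P T wt) (hy : 0 < y) (K : ℝ) (hK : 0 < K) : ∃ (n : ℕ) (f : ℕ → ℕ),
    (#(T.filter fun t : ℕ => sv S n {(t:ℤ)} = 1 ∧ ∀ p ∈ P, ¬ (p:ℤ) ∣ (f p : ℤ) - t) : ℝ) ≤
    #T * (exp (-(K / (8 * sg S 1))) * sg S 1) + #(T.filter (fun t => ∑ p ∈ P, ∑ i : Fin k, wt p (t + i * W * p) < K)) * sg S 1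
    + #T * (4 * ε * sg S 1 + 4 * k * sg S 1 ^ 2 / (K * sg S k ^ 2 * √x))
    + #P * (8 * k * sg S 1 / (K * sg S k ^ 2) * (ε * sg S k ^ 2 + k ^ 2 / √x)) := by
  choose f hf using h.det hy K hK
  have hσ := h.sg_pos 1 h.hk
  have hs := h.sg_pos k le_rfl
  have hx : (0:ℝ) < √x := Real.sqrt_pos.2 (by exact_mod_cast h.hx)
  have hε := h.hε0
  obtain ⟨n, hn⟩ := EX_exists S (fun s hs => (h.hS s hs).1.pos) (fun n => (#(T.filter fun t : ℕ => sv S n {(t:ℤ)} = 1 ∧ ∀ p ∈ P, ¬ (p:ℤ) ∣ (f n p : ℤ) - t) : ℝ))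
  refine ⟨n, f n, hn.trans ((EX_mono S _ _ hf).trans ?_)⟩
  simp only [EX_add, EX_sum, EX_mul, h.EXt, sum_const, nsmul_eq_mul]
  gcongr ?_ + ?_ + ?_ + ?_
  · exact le_rfl
  · exact le_rfl
  · calc _ ≤ ∑ t ∈ T.filter (fun t => ¬ ∑ p ∈ P, ∑ i : Fin k, wt p (t + i * W * p) < K), (4 * ε * sg S 1 + 4 * k * sg S 1 ^ 2 / (K * sg S k ^ 2 * √x)) := by
          refine sum_le_sum fun t ht => ?_
          obtain ⟨h1, h2⟩ := mem_filter.1 ht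
          push Not at h2
          have h3 := h.varZ h1 _ rfl
          set κ := ∑ p ∈ P, ∑ i : Fin k, wt p (t + i * W * p)
          have hκ : 0 < κ := lt_of_lt_of_le hK h2
          refine (mll h3 (by positivity)).trans ?_
          calc _ = 4 * ε * sg S 1 + 4 * k * sg S 1 ^ 2 / (κ * sg S k ^ 2 * √x) := by field_simp
            _ ≤ _ := by gcongr
      _ ≤ _ := by
          rw [sum_const, nsmul_eq_mul]
          gcongr
          exact filter_subset _ _
  · rw [← nsmul_eq_mul]
    refine sum_le_card_nsmul _ _ _ fun p hp => ?_
    refine (mll (h.varX hp) (by positivity)).trans (le_of_eq ?_)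
    field_simp; ring
end
section
lemma gap_red (Q y : ℕ) (a : ℕ → ℤ) (hQ : 2 ≤ Q) (hcov : ∀ e : ℕ, 1 ≤ e → e ≤ y → ∃ p : ℕ, p.Prime ∧ p ≤ Q ∧ (p:ℤ) ∣ e - a p)
    (X : ℝ) (hX : 2 * ((Q:ℝ) + 4 ^ Q + y) ≤ X) : (y:ℝ) ≤ G X := by
  set c := Nat.chineseRemainderOfFinset (fun p => ((-a p) % p - Q % p + p).toNat) (fun p => p) ((range (Q+1)).filter Nat.Prime)
    (fun p hp => (mem_filter.1 hp).2.ne_zero)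
    (fun p hp q hq hne => (Nat.coprime_primes (mem_filter.1 hp).2 (mem_filter.1 hq).2).2 hne) with hc
  have hlt : (c:ℕ) < 4 ^ Q := lt_of_lt_of_le (Nat.chineseRemainderOfFinset_lt_prod _ _ _ _) (primorial_le_four_pow Q)
  set N := Q + (c:ℕ) with hN
  have hcomp : ∀ e, 1 ≤ e → e ≤ y → ¬ (N + e).Prime := by
    intro e h1 h2 hpr
    obtain ⟨p, hp, hpQ, hd⟩ := hcov e h1 h2
    have hp0 : (0:ℤ) < p := by exact_mod_cast hp.pos
    have hcp := c.2 p (mem_filter.2 ⟨mem_range.2 (by omega), hp⟩)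
    have h3 := (Int.natCast_modEq_iff.2 hcp)
    have h4 : 0 ≤ (-a p) % p - Q % p + p := by
      have := Int.emod_nonneg (-a p) hp0.ne'
      have := Int.emod_lt_of_pos (Q:ℤ) hp0
      omega
    rw [Int.toNat_of_nonneg h4] at h3
    have h5 : (p:ℤ) ∣ ((N + e : ℕ) : ℤ) := by
      have h6 := h3.symm.dvd
      have h7 : (p:ℤ) ∣ (-a p) - (-a p) % p := Int.dvd_self_sub_emod
      have h8 : (p:ℤ) ∣ (Q:ℤ) - Q % p := Int.dvd_self_sub_emod
      have : ((N + e : ℕ) : ℤ) = ((c:ℕ) - ((-a p) % p - Q % p + p)) + (e - a p) - ((-a p) - (-a p) % p) + ((Q:ℤ) - Q % p) + p := by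
        rw [hN]; push_cast; ring
      rw [this]
      exact dvd_add (dvd_add (dvd_sub (dvd_add h6 hd) h7) h8) (dvd_refl _)
    have := (Nat.prime_dvd_prime_iff_eq hp hpr).1 (Int.natCast_dvd_natCast.1 h5)
    omega
  obtain ⟨q, hq, hq1, hq2⟩ := Nat.exists_prime_lt_and_le_two_mul (N + y) (by omega)
  set n := Nat.count Nat.Prime (N + 1) with hn
  have hn1 : 1 ≤ n := by
    have : Nat.count Nat.Prime 3 ≤ n := Nat.count_monotone _ (by omega)
    have h3 : Nat.count Nat.Prime 3 = 1 := by decide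
    omega
  have hp1 : nthPrime n ≤ N := by
    have := Nat.nth_lt_of_lt_count (p := Nat.Prime) (n := N + 1) (k := n - 1) (by omega)
    rw [nthPrime]; omega
  have hinf : (Set.ofPred Nat.Prime).Infinite := Nat.infinite_setOf_prime
  have hge : N + 1 ≤ Nat.nth Nat.Prime n := by
    by_contra hlt
    push Not at hlt
    have hpr : (Nat.nth Nat.Prime n).Prime := Nat.nth_mem_of_infinite hinf n
    have h1 := Nat.count_nth_of_infinite hinf n
    have h2 := Nat.count_strict_mono hpr hlt
    omega
  have hp2 : N + y + 1 ≤ nthPrime (n + 1) := by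
    rw [nthPrime, Nat.add_sub_cancel]
    have hpr : (Nat.nth Nat.Prime n).Prime := Nat.nth_mem_of_infinite hinf n
    by_contra hlt
    refine hcomp (Nat.nth Nat.Prime n - N) (by omega) (by omega) ?_
    rwa [Nat.add_sub_cancel' (by omega)]
  have hp3 : nthPrime (n + 1) ≤ q := by
    rw [nthPrime, Nat.add_sub_cancel]
    conv_rhs => rw [← Nat.nth_count hq]
    exact Nat.nth_monotone hinf (Nat.count_monotone _ (by omega))
  have h1 : (nthPrime (n + 1) : ℝ) - nthPrime n ≤ G X := by
    refine le_csSup ⟨X, ?_⟩ ⟨n, hn1, ?_, rfl⟩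
    · rintro d ⟨m, -, hm, rfl⟩
      have : (0:ℝ) ≤ nthPrime m := Nat.cast_nonneg _
      linarith
    · have h5 : (nthPrime (n + 1) : ℝ) ≤ 2 * ((Q:ℝ) + (c:ℕ) + y) := by exact_mod_cast hp3.trans (by omega)
      have h6 : ((c:ℕ) : ℝ) ≤ 4 ^ Q := by exact_mod_cast hlt.le
      linarith
  have h2 : (nthPrime n : ℝ) ≤ N := by exact_mod_cast hp1
  have h3 : ((N + y + 1 : ℕ) : ℝ) ≤ nthPrime (n + 1) := by exact_mod_cast hp2
  push_cast at h3
  linarith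
lemma cover_fin (x y z v D : ℕ) (hz : z ≤ v) (hv : v ≤ x) (hD : 1 ≤ D) (n : ℕ) (f : ℕ → ℕ) (hy : y ≤ x * z)
    (U V : Finset ℕ)
    (hU : ∀ t, t.Prime → x < t → t ≤ y → (∀ s, s.Prime → z < s → s ≤ v → ¬ (s:ℤ) ∣ (t:ℤ) + n) → (∀ p, p.Prime → x < p → p ≤ D * x → ¬ (p:ℤ) ∣ (f p : ℤ) - t) → t ∈ U)
    (hV : ∀ e, 1 ≤ e → e ≤ y → (∀ p, p.Prime → p ∣ e → p ≤ v) → e ∈ V)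
    (P' : Finset ℕ) (hP' : ∀ p ∈ P', p.Prime ∧ D * x < p ∧ p ≤ D * (D * x)) (hcard : #U + #V ≤ #P') :
    ∃ a : ℕ → ℤ, ∀ e : ℕ, 1 ≤ e → e ≤ y → ∃ p : ℕ, p.Prime ∧ p ≤ D * (D * x) ∧ (p:ℤ) ∣ e - a p := by
  classical
  have hc : Fintype.card (↥(U ∪ V)) ≤ Fintype.card (↥P') := by
    rw [Fintype.card_coe, Fintype.card_coe]; exact (card_union_le _ _).trans hcard
  obtain ⟨g⟩ := Function.Embedding.nonempty_of_card_le hc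
  have hg : ∀ e ∈ U ∪ V, ∃ p ∈ P', ∀ h : p ∈ P', ∃ (h' : e ∈ U ∪ V), g ⟨e, h'⟩ = ⟨p, h⟩ := fun e he =>
    ⟨g ⟨e, he⟩, (g ⟨e, he⟩).2, fun h => ⟨he, rfl⟩⟩
  set b : ℕ → ℤ := fun p => if h : ∃ e : ↥(U ∪ V), (g e : ℕ) = p then ((h.choose : ℕ) : ℤ) else 0 with hb
  have hbg : ∀ e : ↥(U ∪ V), b (g e) = (e : ℕ) := by
    intro e
    have h : ∃ e' : ↥(U ∪ V), (g e' : ℕ) = g e := ⟨e, rfl⟩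
    simp only [hb]
    rw [dif_pos h]
    have := g.injective (Subtype.ext h.choose_spec)
    rw [this]
  have hx1 : D * x ≤ D * (D * x) := Nat.le_mul_of_pos_left _ hD
  have hx0 : x ≤ D * x := Nat.le_mul_of_pos_left _ hD
  refine ⟨fun p => if p ≤ z then 0 else if p ≤ v then -n else if p ≤ x then 0 else if p ≤ D * x then f p else b p, fun e h1 h2 => ?_⟩
  by_contra hno
  push Not at hno
  have n1 : ∀ p, p.Prime → p ≤ z → ¬ p ∣ e := fun p hp hpz hd => by
    refine hno p hp (by omega) ?_
    rw [if_pos hpz, sub_zero]; exact_mod_cast hd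
  have n2 : ∀ p, p.Prime → z < p → p ≤ v → ¬ (p:ℤ) ∣ (e:ℤ) + n := fun p hp hpz hpv hd => by
    refine hno p hp (by omega) ?_
    rw [if_neg (by omega), if_pos hpv, sub_neg_eq_add]; exact hd
  have n3 : ∀ p, p.Prime → v < p → p ≤ x → ¬ p ∣ e := fun p hp hpz hpv hd => by
    refine hno p hp (by omega) ?_
    rw [if_neg (by omega), if_neg (by omega), if_pos hpv, sub_zero]; exact_mod_cast hd
  have n4 : ∀ p, p.Prime → x < p → p ≤ D * x → ¬ (p:ℤ) ∣ (f p : ℤ) - e := fun p hp hpz hpv hd => by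
    refine hno p hp (by omega) ?_
    rw [if_neg (by omega), if_neg (by omega), if_neg (by omega), if_pos hpv, ← dvd_neg, neg_sub]; exact_mod_cast hd
  have n5 : e ∉ U ∪ V := fun he => by
    have hp := hP' _ (g ⟨e, he⟩).2
    refine hno (g ⟨e, he⟩) hp.1 hp.2.2 ?_
    rw [if_neg (by omega), if_neg (by omega), if_neg (by omega), if_neg (by omega), hbg]
    simp
  by_cases hsm : ∀ p, p.Prime → p ∣ e → p ≤ v
  · exact n5 (mem_union_right _ (hV e h1 h2 hsm))
  · push Not at hsm
    obtain ⟨p, hp, ⟨m, hm⟩, hpv⟩ := hsm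
    have hpx : x < p := by
      by_contra h
      exact n3 p hp hpv (by omega) ⟨m, hm⟩
    have hm1 : m = 1 := by
      by_contra hne
      have hq := Nat.minFac_prime hne
      have hm0 : 0 < m := Nat.pos_of_ne_zero fun h => by rw [h] at hm; omega
      have hqm := Nat.minFac_le hm0
      refine n1 _ hq ?_ (hm ▸ (Nat.minFac_dvd m).mul_left p)
      by_contra hz'
      have : x * z < p * m := Nat.mul_lt_mul'' hpx (by omega)
      omega
    rw [hm1, mul_one] at hm
    subst hm
    exact n5 (mem_union_left _ (hU e hp hpx h2 n2 n4))
end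
section
lemma sg_one_eq (z v : ℕ) (hzv : z ≤ v) : sg (v.primesLE.filter (z < ·)) 1 * PP v = PP z := by
  have h : v.primesLE.filter (fun s => ¬ z < s) = z.primesLE := by
    ext p; simp only [mem_filter, Nat.mem_primesLE]; constructor
    · rintro ⟨⟨h1, h2⟩, h3⟩; exact ⟨by omega, h2⟩
    · rintro ⟨h1, h2⟩; exact ⟨⟨by omega, h2⟩, by omega⟩
  rw [PP, PP, ← prod_filter_mul_prod_filter_not v.primesLE (z < ·), h, ← mul_assoc, sg, ← pmd, prod_eq_one, one_mul]
  intro p hp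
  have : (2:ℝ) ≤ p := by exact_mod_cast (Nat.mem_primesLE.1 (mem_filter.1 hp).1).2.two_le
  rw [Nat.cast_one, mul_inv_cancel₀]
  have h1 : 1 / (p:ℝ) ≤ 1 / 2 := by gcongr
  linarith
lemma sg_pow (S : Finset ℕ) (k : ℕ) (hS : ∀ s ∈ S, 2 * k ≤ s ∧ 2 ≤ s) : sg S 1 ^ (2 * k) ≤ sg S k := by
  rw [sg, sg, ← prod_pow]
  refine prod_le_prod (fun s hs => ?_) fun s hs => ?_
  · exact Even.pow_nonneg (even_two_mul k) _
  · obtain ⟨h1, h2⟩ := hS s hs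
    have h2' : (2:ℝ) ≤ s := by exact_mod_cast h2
    have h3 : 1 / (s:ℝ) ≤ 1 / 2 := by gcongr
    have h4 : (2 * k / s : ℝ) ≤ 1 := by rw [div_le_one (by linarith)]; exact_mod_cast h1
    have h0 : (0:ℝ) ≤ 2 * k / s := by positivity
    set u : ℝ := 2 * k / s with hu
    have e : (k:ℝ) / s = u / 2 := by rw [hu]; ring
    rw [e, Nat.cast_one]
    calc (1 - 1 / (s:ℝ)) ^ (2 * k) ≤ (exp (-(1 / s))) ^ (2 * k) := by
          gcongr
          · linarith
          · linarith [add_one_le_exp (-(1 / (s:ℝ)))]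
      _ = exp (-u) := by rw [← exp_nat_mul, hu]; push_cast; congr 1; ring
      _ ≤ 1 - u / 2 := by
          rw [exp_neg, inv_le_iff_one_le_mul₀ (exp_pos _)]
          have := add_one_le_exp u
          nlinarith
lemma rankin (v y : ℕ) (hv : 2 ≤ v) (η V : ℝ) (hη : 0 < η) (hη2 : η ≤ 1 / 2) (hV : 1 ≤ V) (hvV : log v ≤ V) (F : Finset ℕ)
    (hF : ∀ e ∈ F, 1 ≤ e ∧ e ≤ y ∧ ∀ p, p.Prime → p ∣ e → p ≤ v) :
    (#F : ℝ) ≤ (y:ℝ) ^ (1 - η) * (CM * V * exp (10 * exp (η * V))) := by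
  have hp1 : ∀ p : ℕ, p.Prime → 0 < powHom (1 - η) p ∧ powHom (1 - η) p ≤ 3 / 4 := fun p hp => by
    have hp2 : (2:ℝ) ≤ p := by exact_mod_cast hp.two_le
    simp only [powHom, MonoidHom.coe_mk, OneHom.coe_mk]
    refine ⟨by positivity, ?_⟩
    calc (p:ℝ) ^ (-(1 - η)) ≤ (p:ℝ) ^ (-(1/2) : ℝ) := rpow_le_rpow_of_exponent_le (by linarith) (by linarith)
      _ ≤ (2:ℝ) ^ (-(1/2) : ℝ) := rpow_le_rpow_of_nonpos (by norm_num) hp2 (by norm_num)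
      _ ≤ 3 / 4 := by
          rw [rpow_neg (by norm_num), ← sqrt_eq_rpow, inv_le_comm₀ (by positivity) (by norm_num)]
          rw [Real.le_sqrt (by norm_num) (by norm_num)]; norm_num
  have h := EulerProduct.summable_and_hasSum_smoothNumbers_prod_primesBelow_geometric (f := powHom (1 - η)) (fun {p} hp => by
    rw [Real.norm_of_nonneg (hp1 p hp).1.le]; linarith [(hp1 p hp).2]) (v + 1)
  have hn : ∀ m : (v+1).smoothNumbers, 0 ≤ powHom (1 - η) m := fun m => by
    simp only [powHom, MonoidHom.coe_mk, OneHom.coe_mk]; positivity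
  have hsm : ∀ e ∈ F, e ∈ (v+1).smoothNumbers := fun e he => Nat.mem_smoothNumbers.2 ⟨by have := (hF e he).1; omega, fun p hp => by
    have := (hF e he).2.2 p (Nat.prime_of_mem_primeFactorsList hp) (Nat.dvd_of_mem_primeFactorsList hp); omega⟩
  have h2 : ∑ e ∈ F, powHom (1 - η) e ≤ ∏ p ∈ v.primesLE, (1 - powHom (1 - η) p)⁻¹ := by
    have h3 := h.2.summable.sum_le_tsum (F.attach.image fun e : {e // e ∈ F} => (⟨e.1, hsm e.1 e.2⟩ : (v+1).smoothNumbers)) (fun m _ => hn m)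
    rw [sum_image (by intro a _ b _ hab; exact Subtype.ext (congrArg (fun m : (v+1).smoothNumbers => (m.1 : ℕ)) hab)), h.2.tsum_eq] at h3
    rw [← sum_attach]; exact h3
  have h4 : (#F : ℝ) ≤ (y:ℝ) ^ (1 - η) * ∑ e ∈ F, powHom (1 - η) e := by
    rw [mul_sum, card_eq_sum_ones, Nat.cast_sum]
    refine sum_le_sum fun e he => ?_
    obtain ⟨h1, h2, -⟩ := hF e he
    have he : (0:ℝ) < e := by exact_mod_cast h1
    simp only [powHom, MonoidHom.coe_mk, OneHom.coe_mk]
    rw [rpow_neg he.le, ← div_eq_mul_inv, le_div_iff₀ (by positivity), Nat.cast_one, one_mul]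
    exact rpow_le_rpow he.le (by exact_mod_cast h2) (by linarith)
  refine h4.trans (mll (h2.trans ?_) (by positivity))
  have h5 : ∀ p ∈ v.primesLE, (1 - powHom (1 - η) p)⁻¹ ≤ (1 - 1 / (p:ℝ))⁻¹ * exp (4 * exp (η * V) / V * (log p / p)) := fun p hp => by
    obtain ⟨hpv, hpp⟩ := Nat.mem_primesLE.1 hp
    obtain ⟨a1, a2⟩ := hp1 p hpp
    have hp2 : (2:ℝ) ≤ p := by exact_mod_cast hpp.two_le
    have hp0 : (0:ℝ) < p := by linarith
    have e4 : 1 / (p:ℝ) ≤ 1 / 2 := by gcongr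
    have hlp : 0 ≤ log p := Real.log_natCast_nonneg _
    have e1 : powHom (1 - η) p = (1 / p) * (p:ℝ) ^ η := by
      simp only [powHom, MonoidHom.coe_mk, OneHom.coe_mk]
      rw [neg_sub, sub_eq_add_neg, rpow_add hp0, rpow_neg_one]; ring
    have hθ : log p / V ≤ 1 := by
      rw [div_le_one (by linarith)]
      exact (Real.log_le_log hp0 (by exact_mod_cast hpv)).trans hvV
    have e2 : (p:ℝ) ^ η ≤ 1 + log p / V * exp (η * V) := by
      have := convexOn_exp.2 (Set.mem_univ (η * V)) (Set.mem_univ 0) (by positivity : 0 ≤ log p / V) (by linarith : 0 ≤ 1 - log p / V) (by ring)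
      simp only [smul_eq_mul, mul_zero, add_zero, exp_zero, mul_one] at this
      rw [rpow_def_of_pos hp0, show log p * η = log p / V * (η * V) by field_simp]
      have : 0 ≤ log p / V := by positivity
      linarith
    set w := log p / V * exp (η * V) with hw
    have hw0 : 0 ≤ w := by positivity
    rw [show 4 * exp (η * V) / V * (log p / p) = 4 * (w / p) by rw [hw]; ring]
    have e3 : powHom (1 - η) p - 1 / p ≤ w / p := by
      rw [e1]
      calc _ = (1 / (p:ℝ)) * ((p:ℝ) ^ η - 1) := by ring
        _ ≤ (1 / (p:ℝ)) * w := by gcongr; linarith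
        _ = _ := by ring
    rw [inv_mul_eq_div, inv_eq_one_div, ddi (by linarith) (by linarith)]
    have e5 := add_one_le_exp (4 * (w / p))
    have e6 : 0 ≤ w / p := by positivity
    nlinarith
  calc _ ≤ ∏ p ∈ v.primesLE, ((1 - 1 / (p:ℝ))⁻¹ * exp (4 * exp (η * V) / V * (log p / p))) :=
        prod_le_prod (fun p hp => inv_nonneg.2 (by linarith [(hp1 p (Nat.mem_primesLE.1 hp).2).2])) h5
    _ = PP v * exp (4 * exp (η * V) / V * ∑ p ∈ v.primesLE, log p / p) := by rw [pmd, ← exp_sum, ← mul_sum, PP]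
    _ ≤ (CM * V) * exp (10 * exp (η * V)) := by
        have h1 := mertens_upper v hv
        have h2 := sum_log_div_le v (by omega)
        have hl4 : log 4 ≤ 1.5 := by
          rw [show (4:ℝ) = 2 ^ 2 by norm_num, Real.log_pow]; have := Real.log_two_lt_d9; push_cast; linarith
        have h3 : (0:ℝ) < CM := by positivity
        refine mul_le_mul (h1.trans ?_) (exp_le_exp.2 ?_) (exp_pos _).le (by positivity)
        · gcongr
        · calc _ ≤ 4 * exp (η * V) / V * (2.5 * V) := by gcongr; linarith
            _ = _ := by field_simp; ring
end
section
lemma card_between (x y : ℕ) (h : x ≤ y) : (#(y.primesLE.filter (x < ·)) : ℝ) = y.primeCounting - x.primeCounting := by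
  have h1 : y.primesLE.filter (fun s => ¬ x < s) = x.primesLE := by
    ext p; simp only [mem_filter, Nat.mem_primesLE]; constructor
    · rintro ⟨⟨h1, h2⟩, h3⟩; exact ⟨by omega, h2⟩
    · rintro ⟨h1, h2⟩; exact ⟨⟨by omega, h2⟩, by omega⟩
  have h2 := card_filter_add_card_filter_not (s := y.primesLE) (x < ·)
  rw [h1, Nat.primesLE_card_eq_primeCounting, Nat.primesLE_card_eq_primeCounting] at h2
  rw [eq_sub_iff_add_eq]; exact_mod_cast h2
lemma cheb : ∃ x1 : ℕ, ∀ n ≥ x1, (n.primeCounting : ℝ) ≤ 2 * n / log n ∧ n / (2 * log n) ≤ (n.primeCounting : ℝ) := by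
  have h1 := tendsto_natCast_atTop_atTop (R := ℝ) |>.eventually (Chebyshev.eventually_primeCounting_le (ε := 0.5) (by norm_num))
  have h2 : ∀ᶠ n : ℕ in atTop, log n / n < 0.01 := by
    have := (Real.isLittleO_log_id_atTop.tendsto_div_nhds_zero).comp (tendsto_natCast_atTop_atTop (R := ℝ))
    exact this.eventually_lt_const (by norm_num)
  obtain ⟨x1, hx⟩ := eventually_atTop.1 (h1.and (h2.and (eventually_ge_atTop 2)))
  refine ⟨x1, fun n hn => ?_⟩
  obtain ⟨a, b, c⟩ := hx n hn
  rw [Nat.floor_natCast] at a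
  have hn2 : (2:ℝ) ≤ n := by exact_mod_cast c
  have hl : 0 < log n := Real.log_pos (by linarith)
  have hl2 := Real.log_two_gt_d9
  have hl2' := Real.log_two_lt_d9
  constructor
  · refine a.trans ?_
    gcongr
    rw [show (4:ℝ) = 2 ^ 2 by norm_num, Real.log_pow]; push_cast; linarith
  · refine le_trans ?_ (Chebyshev.pi_ge n)
    rw [← div_div]
    gcongr
    have h3 : log (n + 1) ≤ log n + log 2 := by
      rw [← Real.log_mul (by linarith) (by norm_num)]
      exact Real.log_le_log (by linarith) (by linarith)
    have h4 : log n < 0.01 * n := by rwa [div_lt_iff₀ (by linarith)] at b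
    have hb : 0.01 * (n:ℝ) ≥ 0 := by positivity
    have h5 : 2 ≤ 100 * 0.01 * (n:ℝ) := by linarith
    have h6 : (100:ℝ) ≤ n ∨ (n:ℝ) < 100 := le_or_gt _ _
    rcases h6 with h6 | h6
    · nlinarith
    · have : log 2 ≤ log n := Real.log_le_log (by norm_num) hn2
      nlinarith
lemma cheb2 : ∃ x1 : ℕ, ∀ x ≥ x1, (x:ℝ) / log x ≤ #((12 * x).primesLE.filter (x < ·)) ∧
    (x:ℝ) / log x ≤ #((12 * (12 * x)).primesLE.filter (12 * x < ·)) ∧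
    ∀ y ≥ x, (#(y.primesLE.filter (x < ·)) : ℝ) ≤ 2 * y / log x := by
  obtain ⟨x1, h⟩ := cheb
  have key : ∀ x ≥ max x1 12, (x:ℝ) / log x ≤ #((12 * x).primesLE.filter (x < ·)) ∧ log ((12 * x : ℕ):ℝ) ≤ 2 * log x := by
    intro x hx
    have hx1 := le_of_max_le_left hx
    have hx2 : (12:ℝ) ≤ x := by exact_mod_cast le_of_max_le_right hx
    have hl : 0 < log x := Real.log_pos (by linarith)
    have h2 : log ((12 * x : ℕ):ℝ) ≤ 2 * log x := by
      push_cast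
      rw [Real.log_mul (by norm_num) (by linarith)]
      have := Real.log_le_log (by norm_num) hx2
      linarith
    refine ⟨?_, h2⟩
    rw [card_between _ _ (by omega)]
    have h3 := (h (12 * x) (by omega)).2
    have h4 := (h x hx1).1
    have h0 : 0 < log ((12 * x : ℕ):ℝ) := Real.log_pos (by push_cast; linarith)
    have h5 : ((12 * x : ℕ):ℝ) / (2 * (2 * log x)) ≤ ((12 * x : ℕ):ℝ) / (2 * log ((12 * x : ℕ):ℝ)) := by gcongr
    have e1 : ((12 * x : ℕ):ℝ) / (2 * (2 * log x)) = 3 * (x / log x) := by push_cast; field_simp; ring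
    have e2 : 2 * (x:ℝ) / log x = 2 * (x / log x) := by ring
    linarith
  refine ⟨max x1 12, fun x hx => ⟨(key x hx).1, ?_, fun y hy => ?_⟩⟩
  · have hx2 : (12:ℝ) ≤ x := by exact_mod_cast le_of_max_le_right hx
    have hl : 0 < log x := Real.log_pos (by linarith)
    refine le_trans ?_ (key (12 * x) (by omega)).1
    have := (key x hx).2
    have h0 : 0 < log ((12 * x : ℕ):ℝ) := Real.log_pos (by push_cast; linarith)
    rw [ddi hl h0]
    push_cast at this ⊢
    nlinarith
  · have hx1 := le_of_max_le_left hx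
    have hx2 : (12:ℝ) ≤ x := by exact_mod_cast le_of_max_le_right hx
    have hl : 0 < log x := Real.log_pos (by linarith)
    rw [card_between _ _ hy]
    have h3 := (h y (by omega)).1
    have : (0:ℝ) ≤ x.primeCounting := Nat.cast_nonneg _
    have hlog : log x ≤ log y := Real.log_le_log (by linarith) (by exact_mod_cast hy)
    have : 2 * (y:ℝ) / log y ≤ 2 * y / log x := by gcongr
    linarith
lemma final_num {X L σ sk y K η ε k τ β pn F A0 q r : ℝ} (hX : 0 < X) (hL : 0 < L) (hσ : 0 < σ) (hσ1 : σ ≤ 1) (hq : 0 < q) (hsk : q ≤ sk)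
    (hy : 0 < y) (hyL : y ≤ X * L) (hA : 0 < A0) (hσy : σ * y ≤ A0 * X) (hK : K = 128 * A0 ^ 2) (hη : η = 1 / (8 * A0)) (hε0 : 0 ≤ ε)
    (hτ : τ ≤ 2 * y / L) (hβ : β ≤ η * (y / L)) (hpn : pn ≤ 12 * X) (hk : 0 < k) (hr : 0 < r)
    (c1 : 64 * A0 * ε ≤ 1) (c2 : 64 * k * L ^ 2 ≤ K * q ^ 2 * r) (c3 : 768 * k * A0 * ε * L ≤ K) (c4 : 768 * k ^ 3 * L ^ 2 ≤ K * q ^ 2 * r)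
    (hF : F ≤ X / (8 * L)) :
    τ * (exp (-(K * (X / y) / (8 * σ))) * σ) + β * σ + τ * (4 * ε * σ + 4 * k * σ ^ 2 / (K * (X / y) * sk ^ 2 * r))
      + pn * (8 * k * σ / (K * (X / y) * sk ^ 2) * (ε * sk ^ 2 + k ^ 2 / r)) + F ≤ X / L := by
  have hsk0 : 0 < sk := lt_of_lt_of_le hq hsk
  have hK0 : 0 < K := by rw [hK]; positivity
  have ta : τ * (exp (-(K * (X / y) / (8 * σ))) * σ) ≤ 1 / 8 * (X / L) := by
    have h1 : exp (-(K * (X / y) / (8 * σ))) ≤ 8 * A0 / K := by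
      calc _ ≤ exp (-(K / (8 * A0))) := by
            apply exp_le_exp.2; rw [neg_le_neg_iff, ddi (by positivity) (by positivity)]
            rw [show K * (X / y) * (8 * A0) = K * 8 * (A0 * X) / y by ring, le_div_iff₀ hy]
            nlinarith [mll hσy (by positivity : 0 ≤ K * 8)]
        _ ≤ _ := by
            rw [exp_neg, inv_le_comm₀ (exp_pos _) (by positivity), inv_div]
            linarith [add_one_le_exp (K / (8 * A0))]
    calc _ ≤ 2 * y / L * (8 * A0 / K * σ) := by gcongr
      _ = 16 * A0 / (K * L) * (σ * y) := by ring
      _ ≤ 16 * A0 / (K * L) * (A0 * X) := by gcongr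
      _ = _ := by rw [hK]; field_simp; norm_num
  have tb : β * σ ≤ 1 / 8 * (X / L) := by
    calc _ ≤ η * (y / L) * σ := by gcongr
      _ = 1 / (8 * A0 * L) * (σ * y) := by rw [hη]; field_simp
      _ ≤ 1 / (8 * A0 * L) * (A0 * X) := by gcongr
      _ = _ := by field_simp
  have tc1 : τ * (4 * ε * σ) ≤ 1 / 8 * (X / L) := by
    calc _ ≤ 2 * y / L * (4 * ε * σ) := by gcongr
      _ = 8 * ε / L * (σ * y) := by ring
      _ ≤ 8 * ε / L * (A0 * X) := by gcongr
      _ = (64 * A0 * ε) * (1 / 8 * (X / L)) := by ring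
      _ ≤ _ := mul_le_of_le_one_left (by positivity) c1
  have tc2 : τ * (4 * k * σ ^ 2 / (K * (X / y) * sk ^ 2 * r)) ≤ 1 / 8 * (X / L) := by
    calc _ ≤ 2 * y / L * (4 * k * 1 ^ 2 / (K * (X / y) * q ^ 2 * r)) := by gcongr
      _ = 8 * k * y * y / (L * K * X * q ^ 2 * r) := by field_simp; ring
      _ ≤ 8 * k * (X * L) * (X * L) / (L * K * X * q ^ 2 * r) := by gcongr
      _ = (64 * k * L ^ 2) / (K * q ^ 2 * r) * (1 / 8 * (X / L)) := by field_simp; ring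
      _ ≤ _ := mul_le_of_le_one_left (by positivity) ((div_le_one (by positivity)).2 c2)
  have td1 : pn * (8 * k * σ / (K * (X / y) * sk ^ 2) * (ε * sk ^ 2)) ≤ 1 / 8 * (X / L) := by
    calc _ ≤ 12 * X * (8 * k * σ / (K * (X / y) * sk ^ 2) * (ε * sk ^ 2)) := by gcongr
      _ = 96 * k * ε / K * (σ * y) := by field_simp; ring
      _ ≤ 96 * k * ε / K * (A0 * X) := by gcongr
      _ = (768 * k * A0 * ε * L) / K * (1 / 8 * (X / L)) := by field_simp; ring
      _ ≤ _ := mul_le_of_le_one_left (by positivity) ((div_le_one (by positivity)).2 c3)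
  have td2 : pn * (8 * k * σ / (K * (X / y) * sk ^ 2) * (k ^ 2 / r)) ≤ 1 / 8 * (X / L) := by
    calc _ ≤ 12 * X * (8 * k * 1 / (K * (X / y) * q ^ 2) * (k ^ 2 / r)) := by gcongr
      _ = 96 * k ^ 3 / (K * q ^ 2 * r) * y := by field_simp; ring
      _ ≤ 96 * k ^ 3 / (K * q ^ 2 * r) * (X * L) := by gcongr
      _ = (768 * k ^ 3 * L ^ 2) / (K * q ^ 2 * r) * (1 / 8 * (X / L)) := by field_simp; ring
      _ ≤ _ := mul_le_of_le_one_left (by positivity) ((div_le_one (by positivity)).2 c4)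
  have tF : F ≤ 1 / 8 * (X / L) := hF.trans (le_of_eq (by field_simp))
  have : 0 < X / L := by positivity
  rw [mul_add, mul_add (8 * k * σ / (K * (X / y) * sk ^ 2)), mul_add]
  linarith
end
section
lemma rankin_app {x y v : ℕ} {t l m : ℝ} (hx : 1 ≤ x) (ht : t = log x) (hl : l = log t) (hm : m = log l) (h20 : 20 ≤ m) (hl1 : 1 ≤ l)
    (h400 : 400 * l ^ 2 ≤ t) (hC : 8 * CM ≤ t) (hy : (y:ℝ) ≤ x * t) (hv2 : 2 ≤ v) (hv : log v ≤ t * m / (10 * l))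
    (F : Finset ℕ) (hF : ∀ e ∈ F, 1 ≤ e ∧ e ≤ y ∧ ∀ p : ℕ, p.Prime → p ∣ e → p ≤ v) : (#F : ℝ) ≤ x / (8 * t) := by
  have hx0 : (0:ℝ) < x := by exact_mod_cast hx
  have ht1 : 400 ≤ t := by nlinarith
  have hl0 : 0 < l := by linarith
  have htl : exp l = t := by rw [hl, exp_log (by linarith)]
  have hlm : exp m = l := by rw [hm, exp_log (by linarith)]
  have hml : m ≤ l := by linarith [add_one_le_exp m]
  have hxt : exp t = x := by rw [ht, exp_log hx0]
  have hCM : 0 < CM := by positivity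
  have hη : 5 * l / t ≤ 1 / 2 := by rw [ddi (by linarith) (by norm_num)]; nlinarith
  have hV1 : 1 ≤ t * m / (10 * l) := by rw [le_div_iff₀ (by linarith)]; nlinarith
  have hVt : t * m / (10 * l) ≤ t := by rw [div_le_iff₀ (by linarith)]; nlinarith
  have h := rankin v y hv2 (5 * l / t) (t * m / (10 * l)) (by positivity) hη hV1 hv F hF
  have e1 : 5 * l / t * (t * m / (10 * l)) = m / 2 := by field_simp; norm_num
  rw [e1] at h
  have e2 : 10 * exp (m / 2) ≤ l := by
    have : exp (m/2) * exp (m/2) = l := by rw [← exp_add, ← hlm]; ring_nf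
    nlinarith [add_one_le_exp (m/2), exp_pos (m/2)]
  have e3 : (y:ℝ) ^ (1 - 5 * l / t) ≤ x * t / t ^ 5 := by
    calc _ ≤ ((x:ℝ) * t) ^ (1 - 5 * l / t) := rpow_le_rpow (by positivity) hy (by linarith)
      _ = (x:ℝ) ^ (1 - 5 * l / t) * t ^ (1 - 5 * l / t) := mul_rpow hx0.le (by linarith)
      _ ≤ (x / t ^ 5) * t := by
        gcongr
        · rw [rpow_sub hx0, rpow_one]
          apply le_of_eq; congr 1
          rw [rpow_def_of_pos hx0, ← ht, ← htl, ← exp_nat_mul, htl]; congr 1; field_simp; norm_num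
        · calc _ ≤ t ^ (1:ℝ) := rpow_le_rpow_of_exponent_le (by linarith) (by have : 0 ≤ 5 * l / t := by positivity
                                                                              linarith)
            _ = t := rpow_one t
      _ = _ := by ring
  calc (#F : ℝ) ≤ _ := h
    _ ≤ x * t / t ^ 5 * (CM * t * exp l) := by gcongr
    _ = x * CM / t ^ 2 := by rw [htl]; field_simp
    _ ≤ _ := by
      rw [ddi (by positivity) (by linarith)]
      nlinarith [mll hC (by positivity : 0 ≤ x * t)]
lemma eps_app {k N : ℕ} {t : ℝ} (ht : 1 ≤ t) (hN : (N:ℝ) ≤ 9 * t) (hk : 36 * (k:ℝ) ^ 3 ≤ t) :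
    (1 + 2 * k / t ^ 20) ^ (k * k * N) ≤ 1 + 1 / t ^ 10 := by
  have ht0 : 0 < t := by linarith
  have hu : 18 * (k:ℝ) ^ 3 / t ^ 19 ≤ 1 / (2 * t ^ 10) := by
    rw [ddi (by positivity) (by positivity)]
    have : t ≤ t ^ 9 := le_self_pow₀ ht (by norm_num)
    have := mlr (hk.trans this) (by positivity : 0 ≤ t ^ 10)
    nlinarith [this]
  have h1 : 1 / (2 * t ^ 10) ≤ 1 / 2 := by
    rw [ddi (by positivity) (by positivity)]; linarith [one_le_pow₀ ht (n := 10)]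
  calc _ ≤ (exp (2 * k / t ^ 20)) ^ (k * k * N) := by
        gcongr; linarith [add_one_le_exp (2 * k / t ^ 20)]
    _ = exp (2 * k ^ 3 / t ^ 20 * N) := by rw [← exp_nat_mul]; push_cast; ring_nf
    _ ≤ exp (2 * k ^ 3 / t ^ 20 * (9 * t)) := by gcongr
    _ = exp (18 * k ^ 3 / t ^ 19) := by congr 1; field_simp; ring
    _ ≤ exp (1 / (2 * t ^ 10)) := by gcongr
    _ ≤ 1 + 1 / t ^ 10 := by
      set u := 1 / (2 * t ^ 10) with hudef
      have hu0 : 0 < u := by positivity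
      have h3 : 1 / t ^ 10 = 2 * u := by rw [hudef]; field_simp
      rw [h3]
      have h2 := add_one_le_exp (-u)
      rw [exp_neg, inv_eq_one_div, le_div_iff₀ (exp_pos _)] at h2
      nlinarith [exp_pos u]
end
section
lemma asy (B : ℝ) (j : ℕ) : ∀ᶠ t : ℝ in atTop, B ≤ t ∧ B ≤ log t ∧ 20 ≤ log (log t) ∧ B * (log t) ^ 2 ≤ t ∧ B * t ^ j ≤ exp (t / 2) := by
  have hl := Real.tendsto_log_atTop
  have h4 : ∀ᶠ t : ℝ in atTop, B * (log t) ^ 2 ≤ t := by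
    have := (tendsto_exp_div_pow_atTop 2).comp hl
    filter_upwards [this.eventually_ge_atTop B, eventually_gt_atTop 1] with t h ht
    have h0 := Real.log_pos ht
    simp only [Function.comp] at h
    rw [le_div_iff₀ (by positivity), exp_log (by linarith)] at h; exact h
  have h5 : ∀ᶠ t : ℝ in atTop, B * t ^ j ≤ exp (t / 2) := by
    have := (tendsto_exp_div_pow_atTop j).comp (tendsto_id.atTop_div_const (by norm_num : (0:ℝ) < 2))
    filter_upwards [this.eventually_ge_atTop (B * 2 ^ j), eventually_gt_atTop 0] with t h ht
    simp only [Function.comp, id] at h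
    rw [le_div_iff₀ (by positivity), div_pow] at h
    calc _ = B * 2 ^ j * (t ^ j / 2 ^ j) := by field_simp
      _ ≤ _ := h
  filter_upwards [eventually_ge_atTop B, hl.eventually_ge_atTop B, (hl.comp hl).eventually_ge_atTop 20, h4, h5] with t a b c d e
  exact ⟨a, b, c, d, e⟩
lemma exists_z {t l : ℝ} (hl : l = log t) (ht : 400 ≤ t) : ∃ z : ℕ, t ^ 20 ≤ z ∧ log z ≤ 40 * l := by
  refine ⟨⌈t⌉₊ ^ 20, ?_, ?_⟩
  · push_cast; gcongr; exact Nat.le_ceil t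
  · push_cast; rw [Real.log_pow]
    have : log ⌈t⌉₊ ≤ 2 * l := by
      rw [← Real.log_exp (2 * l)]
      apply Real.log_le_log
      · exact Nat.cast_pos.2 (Nat.ceil_pos.2 (by linarith))
      rw [two_mul, exp_add, hl, exp_log (by linarith)]
      have := Nat.ceil_lt_add_one (by linarith : 0 ≤ t)
      nlinarith
    push_cast; linarith
lemma exists_N {x y : ℕ} {t : ℝ} (h : t = log x) (ht : 400 ≤ t) (hy : (y:ℝ) ≤ x * t) : ∃ N : ℕ, (N:ℝ) ≤ 9 * t ∧ 3 * y < 2 ^ N := by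
  have hX0 : (0:ℝ) < x := by
    rcases Nat.eq_zero_or_pos x with h0 | h0
    · rw [h0, Nat.cast_zero, Real.log_zero] at h; linarith
    · exact_mod_cast h0
  have hxt : exp t = x := by rw [h, exp_log hX0]
  have htx : t ≤ x := by linarith [add_one_le_exp t]
  obtain ⟨N, h8N, hN⟩ : ∃ N : ℕ, 8 * t ≤ N ∧ (N:ℝ) < 8 * t + 1 := ⟨⌈8 * t⌉₊, Nat.le_ceil _, Nat.ceil_lt_add_one (by linarith)⟩
  refine ⟨N, by linarith, ?_⟩
  have : (3 * y : ℝ) < 2 ^ N := by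
    have h1 : exp (4 * t) ≤ (2:ℝ) ^ N := by
      rw [← Real.exp_log (by norm_num : (0:ℝ) < 2), ← exp_nat_mul]
      apply exp_le_exp.2; nlinarith [Real.log_two_gt_d9]
    have h2 : exp (4 * t) = x * x * (x * x) := by rw [← hxt, ← exp_add, ← exp_add]; ring_nf
    have h3 : (400:ℝ) ≤ x := ht.trans htx
    have h4 : (y:ℝ) ≤ x * x := hy.trans (by gcongr)
    have h5 : 160000 ≤ (x:ℝ) * x := by nlinarith
    nlinarith
  exact_mod_cast this
set_option maxHeartbeats 2000000 in
lemma core (M : ℝ) (hM : 0 < M) : ∃ x0 : ℕ, ∀ x ≥ x0, ∃ y : ℕ,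
    M * x * log x * log (log (log x)) / (log (log x)) ^ 2 ≤ y ∧ (y:ℝ) ≤ x * log x ∧
    ∃ a : ℕ → ℤ, ∀ e : ℕ, 1 ≤ e → e ≤ y → ∃ p : ℕ, p.Prime ∧ p ≤ 12 * (12 * x) ∧ (p:ℤ) ∣ e - a p := by
  have hCM : 1 ≤ CM := by have := add_one_le_exp (6:ℝ); show 1 ≤ 3 * exp 6; linarith
  obtain ⟨A0, hA⟩ : ∃ A0 : ℝ, A0 = 800 * CM * M := ⟨_, rfl⟩
  have hA0 : 0 < A0 := by rw [hA]; positivity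
  obtain ⟨K, hK⟩ : ∃ K : ℝ, K = 128 * A0 ^ 2 := ⟨_, rfl⟩
  obtain ⟨η, hη⟩ : ∃ η : ℝ, η = 1 / (8 * A0) := ⟨_, rfl⟩
  have hK0 : 0 < K := by rw [hK]; positivity
  have hη0 : 0 < η := by rw [hη]; positivity
  obtain ⟨k, W, x0, hk, hW, hNT⟩ := NT K η hη0 12 (by norm_num)
  obtain ⟨x1, hch⟩ := cheb2
  have hk1 : (1:ℝ) ≤ k := by exact_mod_cast hk
  have hW1 : (1:ℝ) ≤ W := by exact_mod_cast hW
  obtain ⟨B, B1, B2, B3, B4, B5, B6, B7, B8, B9⟩ : ∃ B : ℝ, 400 ≤ B ∧ 8 * CM ≤ B ∧ 2 * M ≤ B ∧ (k * W * 12 + 1) / M ≤ B ∧ 2 * k + W ≤ B ∧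
      36 * (k:ℝ) ^ 3 ≤ B ∧ 64 * A0 ≤ B ∧ 768 * k * A0 / K ≤ B ∧ 768 * k ^ 3 * CM ^ (4 * k) / K ≤ B := by
    have h := eventually_ge_atTop (α := ℝ)
    exact ((h 400).and ((h _).and ((h _).and ((h _).and ((h _).and ((h _).and ((h _).and ((h _).and (h _))))))))).exists
  have htend : Tendsto (fun x : ℕ => log x) atTop atTop := Real.tendsto_log_atTop.comp tendsto_natCast_atTop_atTop
  obtain ⟨x2, hx2⟩ := eventually_atTop.1 (htend.eventually (asy B (4 * k + 2)))
  refine ⟨max x0 (max x1 (max x2 2)), fun x hx => ?_⟩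
  simp only [ge_iff_le, max_le_iff] at hx
  obtain ⟨hx0, hx1, hx2', hx3⟩ := hx
  obtain ⟨b1, b2, h20, b4, b5⟩ := hx2 x hx2'
  obtain ⟨hP1, hP2, hT1⟩ := hch x hx1
  clear hx2
  have hX0 : (0:ℝ) < x := by exact_mod_cast (by omega : 0 < x)
  obtain ⟨t, ht⟩ : ∃ t : ℝ, t = log x := ⟨_, rfl⟩
  obtain ⟨l, hl⟩ : ∃ l : ℝ, l = log t := ⟨_, rfl⟩
  obtain ⟨m, hm⟩ : ∃ m : ℝ, m = log l := ⟨_, rfl⟩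
  simp only [← ht] at b1 b2 h20 b4 b5 hP1 hP2 hT1 ⊢
  simp only [← hl] at b2 h20 b4 ⊢
  simp only [← hm] at h20 ⊢
  have ht400 : 400 ≤ t := B1.trans b1
  have hl400 : 400 ≤ l := B1.trans b2
  have ht0 : 0 < t := by linarith only [ht400]
  have ht1 : 1 ≤ t := by linarith only [ht400]
  have hl0 : 0 < l := by linarith only [hl400]
  have hm1 : 1 ≤ m := by linarith only [h20]
  have hxt : exp t = x := by rw [ht, exp_log hX0]
  have htl : exp l = t := by rw [hl, exp_log ht0]
  have hlm : exp m = l := by rw [hm, exp_log hl0]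
  have hml : m ≤ l := by linarith only [add_one_le_exp m, hlm]
  have hlt : l ≤ t := by linarith only [add_one_le_exp l, htl]
  have htx : t ≤ x := by linarith only [add_one_le_exp t, hxt]
  have h400 : 400 * l ^ 2 ≤ t := le_trans (mlr B1 (sq_nonneg l)) b4
  obtain ⟨Y, hY⟩ : ∃ Y : ℝ, Y = M * x * t * m / l ^ 2 := ⟨_, rfl⟩
  have hYB : (k * W * 12 + 1) * x ≤ Y := by
    rw [hY, le_div_iff₀ (by positivity)]
    have h1 : (k * W * 12 + 1) / M * l ^ 2 ≤ t := le_trans (mlr B4 (sq_nonneg l)) b4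
    rw [div_mul_eq_mul_div, div_le_iff₀ hM] at h1
    have h2 : t * M * 1 ≤ t * M * m := by gcongr
    linarith only [mll (h1.trans (by linarith only [h2] : t * M ≤ t * M * m)) hX0.le]
  have hkW : 0 ≤ (k:ℝ) * W * 12 := by positivity
  have hYx : (x:ℝ) ≤ Y := by linarith only [mul_nonneg hkW hX0.le, hYB]
  have hY2 : 2 * Y ≤ x * t := by
    rw [hY, mul_div_assoc', div_le_iff₀ (by positivity)]
    have : 2 * M * m ≤ l ^ 2 := by rw [sq]; exact mul_le_mul (B3.trans b2) hml (by linarith only [hm1]) hl0.le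
    linarith only [mll this (by positivity : 0 ≤ x * t)]
  obtain ⟨y, hYy, hyY⟩ : ∃ y : ℕ, Y ≤ y ∧ (y:ℝ) ≤ 2 * Y :=
    ⟨⌈Y⌉₊, Nat.le_ceil Y, by have := (Nat.ceil_lt_add_one (by linarith only [hYx, hX0] : 0 ≤ Y)).le; linarith only [this, hYx, htx, ht400]⟩
  have hyxt : (y:ℝ) ≤ x * t := hyY.trans hY2
  have hxy : (x:ℝ) ≤ y := hYx.trans hYy
  have hxy' : x ≤ y := by exact_mod_cast hxy
  refine ⟨y, hYy.trans' hY.ge, hyxt, ?_⟩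
  obtain ⟨z, hzt, hzl⟩ := exists_z hl ht400
  have htz : t ≤ z := (le_self_pow₀ ht1 (by norm_num)).trans hzt
  have hz2 : 2 ≤ z := by exact_mod_cast (by linarith only [ht400, htz] : (2:ℝ) ≤ z)
  obtain ⟨V, hV⟩ : ∃ V : ℝ, V = t * m / (10 * l) := ⟨_, rfl⟩
  have hV40 : 40 * l ≤ V := by
    rw [hV, le_div_iff₀ (by positivity)]; linarith only [h400, mll hm1 ht0.le]
  have hVt : V ≤ t := by
    rw [hV, div_le_iff₀ (by positivity)]; exact mll (by linarith only [hml, hl0]) ht0.le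
  obtain ⟨v, hvV, hVv⟩ : ∃ v : ℕ, (v:ℝ) ≤ exp V ∧ exp V < v + 1 := ⟨⌊exp V⌋₊, Nat.floor_le (exp_pos V).le, Nat.lt_floor_add_one _⟩
  have hvx : v ≤ x := by
    have : (v:ℝ) ≤ x := hvV.trans (by rw [← hxt]; gcongr)
    exact_mod_cast this
  have hzv : z ≤ v := by
    have h1 : (z:ℝ) ≤ exp V := by
      rw [← Real.exp_log (by linarith only [ht400, htz] : (0:ℝ) < z)]; gcongr; linarith only [hV40, hzl]
    have : (z:ℝ) < v + 1 := lt_of_le_of_lt h1 hVv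
    exact Nat.lt_succ_iff.1 (by exact_mod_cast this)
  have hv2 : 2 ≤ v := hz2.trans hzv
  have hlv : log v ≤ V := by
    rw [← Real.log_exp V]; exact Real.log_le_log (by exact_mod_cast (by omega)) hvV
  obtain ⟨S, hS⟩ : ∃ S : Finset ℕ, S = v.primesLE.filter (z < ·) := ⟨_, rfl⟩
  obtain ⟨P, hP⟩ : ∃ P : Finset ℕ, P = (12 * x).primesLE.filter (x < ·) := ⟨_, rfl⟩
  obtain ⟨T, hT⟩ : ∃ T : Finset ℕ, T = y.primesLE.filter (x < ·) := ⟨_, rfl⟩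
  obtain ⟨P', hP'⟩ : ∃ P' : Finset ℕ, P' = (12 * (12 * x)).primesLE.filter (12 * x < ·) := ⟨_, rfl⟩
  have hS' : ∀ s ∈ S, s.Prime ∧ z < s ∧ s ≤ v := by
    intro s hs; rw [hS] at hs; simp only [mem_filter, Nat.mem_primesLE] at hs; exact ⟨hs.1.2, hs.2, hs.1.1⟩
  have hPm : ∀ p ∈ P, p.Prime ∧ x < p ∧ p ≤ 12 * x := by
    intro s hs; rw [hP] at hs; simp only [mem_filter, Nat.mem_primesLE] at hs; exact ⟨hs.1.2, hs.2, hs.1.1⟩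
  have hTm : ∀ p ∈ T, p.Prime ∧ x < p ∧ p ≤ y := by
    intro s hs; rw [hT] at hs; simp only [mem_filter, Nat.mem_primesLE] at hs; exact ⟨hs.1.2, hs.2, hs.1.1⟩
  have hyB : (k * W * 12 + 1) * x ≤ y := by
    have : ((k * W * 12 + 1) * x : ℝ) ≤ y := hYB.trans hYy
    exact_mod_cast this
  rw [← hP] at hP1
  rw [← hP'] at hP2
  obtain ⟨wt, w0, w1, w2, w3⟩ := hNT x hx0 y hyB P T hPm hTm (by rw [← ht]; exact hP1)
  rw [← ht] at w3
  have hsz : ∀ s ∈ S, 2 * k ≤ s ∧ W < s := by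
    intro s hs
    obtain ⟨-, h2, -⟩ := hS' s hs
    have h3 : (2 * k + W : ℝ) ≤ z := (B5.trans b1).trans htz
    have h4 : 2 * k + W ≤ z := by exact_mod_cast h3
    omega
  obtain ⟨N, hN9, hy2N⟩ := exists_N ht ht400 hyxt
  have hSH : SH x y k W N (t ^ 20) (1 / t ^ 10) S P T wt := by
    refine ⟨fun s hs => ⟨(hS' s hs).1, (hsz s hs).1, (hsz s hs).2, (hS' s hs).2.2.trans hvx, hzt.trans (Nat.cast_le.2 (hS' s hs).2.1.le)⟩,
      fun p hp => ⟨(hPm p hp).1, (hPm p hp).2.1, ?_⟩, fun t ht => (hTm t ht).2.2, hk, hW, by omega, ?_, by positivity, by positivity,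
      eps_app ht1 hN9 (B6.trans b1), hy2N, w0, w1, w2⟩
    · calc k * W * p ≤ k * W * (12 * x) := Nat.mul_le_mul_left _ (hPm p hp).2.2
        _ ≤ (k * W * 12 + 1) * x := Nat.le.intro (k := x) (by ring)
        _ ≤ _ := hyB
    · exact_mod_cast (by linarith only [B5, b1, htx, hk1, hW1] : (k:ℝ) ≤ x)
  have hy0 : 0 < y := by omega
  have hy0' : (0:ℝ) < y := by exact_mod_cast hy0
  obtain ⟨n, f, hnf⟩ := hSH.final hy0 (K * (x / y)) (by positivity)
  obtain ⟨F, hF⟩ : ∃ F : Finset ℕ, F = open Classical in (Icc 1 y).filter (fun e => ∀ p ∈ (y+1).primesLE, p ∣ e → p ≤ v) := ⟨_, rfl⟩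
  have hFm : ∀ e, e ∈ F ↔ 1 ≤ e ∧ e ≤ y ∧ ∀ p : ℕ, p.Prime → p ∣ e → p ≤ v := by
    intro e; rw [hF]; simp only [mem_filter, mem_Icc, Nat.mem_primesLE]
    constructor
    · rintro ⟨⟨h1, h2⟩, h3⟩
      exact ⟨h1, h2, fun p hp hd => h3 p ⟨by have := Nat.le_of_dvd (by omega) hd; omega, hp⟩ hd⟩
    · rintro ⟨h1, h2, h3⟩
      exact ⟨⟨h1, h2⟩, fun p hp hd => h3 p hp.2 hd⟩
  have hFc : (#F : ℝ) ≤ x / (8 * t) := rankin_app (by omega) ht hl hm h20 (by linarith only [hl400]) h400 (B2.trans b1) hyxt hv2 (by rw [← hV]; exact hlv) F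
    (fun e he => (hFm e).1 he)
  have hσ0 := hSH.sg_pos 1 hk
  have hσeq := sg_one_eq z v hzv
  rw [← hS] at hσeq
  have hPv := mertens_lower v
  have hPz := mertens_upper z hz2
  have hPv' := mertens_upper v hv2
  have hPz1 := PP_ge_one z
  have hVv' : V ≤ log (v + 1) := by rw [← Real.log_exp V]; exact Real.log_le_log (exp_pos _) hVv.le
  have hσV : sg S 1 * V ≤ CM * (40 * l) := by
    calc sg S 1 * V ≤ sg S 1 * PP v := by gcongr; exact hVv'.trans hPv
      _ = PP z := hσeq
      _ ≤ CM * log z := hPz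
      _ ≤ _ := by gcongr
  have hσlow : 1 / (CM * t) ≤ sg S 1 := by
    rw [div_le_iff₀ (by positivity)]
    calc 1 ≤ PP z := hPz1
      _ = sg S 1 * PP v := hσeq.symm
      _ ≤ _ := by gcongr; exact hPv'.trans (by show CM * _ ≤ _; gcongr; exact hlv.trans hVt)
  have hσ1 : sg S 1 ≤ 1 := by
    refine prod_le_one (fun s hs => ?_) (fun s hs => ?_)
    · have : (1:ℝ) ≤ s := by exact_mod_cast (hS' s hs).1.one_le
      rw [sub_nonneg]; push_cast; exact div_le_one_of_le₀ this (by linarith only [this])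
    · have : (0:ℝ) ≤ (1:ℕ) / (s:ℝ) := by positivity
      linarith only [this]
  have hσy : sg S 1 * y ≤ A0 * x := by
    have h1 : V * Y = M * x * t ^ 2 * m ^ 2 / (10 * l ^ 3) := by rw [hV, hY]; field_simp
    have hV0 : 0 < V := by linarith only [hV40, hl0]
    have h2 : sg S 1 ≤ CM * (40 * l) / V := by rw [le_div_iff₀ hV0]; exact hσV
    calc sg S 1 * y ≤ CM * (40 * l) / V * (2 * Y) := by gcongr
      _ = A0 * x := by rw [hV, hY, hA]; have : 0 < m := by linarith only [hm1]
                       field_simp; norm_num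
  obtain ⟨q, hq⟩ : ∃ q : ℝ, q = (1 / (CM * t)) ^ (2 * k) := ⟨_, rfl⟩
  have hq0 : 0 < q := by rw [hq]; positivity
  have hqs : q ≤ sg S k := by
    rw [hq]
    calc _ ≤ sg S 1 ^ (2 * k) := by gcongr
      _ ≤ _ := sg_pow S k (fun s hs => ⟨(hsz s hs).1, (hS' s hs).1.two_le⟩)
  have hr : √(x:ℝ) = exp (t / 2) := by
    rw [Real.sqrt_eq_iff_mul_self_eq hX0.le (exp_pos _).le, ← exp_add, ← hxt]; ring_nf
  have c4 : 768 * (k:ℝ) ^ 3 * t ^ 2 ≤ K * q ^ 2 * √(x:ℝ) := by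
    have h1 : 768 * (k:ℝ) ^ 3 * CM ^ (4 * k) / K * t ^ (4 * k + 2) ≤ √x := by
      rw [hr]; refine le_trans ?_ b5; gcongr
    have h2 : q ^ 2 = 1 / (CM ^ (4 * k) * t ^ (4 * k)) := by
      rw [hq, ← pow_mul, div_pow, one_pow, mul_pow]; ring_nf
    calc 768 * (k:ℝ) ^ 3 * t ^ 2 = K * q ^ 2 * (768 * (k:ℝ) ^ 3 * CM ^ (4 * k) / K * t ^ (4 * k + 2)) := by
          rw [h2, pow_add]; field_simp
      _ ≤ _ := by gcongr
  have c2 : 64 * (k:ℝ) * t ^ 2 ≤ K * q ^ 2 * √(x:ℝ) := by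
    refine le_trans ?_ c4
    have : (k:ℝ) ≤ k ^ 3 := le_self_pow₀ hk1 (by norm_num)
    gcongr; norm_num
  have ht10 : t ≤ t ^ 10 := le_self_pow₀ ht1 (by norm_num)
  have c1 : 64 * A0 * (1 / t ^ 10) ≤ 1 := by
    rw [mul_one_div, div_le_one (by positivity)]; exact (B7.trans b1).trans ht10
  have c3 : 768 * (k:ℝ) * A0 * (1 / t ^ 10) * t ≤ K := by
    have h1 : 768 * k * A0 / K ≤ t := B8.trans b1
    rw [div_le_iff₀ hK0] at h1
    have h2 : t * t ≤ t ^ 10 := by rw [← sq]; exact pow_le_pow_right₀ ht1 (by norm_num)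
    calc _ = 768 * (k:ℝ) * A0 * t / t ^ 10 := by ring
      _ ≤ _ := by
        rw [div_le_iff₀ (by positivity)]
        linarith only [mlr h1 ht0.le, mlr h2 hK0.le]
  have hτ := hT1 y hxy'
  rw [← hT] at hτ
  have hpn : (#P : ℝ) ≤ 12 * x := by
    have h1 : P ⊆ Icc 1 (12 * x) := fun p hp => mem_Icc.2 ⟨(hPm p hp).1.one_le, (hPm p hp).2.2⟩
    have h2 := card_le_card h1
    rw [Nat.card_Icc] at h2
    exact_mod_cast (by omega : #P ≤ 12 * x)
  have hfin := final_num hX0 ht0 hσ0 hσ1 hq0 hqs hy0' hyxt hA0 hσy hK hη (by positivity : 0 ≤ 1 / t ^ 10) hτ w3 hpn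
    (by linarith only [hk1] : (0:ℝ) < k) (by rw [hr]; positivity : 0 < √(x:ℝ)) c1 c2 c3 c4 hFc
  refine cover_fin x y z v 12 hzv hvx (by norm_num) n f ?_ (V := F) ?_ (fun e h1 h2 h3 => (hFm e).2 ⟨h1, h2, h3⟩) P' ?_ ?_
    (U := T.filter fun t : ℕ => sv S n {(t:ℤ)} = 1 ∧ ∀ p ∈ P, ¬ (p:ℤ) ∣ (f p : ℤ) - t)
  · have : (y:ℝ) ≤ x * z := hyxt.trans (by gcongr)
    exact_mod_cast this
  · intro u hu1 hu2 hu3 hu4 hu5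
    rw [mem_filter]
    refine ⟨by rw [hT]; simp [Nat.mem_primesLE, *], ?_, fun p hp => hu5 p (hPm p hp).1 (hPm p hp).2.1 (hPm p hp).2.2⟩
    rw [sv_eq, if_pos]
    simp only [mem_singleton, forall_eq]
    exact fun s hs => hu4 s (hS' s hs).1 (hS' s hs).2.1 (hS' s hs).2.2
  · intro p hp; rw [hP'] at hp; simp only [mem_filter, Nat.mem_primesLE] at hp; exact ⟨hp.1.2, hp.2, hp.1.1⟩
  · have : ((#(T.filter fun t : ℕ => sv S n {(t:ℤ)} = 1 ∧ ∀ p ∈ P, ¬ (p:ℤ) ∣ (f p : ℤ) - t) : ℝ) + #F) ≤ #P' :=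
      le_trans (le_trans (by gcongr) hfin) hP2
    exact_mod_cast this
end
section
theorem ford_green_konyagin_tao_maynard_large_gaps :
    ∀ M > (0 : ℝ), ∃ X₀ : ℝ, ∀ X ≥ X₀,
      G X ≥ M * (Real.log X * iterlog 2 X * iterlog 4 X) / (iterlog 3 X) ^ 2 := by
  intro M hM
  obtain ⟨x0, hcore⟩ := core (2400 * M) (by positivity)
  have hl := Real.tendsto_log_atTop
  have key : ∀ᶠ X : ℝ in atTop, G X ≥ M * (log X * iterlog 2 X * iterlog 4 X) / (iterlog 3 X) ^ 2 := by
    filter_upwards [hl.eventually (asy 2000 2), (hl.comp hl).eventually (asy 2000 0), hl.eventually_ge_atTop (600 * (x0 + 1 : ℝ)),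
      eventually_gt_atTop 0] with X h1 h2 h3 hX0
    obtain ⟨T, hT⟩ : ∃ T : ℝ, T = log X := ⟨_, rfl⟩
    obtain ⟨s, hs⟩ : ∃ s : ℝ, s = log T := ⟨_, rfl⟩
    obtain ⟨u, hu⟩ : ∃ u : ℝ, u = log s := ⟨_, rfl⟩
    obtain ⟨r, hr⟩ : ∃ r : ℝ, r = log u := ⟨_, rfl⟩
    have i2 : iterlog 2 X = s := by rw [hs, hT]; rfl
    have i3 : iterlog 3 X = u := by rw [hu, ← i2]; rfl
    have i4 : iterlog 4 X = r := by rw [hr, ← i3]; rfl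
    rw [i2, i3, i4]
    simp only [Function.comp, ← hT, ← hs, ← hu, ← hr] at h1 h2 h3 ⊢
    obtain ⟨a1, -, -, -, a5⟩ := h1
    obtain ⟨d1, d2, d3, -, -⟩ := h2
    obtain ⟨x, hxT, hTx⟩ : ∃ x : ℕ, (x:ℝ) ≤ T / 288 ∧ T / 288 < x + 1 := ⟨⌊T / 288⌋₊, Nat.floor_le (by linarith), Nat.lt_floor_add_one _⟩
    have hx600 : T / 600 ≤ x := by linarith
    have hxpos : (0:ℝ) < x := by linarith
    have hxx0 : x0 ≤ x := by
      have : (x0:ℝ) ≤ x := by linarith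
      exact_mod_cast this
    obtain ⟨y, hy1, hy2, a, ha⟩ := hcore x hxx0
    have hX : exp T = X := by rw [hT, exp_log hX0]
    have l2 : log 2 ≤ 1 := by linarith [Real.log_two_lt_d9]
    have t1 : log x ≤ s := by rw [hs]; exact Real.log_le_log hxpos (by linarith)
    have t2 : s / 2 ≤ log x := by
      have h5 : log (T / 600) ≤ log x := Real.log_le_log (by linarith) hx600
      rw [Real.log_div (by linarith) (by norm_num), ← hs] at h5
      have := Real.log_le_sub_one_of_pos (by norm_num : (0:ℝ) < 600)
      linarith
    obtain ⟨t, ht⟩ : ∃ t : ℝ, t = log x := ⟨_, rfl⟩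
    rw [← ht] at t1 t2 hy1 hy2
    have l1 : log t ≤ u := by rw [hu]; exact Real.log_le_log (by linarith) t1
    have l3 : u / 2 ≤ log t := by
      have h5 : log (s / 2) ≤ log t := Real.log_le_log (by linarith) t2
      rw [Real.log_div (by linarith) (by norm_num), ← hu] at h5
      linarith
    obtain ⟨l, hl⟩ : ∃ l : ℝ, l = log t := ⟨_, rfl⟩
    rw [← hl] at l1 l3 hy1
    have m1 : r / 2 ≤ log l := by
      have h5 : log (u / 2) ≤ log l := Real.log_le_log (by linarith) l3
      rw [Real.log_div (by linarith) (by norm_num), ← hr] at h5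
      linarith
    have hl0 : 0 < l := by linarith
    have hxQ : 2 ≤ 12 * (12 * x) := by
      have : 0 < x := by exact_mod_cast hxpos
      omega
    refine ge_iff_le.2 (le_trans ?_ (gap_red (12 * (12 * x)) y a hxQ ha X ?_))
    · refine le_trans ?_ hy1
      have hT0 : 0 ≤ T := by linarith
      have hs0 : 0 ≤ s := by linarith
      have hr0 : 0 ≤ r := by linarith
      have hM0 := hM.le
      have ht0 : 0 ≤ t := by linarith only [t2, d1]
      have hm0 : 0 ≤ log l := by linarith only [m1, d3]
      calc M * (T * s * r) / u ^ 2 = 2400 * M * (T / 600) * (s / 2) * (r / 2) / u ^ 2 := by ring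
        _ ≤ _ := by gcongr
    · have hy3 : (y:ℝ) ≤ T ^ 2 := by
        have : t ≤ x := by rw [ht]; linarith only [Real.log_le_sub_one_of_pos hxpos]
        rw [sq]; exact hy2.trans (mul_le_mul (by linarith only [hxT, a1]) (by linarith only [this, hxT, a1]) (by linarith only [t2, d1]) (by linarith only [a1]))
      have hQ : ((12 * (12 * x) : ℕ) : ℝ) ≤ T / 2 := by push_cast; linarith
      have h4 : (4:ℝ) ^ (12 * (12 * x)) ≤ exp (7 / 10 * T) := by
        have e4 : (4:ℝ) = exp (2 * log 2) := by rw [two_mul, exp_add, exp_log (by norm_num)]; norm_num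
        rw [e4, ← exp_nat_mul]; apply exp_le_exp.2
        have h6 := Real.log_two_lt_d9
        have h7 := mul_le_mul hQ (by linarith only [h6] : 2 * log 2 ≤ 7 / 5) (by positivity) (by linarith only [a1])
        linarith only [h7]
      have e1 : exp (7 / 10 * T) * exp (3 / 10 * T) = X := by rw [← exp_add, ← hX]; ring_nf
      have e2 : exp (T / 2) * exp (T / 2) = X := by rw [← exp_add, ← hX]; ring_nf
      have e3 := add_one_le_exp (3 / 10 * T)
      have e4 := add_one_le_exp (T / 2)
      have p1 := exp_pos (7 / 10 * T)
      have p2 := exp_pos (T / 2)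
      have q1 : 4 * exp (7 / 10 * T) ≤ X := by rw [← e1, mul_comm]; exact mll (by linarith only [e3, a1]) p1.le
      have q2 : 8 * exp (T / 2) ≤ X := by rw [← e2, mul_comm]; exact mll (by linarith only [e4, a1]) p2.le
      have q3 : T ≤ T ^ 2 := by nlinarith only [a1]
      linarith only [q1, q2, q3, h4, hQ, hy3, a5, p2]
  exact eventually_atTop.1 key
end
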